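/- arXiv:1507.03076 — 2 statements merged into one kernel-verified Lean document; each statement's English description precedes it below -/
import Mathlib

section
/- The pseudovariety DA is ω-reducible for idempotent pointlike sets: let S be a finite semigroup and P a DA-idempotent pointlike subset of S. Then for every finite alphabet A and every surjective homomorphism φ: A⁺ → S from the free semigroup on A, there exists a family (w_p)_{p∈P} of ω-terms over A such that, for each p ∈ P, w_p evaluates to p in S under the letter assignment given by φ restricted to A, and for every finite semigroup T in DA and every map from A to T, all the terms w_p evaluate to one and the same idempotent element of T. -/
/-- `spow s n` is the power `s^(n+1)` of `s`, defined in any magma. -/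
def spow {S : Type*} [Mul S] (s : S) (n : ℕ) : S := (fun x => x * s)^[n] s

/-- A finite semigroup lies in `DA` if each of its regular elements is
idempotent, where `s` is regular if `s = s * x * s` for some `x`. -/
def InDA (T : Type) [Semigroup T] : Prop :=
  ∀ t : T, (∃ x : T, t = t * x * t) → IsIdempotentElem t

/-- ω-terms over the alphabet `A`: letters, binary multiplication and the
unary ω-power. -/
inductive OTerm (A : Type) : Type
  | letter : A → OTerm A
  | mul : OTerm A → OTerm A → OTerm A
  | omPow : OTerm A → OTerm A

/-- The evaluation relation for ω-terms in a semigroup `T`, given an assignment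
`f` of letters.  The ω-power of an element `s` is the (unique, in a finite
semigroup) idempotent power of `s`. -/
inductive OEval {A T : Type} [Semigroup T] (f : A → T) : OTerm A → T → Prop
  | letter (a : A) : OEval f (OTerm.letter a) (f a)
  | mul {u v : OTerm A} {s t : T} :
      OEval f u s → OEval f v t → OEval f (OTerm.mul u v) (s * t)
  | omPow {u : OTerm A} {s e : T} :
      OEval f u s →
      IsIdempotentElem e → (∃ n : ℕ, spow s n = e) →
      OEval f (OTerm.omPow u) e

/-- `P` is idempotent pointlike for the pseudovariety `DA`: for every finite
semigroup `T` in `DA` and every subsemigroup `R` of `S × T` projecting onto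
`S`, some idempotent `t ∈ T` is related to every element of `P`. -/
def IsDAIdempotentPointlike {S : Type} [Semigroup S] (P : Set S) : Prop :=
  ∀ (T : Type) [Semigroup T] [Finite T], InDA T →
    ∀ R : Subsemigroup (S × T),
      (∀ s : S, ∃ t : T, (s, t) ∈ R) →
      ∃ t : T, IsIdempotentElem t ∧ ∀ p ∈ P, (p, t) ∈ R

namespace DAProof

open Pointwise

/-! ### Finite monoids in DA -/

theorem exists_idem_pow {M : Type*} [Monoid M] [Finite M] (x : M) :
    ∃ n : ℕ, 0 < n ∧ IsIdempotentElem (x ^ n) := by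
  obtain ⟨i, j, hne, hij⟩ := Finite.exists_ne_map_eq_of_infinite (fun n : ℕ => x ^ n)
  wlog hlt : i < j generalizing i j
  · exact this j i hne.symm hij.symm (by omega)
  obtain ⟨d, rfl⟩ := Nat.exists_eq_add_of_lt hlt
  have hij : x ^ i = x ^ (i + (d + 1)) := hij
  have h1 : ∀ k, x ^ i = x ^ (i + (d + 1) * k) := by
    intro k
    induction k with
    | zero => simp
    | succ k ih =>
      rw [show i + (d + 1) * (k + 1) = (i + (d + 1)) + (d + 1) * k by ring, pow_add, ← hij,
        ← pow_add, ← ih]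
  refine ⟨(d + 1) * (i + 1), by positivity, ?_⟩
  have h2 : (d + 1) * (i + 1) = i + (d * (i + 1) + 1) := by ring
  have h3 : x ^ ((d + 1) * (i + 1)) = x ^ i * x ^ (d * (i + 1) + 1) := by
    rw [h2, pow_add]
  unfold IsIdempotentElem
  nth_rewrite 2 [h3]
  rw [← mul_assoc, ← pow_add, add_comm, ← h1, ← h3]

/-- The idempotent power of an element of a finite monoid. -/
noncomputable def om {M : Type*} [Monoid M] [Finite M] (x : M) : M :=
  x ^ (exists_idem_pow x).choose

theorem om_spec {M : Type*} [Monoid M] [Finite M] (x : M) :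
    ∃ n : ℕ, 0 < n ∧ om x = x ^ n := ⟨_, (exists_idem_pow x).choose_spec.1, rfl⟩

theorem om_idem {M : Type*} [Monoid M] [Finite M] (x : M) : om x * om x = om x :=
  (exists_idem_pow x).choose_spec.2

theorem om_pow {M : Type*} [Monoid M] [Finite M] (x : M) (m : ℕ) (hm : 0 < m) :
    om (x ^ m) = om x := by
  obtain ⟨k, hk, h1⟩ := om_spec x
  obtain ⟨j, hj, h2⟩ := om_spec (x ^ m)
  have e1 : (om x) ^ (m * j) = om x := IsIdempotentElem.pow_eq (om_idem x) (by positivity)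
  have e2 : (om (x ^ m)) ^ k = om (x ^ m) := IsIdempotentElem.pow_eq (om_idem _) (by omega)
  rw [← e1, ← e2, h1, h2, ← pow_mul, ← pow_mul, ← pow_mul]
  congr 1
  ring

theorem om_of_fix {M : Type*} [Monoid M] [Finite M] (z h : M) (hz : z = z * h) :
    z * om h = z := by
  obtain ⟨k, hk, h1⟩ := om_spec h
  rw [h1]
  clear hk h1
  induction k with
  | zero => simp
  | succ k ih => rw [pow_succ, ← mul_assoc, ih, ← hz]

section da
variable {N : Type} [Monoid N]

theorem da_om_mul [Finite N] (hN : InDA N) (s : N) : om s * s = om s := by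
  obtain ⟨k, hk, h1⟩ := om_spec s
  have hi := om_idem s
  have hc : om s * s = s * om s := by rw [h1, ← pow_succ, ← pow_succ']
  have hreg : IsIdempotentElem (om s * s) := by
    apply hN
    refine ⟨s ^ (k - 1), ?_⟩
    have : s * s ^ (k - 1) = om s := by
      rw [h1, ← pow_succ']; congr 1; omega
    rw [mul_assoc (om s), this, hi, ← mul_assoc, hi]
  have h2 : om s * s * s = om s * s := by
    calc om s * s * s = om s * (om s * s) * s := by rw [← mul_assoc, hi]
      _ = om s * (s * om s) * s := by rw [hc]
      _ = om s * s * (om s * s) := by simp only [mul_assoc]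
      _ = om s * s := hreg
  have h3 : ∀ j, om s * s ^ (j + 1) = om s * s := by
    intro j
    induction j with
    | zero => simp
    | succ j ih => rw [pow_succ, ← mul_assoc, ih, h2]
  have h4 := h3 (k - 1)
  rw [show k - 1 + 1 = k by omega, ← h1, hi] at h4
  exact h4.symm

theorem da_om_mul_pow [Finite N] (hN : InDA N) (s : N) (k : ℕ) : om s * s ^ k = om s := by
  induction k with
  | zero => simp
  | succ k ih => rw [pow_succ, ← mul_assoc, ih, da_om_mul hN]

theorem da_factor (hN : InDA N) (e p x q : N) (he : e * e = e) (h : e = p * x * q) : e * x * e = e := by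
  have h0 : e * p * x * q * e = e := by
    calc e * p * x * q * e = e * (p * x * q) * e := by simp only [mul_assoc]
      _ = e := by rw [← h, he, he]
  have h1 : x * q * e * (x * q * e) = x * q * e := by
    apply hN
    refine ⟨p, ?_⟩
    calc x * q * e = x * q * e := rfl
      _ = x * q * (e * p * x * q * e) := by rw [h0]
      _ = _ := by simp only [mul_assoc]
  have h2 : e * x * q * e = e := by
    calc e * x * q * e = (e * p * x * q * e) * x * q * e := by rw [h0]
      _ = e * p * (x * q * e * (x * q * e)) := by simp only [mul_assoc]
      _ = e * p * x * q * e := by rw [h1]; simp only [mul_assoc]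
      _ = e := h0
  have h3 : e * x * (e * x) = e * x := by
    apply hN
    refine ⟨q * e, ?_⟩
    calc e * x = (e * x * q * e) * x := by rw [h2]
      _ = (e * x * q * (e * e)) * x := by rw [he]
      _ = _ := by simp only [mul_assoc]
  calc e * x * e = e * x * (e * x * q * e) := by rw [h2]
    _ = (e * x * (e * x)) * q * e := by simp only [mul_assoc]
    _ = e := by rw [h3, h2]

theorem da_mul (hN : InDA N) (e x y : N) (hx : e * x * e = e) (hy : e * y * e = e) :
    e * (x * y) * e = e := by
  have h1 : y * e * x * (y * e * x) = y * e * x := by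
    apply hN
    refine ⟨e, ?_⟩
    calc y * e * x = y * (e * y * e) * x := by rw [hy]
      _ = y * ((e * x * e) * y * e) * x := by rw [hx]
      _ = _ := by simp only [mul_assoc]
  calc e * (x * y) * e = (e * y * e) * (x * y) * (e * x * e) := by rw [hx, hy]
    _ = e * (y * e * x * (y * e * x)) * e := by simp only [mul_assoc]
    _ = (e * y * e) * x * e := by rw [h1]; simp only [mul_assoc]
    _ = e := by rw [hy, hx]

end da

/-! ### Terms with a unit -/

inductive ETerm (A : Type) : Type
  | one : ETerm A
  | letter : A → ETerm A
  | mul : ETerm A → ETerm A → ETerm A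
  | pow : ETerm A → ETerm A

variable {A : Type}

noncomputable def ev {N : Type} [Monoid N] [Finite N] (f : A → N) : ETerm A → N
  | .one => 1
  | .letter a => f a
  | .mul u v => ev f u * ev f v
  | .pow u => om (ev f u)

def tal : ETerm A → Set A
  | .one => ∅
  | .letter a => {a}
  | .mul u v => tal u ∪ tal v
  | .pow u => tal u

theorem ev_factor {N : Type} [Monoid N] [Finite N] (f : A → N) (a : A) (w : ETerm A)
    (h : a ∈ tal w) : ∃ p q, ev f w = p * f a * q := by
  induction w with
  | one => exact absurd h (by simp [tal])
  | letter b => 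
    obtain rfl : a = b := h
    exact ⟨1, 1, by simp [ev]⟩
  | mul u v hu hv =>
    rcases h with h | h
    · obtain ⟨p, q, e⟩ := hu h
      exact ⟨p, q * ev f v, by simp only [ev, e, mul_assoc]⟩
    · obtain ⟨p, q, e⟩ := hv h
      exact ⟨ev f u * p, q, by simp only [ev, e, mul_assoc]⟩
  | pow u hu =>
    obtain ⟨p, q, e⟩ := hu h
    obtain ⟨k, hk, h1⟩ := om_spec (ev f u)
    obtain ⟨k, rfl⟩ : ∃ j, k = j + 1 := ⟨k - 1, by omega⟩
    refine ⟨p, q * ev f u ^ k, ?_⟩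
    simp only [ev]
    rw [h1, pow_succ', ← mul_assoc, ← e]

/-- `e · w · e = e` whenever the content of `w` is contained in that of `ε`, `e = ε^ω`. -/
theorem ev_absorb {N : Type} [Monoid N] [Finite N] (hN : InDA N) (f : A → N) (ε w : ETerm A)
    (h : tal w ⊆ tal ε) : om (ev f ε) * ev f w * om (ev f ε) = om (ev f ε) := by
  induction w with
  | one => simp [ev, om_idem]
  | letter a =>
    obtain ⟨p, q, e⟩ := ev_factor f a (.pow ε) (h rfl)
    exact da_factor hN _ _ _ _ (om_idem _) e
  | mul u v hu hv =>
    exact da_mul hN _ _ _ (hu fun _ hx => h (Or.inl hx)) (hv fun _ hx => h (Or.inr hx))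
  | pow u hu =>
    obtain ⟨k, hk, h1⟩ := om_spec (ev f u)
    simp only [ev]
    rw [h1]
    clear hk h1
    induction k with
    | zero => simp [om_idem]
    | succ k ih => rw [pow_succ]; exact da_mul hN _ _ _ ih (hu h)

theorem ev_mid {N : Type} [Monoid N] [Finite N] (hN : InDA N) (f : A → N) (ε ε' w : ETerm A)
    (h : tal w ⊆ tal ε) (h' : tal ε' = tal ε) :
    om (ev f ε) * ev f w * om (ev f ε') = om (ev f ε) * om (ev f ε') := by
  have h1 := ev_absorb hN f ε' (.pow ε) h'.ge
  have h2 := ev_absorb hN f ε (.mul w (.pow ε')) (by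
    rintro x (hx | hx)
    · exact h hx
    · exact h' ▸ hx)
  simp only [ev] at h1 h2
  calc om (ev f ε) * ev f w * om (ev f ε')
      = om (ev f ε) * ev f w * (om (ev f ε') * om (ev f ε) * om (ev f ε')) := by rw [h1]
    _ = (om (ev f ε) * (ev f w * om (ev f ε')) * om (ev f ε)) * om (ev f ε') := by
        simp only [mul_assoc]
    _ = _ := by rw [h2]

/-- Equality over DA. -/
def Eqv (w w' : ETerm A) : Prop :=
  ∀ (N : Type) [Monoid N] [Finite N], InDA N → ∀ f : A → N, ev f w = ev f w'

def tnpow (w : ETerm A) : ℕ → ETerm A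
  | 0 => .one
  | k + 1 => .mul (tnpow w k) w

theorem ev_tnpow {N : Type} [Monoid N] [Finite N] (f : A → N) (w : ETerm A) (k : ℕ) :
    ev f (tnpow w k) = ev f w ^ k := by
  induction k with
  | zero => simp [tnpow, ev]
  | succ k ih => simp [tnpow, ev, ih, pow_succ]

section good
variable {M : Type} [Monoid M] [Finite M] (g : A → M)

def Good (Q : Set M) (w₀ : ETerm A) : Prop :=
  ∀ q ∈ Q, ∃ w, ev g w = q ∧ Eqv w w₀

def GoodA (Q : Set M) (B : Set A) : Prop := ∃ w, tal w = B ∧ Good g Q w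

variable {g}

theorem Good.mono {Q Q' : Set M} {w : ETerm A} (h : Good g Q w) (hs : Q' ⊆ Q) : Good g Q' w :=
  fun q hq => h q (hs hq)

theorem Good.eqv {Q : Set M} {w w' : ETerm A} (h : Good g Q w) (hs : Eqv w w') : Good g Q w' := by
  intro q hq
  obtain ⟨v, h1, h2⟩ := h q hq
  exact ⟨v, h1, fun N _ _ hN f => (h2 N hN f).trans (hs N hN f)⟩

theorem Good.mul {Q Q' : Set M} {w w' : ETerm A} (h : Good g Q w) (h' : Good g Q' w') :
    Good g (Q * Q') (.mul w w') := by
  rintro _ ⟨q, hq, q', hq', rfl⟩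
  obtain ⟨v, h1, h2⟩ := h q hq
  obtain ⟨v', h1', h2'⟩ := h' q' hq'
  refine ⟨.mul v v', by simp [ev, h1, h1'], fun N _ _ hN f => ?_⟩
  simp only [ev]
  rw [h2 N hN f, h2' N hN f]

theorem good_one : Good g 1 (.one : ETerm A) := by
  rintro _ rfl
  exact ⟨.one, rfl, fun N _ _ hN f => rfl⟩

theorem good_letter (a : A) : Good g {g a} (.letter a) := by
  rintro _ rfl
  exact ⟨.letter a, rfl, fun N _ _ hN f => rfl⟩

theorem Good.npow {Q : Set M} {w : ETerm A} (h : Good g Q w) (k : ℕ) :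
    Good g (Q ^ k) (tnpow w k) := by
  induction k with
  | zero => simpa [tnpow] using good_one
  | succ k ih => rw [pow_succ]; exact ih.mul h

theorem GoodA.mono {Q Q' : Set M} {B : Set A} (h : GoodA g Q B) (hs : Q' ⊆ Q) : GoodA g Q' B := by
  obtain ⟨w, h1, h2⟩ := h
  exact ⟨w, h1, h2.mono hs⟩

theorem GoodA.mul {Q Q' : Set M} {B B' : Set A} (h : GoodA g Q B) (h' : GoodA g Q' B') :
    GoodA g (Q * Q') (B ∪ B') := by
  obtain ⟨w, rfl, h2⟩ := h
  obtain ⟨w', rfl, h2'⟩ := h'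
  exact ⟨.mul w w', rfl, h2.mul h2'⟩

theorem Good.absorb {Z Y : Set M} {ζ ε : ETerm A} (hZ : Good g Z ζ) (hY : Good g Y ε)
    (h : Z ⊆ Z * Y) : Good g Z (.mul ζ (.pow ε)) := by
  intro z hz
  -- an infinite backward chain
  have hstep : ∀ z : Z, ∃ z' : Z, ∃ y ∈ Y, (z' : M) * y = z := by
    rintro ⟨z, hz⟩
    obtain ⟨z', hz', y, hy, e⟩ := h hz
    exact ⟨⟨z', hz'⟩, y, hy, e⟩
  choose nx yy hyy hnx using hstep
  let c : ℕ → Z := fun n => nx^[n] ⟨z, hz⟩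
  have hc : ∀ n, ((c (n + 1) : Z) : M) * yy (c n) = c n := by
    intro n
    simp only [c, Function.iterate_succ_apply']
    exact hnx _
  have hch : ∀ n d, ∃ y ∈ Y ^ d, ((c (n + d) : Z) : M) * y = c n := by
    intro n d
    induction d with
    | zero => exact ⟨1, by simp, by simp⟩
    | succ d ih =>
      obtain ⟨y, hy, e⟩ := ih
      refine ⟨yy (c (n + d)) * y, ?_, ?_⟩
      · rw [pow_succ']; exact Set.mul_mem_mul (hyy _) hy
      · rw [← mul_assoc, ← add_assoc, hc, e]
  obtain ⟨i, j, hne, hij⟩ := Finite.exists_ne_map_eq_of_infinite c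
  wlog hlt : i < j generalizing i j
  · exact this j i hne.symm hij.symm (by omega)
  obtain ⟨d, rfl⟩ := Nat.exists_eq_add_of_lt hlt
  obtain ⟨y, hy, e⟩ := hch 0 i
  obtain ⟨x, hx, e'⟩ := hch i (d + 1)
  rw [← add_assoc, ← hij] at e'
  rw [zero_add] at e
  have e2 := om_of_fix _ _ e'.symm
  have e3 : ((c 0 : Z) : M) = z := rfl
  obtain ⟨u, hu1, hu2⟩ := hZ _ (c i).2
  obtain ⟨v, hv1, hv2⟩ := hY.npow _ _ hx
  obtain ⟨w, hw1, hw2⟩ := hY.npow _ _ hy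
  refine ⟨.mul (.mul u (.pow v)) w, ?_, ?_⟩
  · simp only [ev]
    rw [hu1, hv1, hw1, e2, e, e3]
  · intro N _ _ hN f
    simp only [ev]
    rw [hu2 N hN f, hv2 N hN f, hw2 N hN f, ev_tnpow, ev_tnpow, om_pow _ _ (Nat.succ_pos d),
      mul_assoc, da_om_mul_pow hN]

theorem good_list (B : Set A) (Xs : List (Set M)) (h : ∀ X ∈ Xs, GoodA g X B) :
    ∃ w, tal w ⊆ B ∧ (Xs ≠ [] → tal w = B) ∧ Good g Xs.prod w := by
  induction Xs with
  | nil => exact ⟨.one, by simp [tal], by simp, good_one⟩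
  | cons X Xs ih =>
    obtain ⟨w, h1, -, h3⟩ := ih fun Y hY => h Y (List.mem_cons_of_mem _ hY)
    obtain ⟨v, hv1, hv2⟩ := h X List.mem_cons_self
    have : tal (.mul v w) = B := by simp [tal, hv1, h1]
    refine ⟨.mul v w, this.le, fun _ => this, ?_⟩
    rw [List.prod_cons]
    exact hv2.mul h3

variable (g) in
/-- Good for a term of the form `ζ ε^ω ρ` with `ε` of full content. -/
def LGood (Q : Set M) (B : Set A) : Prop :=
  ∃ ζ ε ρ : ETerm A, tal ζ ⊆ B ∧ tal ε = B ∧ tal ρ ⊆ B ∧ Good g Q (.mul (.mul ζ (.pow ε)) ρ)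

theorem lgood_list (B : Set A) (Xs : List (Set M)) (h : ∀ X ∈ Xs, GoodA g X B)
    (hl : Xs.length = Nat.card (Set M)) : LGood g Xs.prod B := by
  obtain ⟨i, j, hlt, hj, hij⟩ : ∃ i j, i < j ∧ j ≤ Xs.length ∧
      (Xs.take i).prod = (Xs.take j).prod := by
    have : Fintype (Set M) := Fintype.ofFinite _
    obtain ⟨i, j, hne, hij⟩ := Fintype.exists_ne_map_eq_of_card_lt
      (fun i : Fin (Xs.length + 1) => (Xs.take i).prod) (by
        rw [Fintype.card_fin, ← Nat.card_eq_fintype_card]; omega)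
    rcases lt_or_gt_of_ne hne with hlt | hlt
    · exact ⟨i, j, hlt, by omega, hij⟩
    · exact ⟨j, i, hlt, by omega, hij.symm⟩
  have e1 : Xs.take j = Xs.take i ++ (Xs.drop i).take (j - i) := by
    rw [← List.take_add]; congr 1; omega
  obtain ⟨ζ, z1, -, z3⟩ := good_list B (Xs.take i) fun X hX => h X (List.mem_of_mem_take hX)
  obtain ⟨ε, -, y2, y3⟩ := good_list B ((Xs.drop i).take (j - i))
    fun X hX => h X (List.mem_of_mem_drop (List.mem_of_mem_take hX))
  obtain ⟨ρ, r1, -, r3⟩ := good_list B (Xs.drop j) fun X hX => h X (List.mem_of_mem_drop hX)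
  refine ⟨ζ, ε, ρ, z1, y2 ?_, r1, ?_⟩
  · intro h0
    have := congrArg List.length h0
    simp at this
    omega
  · have e2 : Xs.prod = (Xs.take i).prod * (Xs.drop j).prod := by
      rw [hij, ← List.prod_append, List.take_append_drop]
    rw [e2]
    refine (z3.absorb y3 ?_).mul r3
    rw [← List.prod_append, ← e1, ← hij]

theorem LGood.goodA {Q : Set M} {B : Set A} (h : LGood g Q B) : GoodA g Q B := by
  obtain ⟨ζ, ε, ρ, h1, h2, h3, h4⟩ := h
  refine ⟨_, ?_, h4⟩
  simp only [tal, h2]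
  rw [Set.union_eq_self_of_subset_left h1, Set.union_eq_self_of_subset_right h3]

def ofList : List A → ETerm A
  | [] => .one
  | a :: l => .mul (.letter a) (ofList l)

variable (g) in
def psi (u : List A) : M := (u.map g).prod

theorem ev_ofList (l : List A) : ev g (ofList l) = psi g l := by
  induction l with
  | nil => rfl
  | cons a l ih => simp [ofList, ev, ih, psi]

theorem tal_ofList (l : List A) : tal (ofList l) = {a | a ∈ l} := by
  induction l with
  | nil => simp [ofList, tal]
  | cons a l ih => ext b; simp [ofList, tal, ih]

theorem LGood.mid {Q Q' : Set M} {B : Set A} (h : LGood g Q B) (h' : LGood g Q' B) :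
    ∃ w, tal w = B ∧ Good g (Q * (psi g '' {u | {a | a ∈ u} ⊆ B}) * Q') w ∧
      Eqv (.mul w w) w := by
  obtain ⟨ζ, ε, ρ, h1, h2, h3, h4⟩ := h
  obtain ⟨ζ', ε', ρ', h1', h2', h3', h4'⟩ := h'
  refine ⟨.mul (.mul ζ (.pow ε)) (.mul (.pow ε') ρ'), ?_, ?_, ?_⟩
  · simp only [tal, h2, h2']
    rw [Set.union_eq_self_of_subset_left h1, Set.union_eq_self_of_subset_right h3',
      Set.union_self]
  · rintro _ ⟨_, ⟨q, hq, _, ⟨x, hx, rfl⟩, rfl⟩, q', hq', rfl⟩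
    obtain ⟨u, hu1, hu2⟩ := h4 q hq
    obtain ⟨v, hv1, hv2⟩ := h4' q' hq'
    refine ⟨.mul (.mul u (ofList x)) v, by simp [ev, hu1, hv1, ev_ofList], ?_⟩
    intro N _ _ hN f
    have hm := ev_mid hN f ε ε' (.mul ρ (.mul (ofList x) ζ')) (by
      simp only [tal, tal_ofList, h2]
      exact Set.union_subset h3 (Set.union_subset hx h1')) (h2'.trans h2.symm)
    simp only [ev] at hm ⊢
    rw [hu2 N hN f, hv2 N hN f]
    simp only [ev]
    calc _ = ev f ζ * (om (ev f ε) * (ev f ρ * (ev f (ofList x) * ev f ζ')) * om (ev f ε')) *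
          ev f ρ' := by simp only [mul_assoc]
      _ = _ := by rw [hm]; simp only [mul_assoc]
  · intro N _ _ hN f
    have hm := ev_mid hN f ε ε' (.mul (.pow ε') (.mul ρ' (.mul ζ (.pow ε)))) (by
      simp only [tal, h2, h2']
      exact Set.union_subset le_rfl (Set.union_subset h3' (Set.union_subset h1 le_rfl)))
      (h2'.trans h2.symm)
    simp only [ev] at hm ⊢
    calc _ = ev f ζ * (om (ev f ε) * (om (ev f ε') * (ev f ρ' * (ev f ζ * om (ev f ε)))) *
          om (ev f ε')) * ev f ρ' := by simp only [mul_assoc]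
      _ = _ := by rw [hm]; simp only [mul_assoc]

end good

/-! ### The congruences -/

/-- Finite code types. -/
def Code (A : Type) : ℕ → Type
  | 0 => Set A
  | n + 1 => Code A n × (A → Code A n × Code A n × Code A n × Code A n)

theorem code_finite (A : Type) [Finite A] (n : ℕ) : Finite (Code A n) := by
  induction n with
  | zero => exact inferInstanceAs (Finite (Set A))
  | succ n ih =>
    exact inferInstanceAs (Finite (Code A n × (A → Code A n × Code A n × Code A n × Code A n)))

open Classical in
noncomputable def L1 (a : A) (u : List A) : List A := u.takeWhile (fun b => b ≠ a)

open Classical in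
noncomputable def L2 (a : A) (u : List A) : List A := (u.dropWhile (fun b => b ≠ a)).tail

theorem L_not_mem (a : A) (u : List A) (h : a ∉ u) : L1 a u = u ∧ L2 a u = [] := by
  constructor
  · rw [L1, List.takeWhile_eq_self_iff]
    intro x hx
    simp only [decide_eq_true_eq]
    rintro rfl
    exact h hx
  · rw [L2, List.dropWhile_eq_nil_iff.2]
    · rfl
    intro x hx
    simp only [decide_eq_true_eq]
    rintro rfl
    exact h hx

theorem L_split (a : A) (y r : List A) (h : a ∉ y) :
    L1 a (y ++ a :: r) = y ∧ L2 a (y ++ a :: r) = r := by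
  induction y with
  | nil => simp [L1, L2]
  | cons b y ih =>
    have hb : b ≠ a := by rintro rfl; simp at h
    obtain ⟨h1, h2⟩ := ih (fun h' => h (List.mem_cons_of_mem _ h'))
    unfold L1 at h1 ⊢
    unfold L2 at h2 ⊢
    constructor
    · rw [List.cons_append, List.takeWhile_cons_of_pos (by simpa using hb), h1]
    · rw [List.cons_append, List.dropWhile_cons_of_pos (by simpa using hb), h2]

noncomputable def code : (n : ℕ) → List A → Code A n
  | 0, u => {a | a ∈ u}
  | n + 1, u => (code n u, fun a => (code n (L1 a u), code n (L2 a u),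
      code n (L2 a u.reverse).reverse, code n (L1 a u.reverse).reverse))

def Sim (n : ℕ) (u v : List A) : Prop := code n u = code n v

theorem Sim.refl (n : ℕ) (u : List A) : Sim n u u := rfl

theorem Sim.symm {n : ℕ} {u v : List A} (h : Sim n u v) : Sim n v u := Eq.symm h

theorem Sim.trans {n : ℕ} {u v w : List A} (h : Sim n u v) (h' : Sim n v w) : Sim n u w :=
  Eq.trans h h'

theorem sim_zero (u v : List A) : Sim 0 u v ↔ ∀ a, a ∈ u ↔ a ∈ v := by
  unfold Sim code
  exact Set.ext_iff

theorem Sim.pred {n : ℕ} {u v : List A} (h : Sim (n + 1) u v) : Sim n u v :=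
  congrArg Prod.fst h

theorem Sim.le {n m : ℕ} {u v : List A} (h : Sim m u v) (hm : n ≤ m) : Sim n u v := by
  induction m, hm using Nat.le_induction with
  | base => exact h
  | succ k hk ih => exact ih h.pred

theorem Sim.mem_iff {n : ℕ} {u v : List A} (h : Sim n u v) (a : A) : a ∈ u ↔ a ∈ v :=
  (sim_zero u v).1 (h.le (Nat.zero_le n)) a

theorem exists_left {a : A} {u : List A} (h : a ∈ u) : ∃ y r, u = y ++ a :: r ∧ a ∉ y :=
  List.eq_append_cons_of_mem h

theorem exists_right {a : A} {u : List A} (h : a ∈ u) : ∃ y r, u = y ++ a :: r ∧ a ∉ r := by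
  obtain ⟨y, r, h1, h2⟩ := exists_left (List.mem_reverse.2 h)
  refine ⟨r.reverse, y.reverse, ?_, by simpa using h2⟩
  have := congrArg List.reverse h1
  simpa using this

theorem Sim.left {n : ℕ} {u v y r y' r' : List A} {a : A} (h : Sim (n + 1) u v)
    (hu : u = y ++ a :: r) (hv : v = y' ++ a :: r') (hy : a ∉ y) (hy' : a ∉ y') :
    Sim n y y' ∧ Sim n r r' := by
  have h2 := congrFun (congrArg Prod.snd h) a
  simp only [code, Prod.mk.injEq] at h2
  obtain ⟨e1, e2, -, -⟩ := h2
  subst hu hv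
  rw [(L_split a y r hy).1, (L_split a y' r' hy').1] at e1
  rw [(L_split a y r hy).2, (L_split a y' r' hy').2] at e2
  exact ⟨e1, e2⟩

theorem Sim.right {n : ℕ} {u v y r y' r' : List A} {a : A} (h : Sim (n + 1) u v)
    (hu : u = y ++ a :: r) (hv : v = y' ++ a :: r') (hr : a ∉ r) (hr' : a ∉ r') :
    Sim n y y' ∧ Sim n r r' := by
  have h2 := congrFun (congrArg Prod.snd h) a
  simp only [code, Prod.mk.injEq] at h2
  obtain ⟨-, -, e1, e2⟩ := h2
  have k1 : u.reverse = r.reverse ++ a :: y.reverse := by simp [hu]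
  have k2 : v.reverse = r'.reverse ++ a :: y'.reverse := by simp [hv]
  rw [k1, k2, (L_split a _ _ (by simpa using hr)).2, (L_split a _ _ (by simpa using hr')).2] at e1
  rw [k1, k2, (L_split a _ _ (by simpa using hr)).1, (L_split a _ _ (by simpa using hr')).1] at e2
  simp only [List.reverse_reverse] at e1 e2
  exact ⟨e1, e2⟩

theorem sim_succ {n : ℕ} {u v : List A} (h0 : Sim n u v)
    (hl : ∀ a, a ∈ u → ∃ y r y' r', u = y ++ a :: r ∧ v = y' ++ a :: r' ∧ a ∉ y ∧ a ∉ y' ∧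
      Sim n y y' ∧ Sim n r r')
    (hr : ∀ a, a ∈ u → ∃ y r y' r', u = y ++ a :: r ∧ v = y' ++ a :: r' ∧ a ∉ r ∧ a ∉ r' ∧
      Sim n y y' ∧ Sim n r r') : Sim (n + 1) u v := by
  refine Prod.ext h0 (funext fun a => ?_)
  simp only [code, Prod.mk.injEq]
  by_cases ha : a ∈ u
  · obtain ⟨y, r, y', r', hu, hv, hy, hy', s1, s2⟩ := hl a ha
    obtain ⟨z, t, z', t', hu2, hv2, ht, ht', q1, q2⟩ := hr a ha
    have k1 : u.reverse = t.reverse ++ a :: z.reverse := by simp [hu2]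
    have k2 : v.reverse = t'.reverse ++ a :: z'.reverse := by simp [hv2]
    refine ⟨?_, ?_, ?_, ?_⟩
    · rw [hu, hv, (L_split a y r hy).1, (L_split a y' r' hy').1]; exact s1
    · rw [hu, hv, (L_split a y r hy).2, (L_split a y' r' hy').2]; exact s2
    · rw [k1, k2, (L_split a _ _ (by simpa using ht)).2, (L_split a _ _ (by simpa using ht')).2]
      simp only [List.reverse_reverse]; exact q1
    · rw [k1, k2, (L_split a _ _ (by simpa using ht)).1, (L_split a _ _ (by simpa using ht')).1]
      simp only [List.reverse_reverse]; exact q2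
  · have hb : a ∉ v := fun h => ha ((h0.mem_iff a).2 h)
    have ha' : a ∉ u.reverse := by simpa using ha
    have hb' : a ∉ v.reverse := by simpa using hb
    rw [(L_not_mem a _ ha).1, (L_not_mem a _ ha).2, (L_not_mem a _ ha').1, (L_not_mem a _ ha').2,
      (L_not_mem a _ hb).1, (L_not_mem a _ hb).2, (L_not_mem a _ hb').1, (L_not_mem a _ hb').2]
    simp only [List.reverse_reverse, List.reverse_nil, true_and]
    exact ⟨h0, h0⟩

theorem Sim.append {n : ℕ} {u u' w w' : List A} (h : Sim n u u') (k : Sim n w w') :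
    Sim n (u ++ w) (u' ++ w') := by
  induction n generalizing u u' w w' with
  | zero =>
    rw [sim_zero] at *
    intro a
    simp [h a, k a]
  | succ n ih =>
    refine sim_succ (ih h.pred k.pred) ?_ ?_
    · intro a ha
      by_cases hau : a ∈ u
      · obtain ⟨y, r, e, hy⟩ := exists_left hau
        obtain ⟨y', r', e', hy'⟩ := exists_left ((h.mem_iff a).1 hau)
        obtain ⟨s1, s2⟩ := h.left e e' hy hy'
        exact ⟨y, r ++ w, y', r' ++ w', by simp [e], by simp [e'], hy, hy', s1, ih s2 k.pred⟩
      · have haw : a ∈ w := by simpa [hau] using ha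
        obtain ⟨y, r, e, hy⟩ := exists_left haw
        obtain ⟨y', r', e', hy'⟩ := exists_left ((k.mem_iff a).1 haw)
        obtain ⟨s1, s2⟩ := k.left e e' hy hy'
        have hau' : a ∉ u' := fun q => hau ((h.mem_iff a).2 q)
        exact ⟨u ++ y, r, u' ++ y', r', by simp [e], by simp [e'], by simp [hau, hy],
          by simp [hau', hy'], ih h.pred s1, s2⟩
    · intro a ha
      by_cases haw : a ∈ w
      · obtain ⟨y, r, e, hy⟩ := exists_right haw
        obtain ⟨y', r', e', hy'⟩ := exists_right ((k.mem_iff a).1 haw)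
        obtain ⟨s1, s2⟩ := k.right e e' hy hy'
        exact ⟨u ++ y, r, u' ++ y', r', by simp [e], by simp [e'], hy, hy', ih h.pred s1, s2⟩
      · have hau : a ∈ u := by simpa [haw] using ha
        obtain ⟨y, r, e, hy⟩ := exists_right hau
        obtain ⟨y', r', e', hy'⟩ := exists_right ((h.mem_iff a).1 hau)
        obtain ⟨s1, s2⟩ := h.right e e' hy hy'
        have haw' : a ∉ w' := fun q => haw ((k.mem_iff a).2 q)
        exact ⟨y, r ++ w, y', r' ++ w', by simp [e], by simp [e'], by simp [haw, hy],
          by simp [haw', hy'], s1, ih s2 k.pred⟩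

/-- The quotient by `Sim n` lies in DA. -/
theorem sim_da {n : ℕ} {u x : List A} (h : Sim n u (u ++ x ++ u)) : Sim n (u ++ u) u := by
  induction n generalizing u x with
  | zero => rw [sim_zero]; simp
  | succ n ih =>
    have h1 := ih h.pred
    refine sim_succ h1 ?_ ?_
    · intro a ha
      have ha : a ∈ u := by simpa using ha
      obtain ⟨y, r, e, hy⟩ := exists_left ha
      refine ⟨y, r ++ u, y, r, by simp [e], e, hy, hy, Sim.refl _ _, ?_⟩
      have e2 : u ++ x ++ u = y ++ a :: (r ++ x ++ u) := by
        nth_rewrite 1 [e]; simp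
      have s := (h.left e e2 hy hy).2
      have s2 : Sim n (r ++ u) (r ++ x ++ (u ++ u)) := by
        simpa using s.append (Sim.refl n u)
      exact (s2.trans ((Sim.refl n _).append h1)).trans s.symm
    · intro a ha
      have ha : a ∈ u := by simpa using ha
      obtain ⟨y, r, e, hy⟩ := exists_right ha
      refine ⟨u ++ y, r, y, r, by simp [e], e, hy, hy, ?_, Sim.refl _ _⟩
      have e2 : u ++ x ++ u = (u ++ x ++ y) ++ a :: r := by
        nth_rewrite 2 [e]; simp
      have s := (h.right e e2 hy hy).1
      have s2 : Sim n (u ++ y) ((u ++ u) ++ (x ++ y)) := by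
        simpa using (Sim.refl n u).append s
      refine (s2.trans (h1.append (Sim.refl n _))).trans ?_
      simpa using s.symm

def simCon (A : Type) (n : ℕ) : Con (FreeMonoid A) where
  r u v := Sim n u.toList v.toList
  iseqv := ⟨fun _ => rfl, fun h => h.symm, fun h k => h.trans k⟩
  mul' h k := by
    simp only [FreeMonoid.toList_mul]
    exact Sim.append h k

theorem simCon_eq {n : ℕ} (u v : List A) :
    ((FreeMonoid.ofList u : FreeMonoid A) : (simCon A n).Quotient) = (FreeMonoid.ofList v : FreeMonoid A)
      ↔ Sim n u v := by
  rw [Con.eq]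
  rfl

theorem simCon_finite (A : Type) [Finite A] (n : ℕ) : Finite (simCon A n).Quotient := by
  have := code_finite A n
  refine Finite.of_injective
    (fun q : (simCon A n).Quotient => Con.liftOn q (fun u => code n u.toList) fun _ _ h => h) ?_
  intro p q
  induction p using Con.induction_on with | _ u
  induction q using Con.induction_on with | _ v
  intro h
  exact (Con.eq _).2 h

theorem simCon_da (A : Type) (n : ℕ) : InDA (simCon A n).Quotient := by
  rintro t ⟨x, h⟩
  induction t using Con.induction_on with | _ u
  induction x using Con.induction_on with | _ v
  rw [← Con.coe_mul, ← Con.coe_mul, Con.eq] at h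
  unfold IsIdempotentElem
  rw [← Con.coe_mul, Con.eq]
  exact sim_da h

/-! ### Classes of `Sim n` are good -/

section main
variable {M : Type} [Monoid M] [Finite M] (g : A → M)

def al (u : List A) : Set A := {a | a ∈ u}

theorem al_append (u v : List A) : al (u ++ v) = al u ∪ al v := by
  ext a; simp [al]

theorem al_reverse (u : List A) : al u.reverse = al u := by
  ext a; simp [al]

theorem psi_append (u v : List A) : psi g (u ++ v) = psi g u * psi g v := by
  simp [psi]

theorem psi_cons (a : A) (v : List A) : psi g (a :: v) = g a * psi g v := by
  simp [psi]

def cl (n : ℕ) (u : List A) : Set M := psi g '' {v | Sim n v u}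

theorem cl_mono {n m : ℕ} (h : n ≤ m) (u : List A) : cl g m u ⊆ cl g n u :=
  Set.image_mono fun _ hv => Sim.le hv h

theorem cl_congr {n : ℕ} {u v : List A} (h : Sim n u v) : cl g n u = cl g n v := by
  unfold cl
  congr 1
  ext x
  exact ⟨fun hx => Sim.trans hx h, fun hx => Sim.trans hx h.symm⟩

theorem cl_left (n : ℕ) (y r : List A) (a : A) (h : a ∉ y) :
    cl g (n + 1) (y ++ a :: r) ⊆ cl g n y * {g a} * cl g n r := by
  rintro _ ⟨v, hv, rfl⟩
  have hv : Sim (n + 1) v (y ++ a :: r) := hv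
  obtain ⟨y', r', e, hy'⟩ := exists_left ((hv.mem_iff a).2 (by simp))
  obtain ⟨s1, s2⟩ := hv.left e rfl hy' h
  rw [e, psi_append, psi_cons, ← mul_assoc]
  exact Set.mul_mem_mul (Set.mul_mem_mul ⟨_, s1, rfl⟩ rfl) ⟨_, s2, rfl⟩

theorem cl_right (n : ℕ) (y r : List A) (a : A) (h : a ∉ r) :
    cl g (n + 1) (y ++ a :: r) ⊆ cl g n y * ({g a} * cl g n r) := by
  rintro _ ⟨v, hv, rfl⟩
  have hv : Sim (n + 1) v (y ++ a :: r) := hv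
  obtain ⟨y', r', e, hy'⟩ := exists_right ((hv.mem_iff a).2 (by simp))
  obtain ⟨s1, s2⟩ := hv.right e rfl hy' h
  rw [e, psi_append, psi_cons]
  exact Set.mul_mem_mul ⟨_, s1, rfl⟩ (Set.mul_mem_mul rfl ⟨_, s2, rfl⟩)

theorem cl_sub (n : ℕ) (u : List A) (B : Set A) (h : al u ⊆ B) :
    cl g n u ⊆ psi g '' {u | {a | a ∈ u} ⊆ B} := by
  refine Set.image_mono fun v hv a ha => h ((Sim.mem_iff hv a).1 ha)

/-- Shortest prefix of full content. -/
theorem greedy_left (u : List A) (hu : u ≠ []) :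
    ∃ y b r, u = y ++ b :: r ∧ b ∉ y ∧ al (y ++ [b]) = al u ∧
      ∀ p t, u = p ++ t → al p = al u → ∃ s, r = s ++ t := by
  induction u using List.reverseRecOn with
  | nil => exact absurd rfl hu
  | append_singleton u c ih =>
    by_cases hc : c ∈ u
    · have hal : al (u ++ [c]) = al u := by
        ext a; simp only [al, List.mem_append, List.mem_singleton, Set.mem_ofPred_eq]
        constructor
        · rintro (h | rfl)
          · exact h
          · exact hc
        · exact Or.inl
      obtain ⟨y, b, r, h1, h2, h3, h4⟩ := ih (List.ne_nil_of_mem hc)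
      refine ⟨y, b, r ++ [c], by simp [h1], h2, h3.trans hal.symm, ?_⟩
      intro p t e hp
      induction t using List.reverseRecOn with
      | nil => exact ⟨r ++ [c], by simp⟩
      | append_singleton t d _ =>
        rw [← List.append_assoc] at e
        obtain ⟨e1, e2⟩ := List.append_inj' e rfl
        obtain ⟨s, hs⟩ := h4 p t e1 (hp.trans hal)
        refine ⟨s, ?_⟩
        rw [hs, e2, List.append_assoc]
    · refine ⟨u, c, [], rfl, hc, rfl, ?_⟩
      intro p t e hp
      induction t using List.reverseRecOn with
      | nil => exact ⟨[], rfl⟩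
      | append_singleton t d _ =>
        exfalso
        rw [← List.append_assoc] at e
        obtain ⟨e1, e2⟩ := List.append_inj' e rfl
        have : c ∈ al p := by rw [hp]; simp [al]
        exact hc (by rw [e1]; exact List.mem_append_left _ this)

theorem greedy_right (u : List A) (hu : u ≠ []) :
    ∃ y b r, u = y ++ b :: r ∧ b ∉ r ∧ al (b :: r) = al u ∧
      ∀ p t, u = t ++ p → al p = al u → ∃ s, y = t ++ s := by
  obtain ⟨y, b, r, h1, h2, h3, h4⟩ := greedy_left u.reverse (by simpa using hu)
  refine ⟨r.reverse, b, y.reverse, ?_, by simpa using h2, ?_, ?_⟩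
  · have := congrArg List.reverse h1
    simpa using this
  · rw [al_reverse] at h3
    rw [← h3, ← al_reverse]
    simp
  · intro p t e hp
    obtain ⟨s, hs⟩ := h4 p.reverse t.reverse (by simp [e]) (by rw [al_reverse, al_reverse, hp])
    exact ⟨s.reverse, by simp [hs]⟩

/-- Iterated concatenation. -/
def rep (v : List A) (k : ℕ) : List A := (List.replicate k v).flatten

theorem rep_succ (v : List A) (k : ℕ) : rep v (k + 1) = v ++ rep v k := by
  simp [rep, List.replicate_succ]

theorem rep_succ' (v : List A) (k : ℕ) : rep v (k + 1) = rep v k ++ v := by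
  simp [rep, List.replicate_succ']

variable [Finite A]

/-- The induction hypothesis. -/
def Hyp (n₀ m : ℕ) : Prop :=
  ∀ n, n₀ ≤ n → ∀ u : List A, (al u).ncard ≤ m → GoodA g (cl g n u) (al u)

variable {g} {n₀ m : ℕ}

theorem ncard_aux (H : Hyp g n₀ m) (B : Set A) (hB : B.ncard ≤ m + 1)
    (hne : B.Nonempty)
    {u : List A} {b : A} (hb : b ∉ u) (h : al u ⊆ B) (hbB : b ∈ B) :
    (al u).ncard ≤ m := by
  have : (al u).ncard < B.ncard :=
    Set.ncard_lt_ncard ⟨h, fun h' => hb (h' hbB)⟩ (Set.toFinite _)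
  omega

theorem step_left (H : Hyp g n₀ m) (B : Set A) (hB : B.ncard ≤ m + 1)
    (hne : B.Nonempty)
    (u : List A) (hu : al u = B) :
    ∃ X r, GoodA g X B ∧ al r ⊆ B ∧ (∀ n, n₀ ≤ n → cl g (n + 1) u ⊆ X * cl g n r) ∧
      ∀ p t, u = p ++ t → al p = B → ∃ s, r = s ++ t := by
  have hu0 : u ≠ [] := by
    rintro rfl
    obtain ⟨b, hb⟩ := hne
    rw [← hu] at hb
    simp [al] at hb
  obtain ⟨y, b, r, h1, h2, h3, h4⟩ := greedy_left u hu0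
  have hbB : b ∈ B := by rw [← hu, h1]; simp [al]
  have hyB : al y ⊆ B := by rw [← hu, h1, al_append]; exact Set.subset_union_left
  have hrB : al r ⊆ B := by
    rw [← hu, h1]; intro a ha; have : a ∈ r := ha; simp [al, this]
  refine ⟨cl g n₀ y * {g b}, r, ?_, hrB, ?_, ?_⟩
  · have := (H n₀ le_rfl y (ncard_aux H B hB hne h2 hyB hbB)).mul
      (⟨.letter b, rfl, good_letter b⟩ : GoodA g {g b} {b})
    convert this using 1
    rw [← hu, ← h3, al_append]
    simp [al]
  · intro n hn
    rw [h1]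
    refine (cl_left g n y r b h2).trans ?_
    exact Set.mul_subset_mul_right (Set.mul_subset_mul_right (cl_mono g hn y))
  · intro p t e hp
    exact h4 p t e (hp.trans hu.symm)

theorem step_right (H : Hyp g n₀ m) (B : Set A) (hB : B.ncard ≤ m + 1)
    (hne : B.Nonempty)
    (u : List A) (hu : al u = B) :
    ∃ X r, GoodA g X B ∧ al r ⊆ B ∧ (∀ n, n₀ ≤ n → cl g (n + 1) u ⊆ cl g n r * X) ∧
      ∀ p t, u = t ++ p → al p = B → ∃ s, r = t ++ s := by
  have hu0 : u ≠ [] := by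
    rintro rfl
    obtain ⟨b, hb⟩ := hne
    rw [← hu] at hb
    simp [al] at hb
  obtain ⟨y, b, r, h1, h2, h3, h4⟩ := greedy_right u hu0
  have hbB : b ∈ B := by rw [← hu, h1]; simp [al]
  have hyB : al y ⊆ B := by rw [← hu, h1, al_append]; exact Set.subset_union_left
  have hrB : al r ⊆ B := by
    rw [← hu, h1]; intro a ha; have : a ∈ r := ha; simp [al, this]
  refine ⟨{g b} * cl g n₀ r, y, ?_, hyB, ?_, ?_⟩
  · have hb1 : GoodA g {g b} {b} := ⟨.letter b, rfl, good_letter b⟩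
    have := hb1.mul
      (H n₀ le_rfl r (ncard_aux H B hB hne h2 hrB hbB))
    convert this using 1
    rw [← hu, ← h3]
    ext a
    simp [al]
  · intro n hn
    rw [h1]
    refine (cl_right g n y r b h2).trans ?_
    exact Set.mul_subset_mul_left (Set.mul_subset_mul_left (cl_mono g hn r))
  · intro p t e hp
    exact h4 p t e (hp.trans hu.symm)

theorem short_aux (H : Hyp g n₀ m) (B : Set A) (hB : B.ncard ≤ m + 1)
    (hne : B.Nonempty)
    (n : ℕ) (hn : n₀ ≤ n) (u : List A) (hs : al u ⊆ B) (hu : al u ≠ B) :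
    GoodA g (cl g n u) (al u) := by
  apply H n hn
  have : (al u).ncard < B.ncard :=
    Set.ncard_lt_ncard (hs.ssubset_of_ne hu) (Set.toFinite _)
  omega

theorem dec_left (H : Hyp g n₀ m) (B : Set A) (hB : B.ncard ≤ m + 1)
    (hne : B.Nonempty)
    (k : ℕ) (u : List A) (hu : al u ⊆ B) :
    GoodA g (cl g (n₀ + k) u) (al u) ∨
    ∃ (Xs : List (Set M)) (r : List A), Xs.length = k ∧ (∀ X ∈ Xs, GoodA g X B) ∧ al r ⊆ B ∧
      ∀ n, n₀ ≤ n → cl g (n + k) u ⊆ Xs.prod * cl g n r := by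
  induction k generalizing u with
  | zero => exact Or.inr ⟨[], u, rfl, by simp, hu, fun n _ => by simp⟩
  | succ k ih =>
    by_cases huB : al u = B
    · obtain ⟨X, r, hX, hr, hcl, -⟩ := step_left H B hB hne u huB
      rcases ih r hr with h | ⟨Xs, r', h1, h2, h3, h4⟩
      · left
        have := (hX.mul h).mono (hcl (n₀ + k) (by omega))
        rwa [Set.union_eq_self_of_subset_right hr, ← huB] at this
      · right
        refine ⟨X :: Xs, r', by simp [h1], by simpa using ⟨hX, h2⟩, h3, fun n hn => ?_⟩
        rw [List.prod_cons, mul_assoc]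
        exact (hcl (n + k) (by omega)).trans (Set.mul_subset_mul_left (h4 n hn))
    · exact Or.inl (short_aux H B hB hne _ (by omega) u hu huB)

theorem dec_right (H : Hyp g n₀ m) (B : Set A) (hB : B.ncard ≤ m + 1)
    (hne : B.Nonempty)
    (k : ℕ) (u : List A) (hu : al u ⊆ B) :
    GoodA g (cl g (n₀ + k) u) (al u) ∨
    ∃ (Xs : List (Set M)) (r : List A), Xs.length = k ∧ (∀ X ∈ Xs, GoodA g X B) ∧ al r ⊆ B ∧
      ∀ n, n₀ ≤ n → cl g (n + k) u ⊆ cl g n r * Xs.prod := by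
  induction k generalizing u with
  | zero => exact Or.inr ⟨[], u, rfl, by simp, hu, fun n _ => by simp⟩
  | succ k ih =>
    by_cases huB : al u = B
    · obtain ⟨X, r, hX, hr, hcl, -⟩ := step_right H B hB hne u huB
      rcases ih r hr with h | ⟨Xs, r', h1, h2, h3, h4⟩
      · left
        have := (h.mul hX).mono (hcl (n₀ + k) (by omega))
        rwa [Set.union_eq_self_of_subset_left hr, ← huB] at this
      · right
        refine ⟨Xs ++ [X], r', by simp [h1], ?_, h3, fun n hn => ?_⟩
        · intro Y hY
          rcases List.mem_append.1 hY with hY | hY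
          · exact h2 Y hY
          · rw [List.mem_singleton.1 hY]; exact hX
        rw [List.prod_append, List.prod_singleton, ← mul_assoc]
        exact (hcl (n + k) (by omega)).trans (Set.mul_subset_mul_right (h4 n hn))
    · exact Or.inl (short_aux H B hB hne _ (by omega) u hu huB)

theorem long_left (H : Hyp g n₀ m) (B : Set A) (hB : B.ncard ≤ m + 1)
    (hne : B.Nonempty)
    (v : List A) (hv : al v = B) (k : ℕ) (u s t : List A) (hu : al u ⊆ B)
    (e : u = s ++ rep v k ++ t) :
    ∃ (Xs : List (Set M)) (r : List A), Xs.length = k ∧ (∀ X ∈ Xs, GoodA g X B) ∧ al r ⊆ B ∧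
      (∀ n, n₀ ≤ n → cl g (n + k) u ⊆ Xs.prod * cl g n r) ∧ ∃ s', r = s' ++ t := by
  induction k generalizing u s with
  | zero => exact ⟨[], u, rfl, by simp, hu, fun n _ => by simp, s, by simp [e, rep]⟩
  | succ k ih =>
    have e' : u = (s ++ v) ++ (rep v k ++ t) := by simp [e, rep_succ]
    have hsv : al (s ++ v) = B := by
      apply le_antisymm
      · refine le_trans ?_ hu
        rw [e', al_append (s ++ v)]; exact Set.subset_union_left
      · rw [al_append, hv]; exact Set.subset_union_right
    have huB : al u = B := by
      apply le_antisymm hu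
      rw [e', al_append (s ++ v), hsv]; exact Set.subset_union_left
    obtain ⟨X, r, hX, hr, hcl, hg⟩ := step_left H B hB hne u huB
    obtain ⟨s1, hs1⟩ := hg _ _ e' hsv
    obtain ⟨Xs, r', h1, h2, h3, h4, h5⟩ := ih r s1 hr (by rw [hs1, List.append_assoc])
    refine ⟨X :: Xs, r', by simp [h1], by simpa using ⟨hX, h2⟩, h3, fun n hn => ?_, h5⟩
    rw [List.prod_cons, mul_assoc]
    exact (hcl (n + k) (by omega)).trans (Set.mul_subset_mul_left (h4 n hn))

theorem long_right (H : Hyp g n₀ m) (B : Set A) (hB : B.ncard ≤ m + 1)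
    (hne : B.Nonempty)
    (v : List A) (hv : al v = B) (k : ℕ) (u s t : List A) (hu : al u ⊆ B)
    (e : u = t ++ rep v k ++ s) :
    ∃ (Xs : List (Set M)) (r : List A), Xs.length = k ∧ (∀ X ∈ Xs, GoodA g X B) ∧ al r ⊆ B ∧
      (∀ n, n₀ ≤ n → cl g (n + k) u ⊆ cl g n r * Xs.prod) ∧ ∃ s', r = t ++ s' := by
  induction k generalizing u s with
  | zero => exact ⟨[], u, rfl, by simp, hu, fun n _ => by simp, s, by simp [e, rep]⟩
  | succ k ih =>
    have e' : u = (t ++ rep v k) ++ (v ++ s) := by simp [e, rep_succ']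
    have hsv : al (v ++ s) = B := by
      apply le_antisymm
      · refine le_trans ?_ hu
        rw [e', al_append _ (v ++ s)]; exact Set.subset_union_right
      · rw [al_append, hv]; exact Set.subset_union_left
    have huB : al u = B := by
      apply le_antisymm hu
      rw [e', al_append _ (v ++ s), hsv]; exact Set.subset_union_right
    obtain ⟨X, r, hX, hr, hcl, hg⟩ := step_right H B hB hne u huB
    obtain ⟨s1, hs1⟩ := hg _ _ e' hsv
    obtain ⟨Xs, r', h1, h2, h3, h4, h5⟩ := ih r s1 hr hs1
    refine ⟨Xs ++ [X], r', by simp [h1], ?_, h3, fun n hn => ?_, h5⟩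
    · intro Y hY
      rcases List.mem_append.1 hY with hY | hY
      · exact h2 Y hY
      · rw [List.mem_singleton.1 hY]; exact hX
    rw [List.prod_append, List.prod_singleton, ← mul_assoc]
    exact (hcl (n + k) (by omega)).trans (Set.mul_subset_mul_right (h4 n hn))

theorem good_full (H : Hyp g n₀ m) (B : Set A) (hB : B.ncard ≤ m + 1)
    (hne : B.Nonempty)
    (u : List A) (hu : al u = B) :
    GoodA g (cl g (n₀ + Nat.card (Set M) + Nat.card (Set M)) u) (al u) := by
  rcases dec_left H B hB hne (Nat.card (Set M)) u hu.le with h | ⟨Xs, r, h1, h2, h3, h4⟩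
  · exact h.mono (cl_mono g (by omega) u)
  have hL := lgood_list B Xs h2 h1
  have hs := h4 (n₀ + Nat.card (Set M)) (by omega)
  rcases dec_right H B hB hne (Nat.card (Set M)) r h3 with h | ⟨Ys, r', k1, k2, k3, k4⟩
  · have := (hL.goodA.mul h).mono hs
    rwa [Set.union_eq_self_of_subset_right h3, ← hu] at this
  have hR := lgood_list B Ys k2 k1
  obtain ⟨w, w1, w2, -⟩ := hL.mid hR
  rw [hu]
  refine ⟨w, w1, w2.mono (hs.trans ?_)⟩
  rw [mul_assoc]
  refine Set.mul_subset_mul_left ((k4 n₀ le_rfl).trans (Set.mul_subset_mul_right ?_))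
  exact cl_sub g _ _ _ k3

theorem good_idem (H : Hyp g n₀ m) (B : Set A) (hB : B.ncard ≤ m + 1)
    (hne : B.Nonempty)
    (v : List A) (hv : al v = B) :
    ∃ w, Good g (cl g (n₀ + Nat.card (Set M) + Nat.card (Set M))
      (rep v (Nat.card (Set M)) ++ rep v (Nat.card (Set M)))) w ∧ Eqv (.mul w w) w := by
  have hrep : ∀ k, al (rep v k) ⊆ B := by
    intro k a ha
    simp only [rep, al, Set.mem_ofPred_eq, List.mem_flatten, List.mem_replicate] at ha
    obtain ⟨l, ⟨-, rfl⟩, ha⟩ := ha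
    rw [← hv]; exact ha
  obtain ⟨Xs, r, h1, h2, h3, h4, s', h5⟩ := long_left H B hB hne v hv (Nat.card (Set M))
    (rep v (Nat.card (Set M)) ++ rep v (Nat.card (Set M))) [] (rep v (Nat.card (Set M)))
    (by rw [al_append]; exact Set.union_subset (hrep _) (hrep _)) (by simp)
  obtain ⟨Ys, r', k1, k2, k3, k4, -⟩ := long_right H B hB hne v hv (Nat.card (Set M))
    r [] s' h3 (by simp [h5])
  have hL := lgood_list B Xs h2 h1
  have hR := lgood_list B Ys k2 k1
  obtain ⟨w, -, w2, w3⟩ := hL.mid hR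
  refine ⟨w, w2.mono ((h4 (n₀ + Nat.card (Set M)) (by omega)).trans ?_), w3⟩
  rw [mul_assoc]
  refine Set.mul_subset_mul_left ((k4 n₀ le_rfl).trans (Set.mul_subset_mul_right ?_))
  exact cl_sub g _ _ _ k3

theorem exists_hyp (g : A → M) (m : ℕ) : ∃ n₀, Hyp g n₀ m := by
  induction m with
  | zero =>
    refine ⟨0, fun n _ u hu => ?_⟩
    have h0 : al u = ∅ := (Set.ncard_eq_zero (Set.toFinite _)).1 (by omega)
    refine ⟨.one, by simp [tal, h0], good_one.mono ?_⟩
    rintro _ ⟨v, hv, rfl⟩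
    have : v = [] := by
      rw [List.eq_nil_iff_forall_not_mem]
      intro a ha
      have : a ∈ al u := (Sim.mem_iff hv a).1 ha
      rw [h0] at this
      exact this
    simp [this, psi]
  | succ m ih =>
    obtain ⟨n₀, H⟩ := ih
    refine ⟨n₀ + Nat.card (Set M) + Nat.card (Set M), fun n hn u hu => ?_⟩
    by_cases hm : (al u).ncard ≤ m
    · exact H n (by omega) u hm
    · have hne : (al u).Nonempty := by
        rw [← Set.ncard_pos (Set.toFinite _)]; omega
      exact (good_full H (al u) hu hne u rfl).mono (cl_mono g hn u)

end main

/-! ### Back to ω-terms -/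

def nrm : ETerm A → Option (OTerm A)
  | .one => none
  | .letter a => some (.letter a)
  | .mul u v => match nrm u, nrm v with
    | none, y => y
    | some x, none => some x
    | some x, some y => some (.mul x y)
  | .pow u => (nrm u).map .omPow

instance withOneFinite {T : Type} [Finite T] : Finite (WithOne T) :=
  inferInstanceAs (Finite (Option T))

theorem coe_spow {T : Type} [Semigroup T] (t : T) (k : ℕ) :
    ((spow t k : T) : WithOne T) = (t : WithOne T) ^ (k + 1) := by
  induction k with
  | zero => simp [spow]
  | succ k ih =>
    rw [pow_succ, ← ih, ← WithOne.coe_mul]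
    simp only [spow, Function.iterate_succ_apply']

theorem nrm_spec {T : Type} [Semigroup T] [Finite T] (f : A → T) (w : ETerm A) :
    (nrm w = none → ev (fun a => (f a : WithOne T)) w = 1) ∧
    (∀ w', nrm w = some w' → ∃ t, OEval f w' t ∧ ev (fun a => (f a : WithOne T)) w = t) := by
  induction w with
  | one => simp [nrm, ev]
  | letter a =>
    refine ⟨by simp [nrm], ?_⟩
    intro w' h
    obtain rfl := Option.some.inj h
    exact ⟨f a, .letter a, rfl⟩
  | mul u v hu hv =>
    simp only [nrm, ev]
    rcases hx : nrm u with _ | x <;> rcases hy : nrm v with _ | y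
    · simp [hu.1 hx, hv.1 hy]
    · simp only [hu.1 hx, one_mul]
      rw [hy] at hv
      exact hv
    · simp only [hv.1 hy, mul_one]
      rw [hx] at hu
      exact hu
    · refine ⟨by simp, ?_⟩
      intro w' h
      obtain rfl := Option.some.inj h
      obtain ⟨s, hs, es⟩ := hu.2 x hx
      obtain ⟨t, ht, et⟩ := hv.2 y hy
      exact ⟨s * t, .mul hs ht, by rw [es, et, WithOne.coe_mul]⟩
  | pow u hu =>
    simp only [nrm, ev]
    rcases hx : nrm u with _ | x
    · refine ⟨fun _ => ?_, by simp⟩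
      obtain ⟨k, -, e⟩ := om_spec (1 : WithOne T)
      rw [hu.1 hx, e, one_pow]
    · refine ⟨by simp, ?_⟩
      intro w' h
      obtain rfl := Option.some.inj h
      obtain ⟨s, hs, es⟩ := hu.2 x hx
      obtain ⟨k, hk, e⟩ := om_spec (s : WithOne T)
      obtain ⟨k, rfl⟩ : ∃ j, k = j + 1 := ⟨k - 1, by omega⟩
      rw [← coe_spow] at e
      refine ⟨spow s k, .omPow hs ?_ ⟨k, rfl⟩, by rw [es, e]⟩
      have := om_idem (s : WithOne T)
      rw [e, ← WithOne.coe_mul, WithOne.coe_inj] at this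
      exact this

theorem withOne_da {T : Type} [Semigroup T] (hT : InDA T) : InDA (WithOne T) := by
  intro t
  refine WithOne.cases_on t (fun _ => mul_one _) ?_
  rintro t ⟨x, hx⟩
  revert hx
  refine WithOne.cases_on x ?_ ?_
  · intro hx; rw [mul_one] at hx; exact hx.symm
  · intro x hx
    rw [← WithOne.coe_mul, ← WithOne.coe_mul, WithOne.coe_inj] at hx
    have : t * t = t := hT t ⟨x, hx⟩
    unfold IsIdempotentElem
    rw [← WithOne.coe_mul, this]

theorem exists_idem (T : Type) [Semigroup T] [Finite T] (s : T) :
    ∃ t : T, IsIdempotentElem t := by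
  obtain ⟨k, hk, e⟩ := om_spec (s : WithOne T)
  obtain ⟨k, rfl⟩ : ∃ j, k = j + 1 := ⟨k - 1, by omega⟩
  rw [← coe_spow] at e
  refine ⟨spow s k, ?_⟩
  have := om_idem (s : WithOne T)
  rw [e, ← WithOne.coe_mul, WithOne.coe_inj] at this
  exact this

theorem sim_rep {n : ℕ} {v : List A} (h : Sim n (v ++ v) v) (k : ℕ) :
    Sim n (rep v (k + 1)) v := by
  induction k with
  | zero => simpa [rep] using Sim.refl n v
  | succ k ih =>
    rw [rep_succ]
    exact ((Sim.refl n v).append ih).trans h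

theorem words {S : Type} [Semigroup S] [Finite S] (φ : FreeSemigroup A →ₙ* S) (n : ℕ)
    (w : FreeSemigroup A) : ∃ l : List A, l ≠ [] ∧
      FreeSemigroup.lift (fun a => ((FreeMonoid.ofList [a] : FreeMonoid A) :
        (simCon A n).Quotient)) w = ((FreeMonoid.ofList l : FreeMonoid A)) ∧
      (φ w : WithOne S) = psi (fun a => ((φ (FreeSemigroup.of a) : S) : WithOne S)) l := by
  induction w using FreeSemigroup.recOnMul with
  | ih1 a => exact ⟨[a], by simp, rfl, by simp [psi]⟩
  | ih2 a w ha hw =>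
    obtain ⟨l, h1, h2, h3⟩ := ha
    obtain ⟨l', h1', h2', h3'⟩ := hw
    refine ⟨l ++ l', by simp [h1], ?_, ?_⟩
    · rw [map_mul, h2, h2', ← Con.coe_mul]; rfl
    · rw [map_mul, WithOne.coe_mul, h3, h3', psi_append]

end DAProof

/-- The pseudovariety `DA` is ω-reducible for idempotent pointlike sets. -/
theorem DA_omega_reducible_for_idempotent_pointlikes
    {S : Type} [Semigroup S] [Finite S]
    (P : Set S) (hP : IsDAIdempotentPointlike P)
    (A : Type) [Finite A]
    (φ : FreeSemigroup A →ₙ* S) (hφ : Function.Surjective φ) :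
    ∃ w : P → OTerm A,
      (∀ p : P, OEval (fun a => φ (FreeSemigroup.of a)) (w p) (p : S)) ∧
      (∀ (T : Type) [Semigroup T] [Finite T], InDA T →
        ∀ f : A → T, ∃ t : T, IsIdempotentElem t ∧ ∀ p : P, OEval f (w p) t) := by
  classical
  rcases P.eq_empty_or_nonempty with hPe | ⟨p₀, hp₀⟩
  · subst hPe
    refine ⟨fun p => (Set.notMem_empty _ p.2).elim, fun p => (Set.notMem_empty _ p.2).elim, ?_⟩
    intro T _ _ hT f
    have hA : Nonempty A := by
      by_contra hA
      have hS : ∀ s : S, False := fun s => by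
        obtain ⟨w, -⟩ := hφ s
        exact hA ⟨w.head⟩
      let _ : Semigroup Empty := { mul := fun a _ => a, mul_assoc := fun a => a.elim }
      obtain ⟨t, -⟩ := hP Empty (fun t => t.elim) ⊥ (fun s => (hS s).elim)
      exact t.elim
    obtain ⟨t, ht⟩ := DAProof.exists_idem T (f hA.some)
    exact ⟨t, ht, fun p => (Set.notMem_empty _ p.2).elim⟩
  · let g : A → WithOne S := fun a => ((φ (FreeSemigroup.of a) : S) : WithOne S)
    obtain ⟨n₀, H⟩ := DAProof.exists_hyp g (Nat.card A)
    let K := Nat.card (Set (WithOne S))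
    have hK : 0 < K := Nat.card_pos
    let n := n₀ + K + K
    have := DAProof.simCon_finite A n
    let θ : FreeSemigroup A →ₙ* (DAProof.simCon A n).Quotient :=
      FreeSemigroup.lift (fun a => ((FreeMonoid.ofList [a] : FreeMonoid A) :
        (DAProof.simCon A n).Quotient))
    obtain ⟨t, ht, hR⟩ := hP (DAProof.simCon A n).Quotient (DAProof.simCon_da A n)
      (MulHom.srange (φ.prod θ)) (fun s => by
        obtain ⟨w, rfl⟩ := hφ s
        exact ⟨θ w, w, rfl⟩)
    obtain ⟨v, rfl⟩ : ∃ v : List A, t = ((FreeMonoid.ofList v : FreeMonoid A) :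
        (DAProof.simCon A n).Quotient) := by
      induction t using Con.induction_on with | _ u
      exact ⟨u.toList, rfl⟩
    have hcl : ∀ p ∈ P, ∃ l : List A, l ≠ [] ∧ DAProof.Sim n l v ∧ DAProof.psi g l = p := by
      intro p hp
      obtain ⟨w, hw⟩ := hR p hp
      obtain ⟨hw1, hw2⟩ := Prod.mk.inj hw
      obtain ⟨l, h1, h2, h3⟩ := DAProof.words φ n w
      refine ⟨l, h1, ?_, ?_⟩
      · rw [← DAProof.simCon_eq, ← h2]
        exact hw2
      · rw [← h3, ← hw1]
    have hvv : DAProof.Sim n (v ++ v) v := by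
      rw [← DAProof.simCon_eq]
      exact ht
    have hne : (DAProof.al v).Nonempty := by
      obtain ⟨l, h1, h2, -⟩ := hcl p₀ hp₀
      obtain ⟨a, ha⟩ := List.exists_mem_of_ne_nil l h1
      exact ⟨a, (h2.mem_iff a).1 ha⟩
    have hcard : (DAProof.al v).ncard ≤ Nat.card A + 1 :=
      (Set.ncard_le_card _).trans (Nat.le_succ _)
    obtain ⟨w₀, hw₀, hid⟩ := DAProof.good_idem H (DAProof.al v) hcard hne v rfl
    have hrep : DAProof.Sim n (DAProof.rep v K ++ DAProof.rep v K) v := by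
      obtain ⟨j, hj⟩ : ∃ j, K = j + 1 := ⟨K - 1, by omega⟩
      rw [hj]
      exact ((DAProof.sim_rep hvv j).append (DAProof.sim_rep hvv j)).trans hvv
    have hterm : ∀ p : P, ∃ w : DAProof.ETerm A, DAProof.ev g w = ((p : S) : WithOne S) ∧
        DAProof.Eqv w w₀ := by
      rintro ⟨p, hp⟩
      obtain ⟨l, -, h2, h3⟩ := hcl p hp
      exact hw₀ _ ⟨l, h2.trans hrep.symm, h3⟩
    choose w hw1 hw2 using hterm
    have hsome : ∀ p : P, ∃ x, DAProof.nrm (w p) = some x := by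
      intro p
      rcases hx : DAProof.nrm (w p) with _ | x
      · have := (DAProof.nrm_spec (fun a => φ (FreeSemigroup.of a)) (w p)).1 hx
        exact absurd (this.symm.trans (hw1 p)) WithOne.one_ne_coe
      · exact ⟨x, rfl⟩
    choose x hx using hsome
    refine ⟨x, ?_, ?_⟩
    · intro p
      obtain ⟨s, h1, h2⟩ := (DAProof.nrm_spec (fun a => φ (FreeSemigroup.of a)) (w p)).2 _ (hx p)
      have : s = p := WithOne.coe_inj.1 (h2.symm.trans (hw1 p))
      exact this ▸ h1
    · intro T _ _ hT f
      have hT' := DAProof.withOne_da hT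
      choose s h1 h2 using fun p : P => (DAProof.nrm_spec f (w p)).2 _ (hx p)
      have hs : ∀ p : P, ((s p : T) : WithOne T) =
          DAProof.ev (fun a => (f a : WithOne T)) w₀ := by
        intro p
        rw [← h2 p]
        exact hw2 p _ hT' _
      refine ⟨s ⟨p₀, hp₀⟩, ?_, ?_⟩
      · have h := hid _ hT' (fun a => (f a : WithOne T))
        simp only [DAProof.ev] at h
        rw [← hs ⟨p₀, hp₀⟩, ← WithOne.coe_mul, WithOne.coe_inj] at h
        exact h
      · intro p
        have : s p = s ⟨p₀, hp₀⟩ := WithOne.coe_inj.1 ((hs p).trans (hs _).symm)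
        exact this ▸ h1 p
end

section
/- The pseudovariety DO is κ-reducible for pointlike sets: let S be a finite semigroup and P a DO-pointlike subset of S. Then for every finite alphabet A and every surjective homomorphism φ: A⁺ → S from the free semigroup on A, there exists a family (w_p)_{p∈P} of κ-terms over A such that, for each p ∈ P, w_p evaluates to p in S under the letter assignment given by φ restricted to A, and for every finite semigroup T in DO and every map from A to T, all the terms w_p evaluate to one and the same element of T. -/
/-- The two-sided ideal of a semigroup `T` generated by the element `s`. -/
def idealGen {T : Type} [Semigroup T] (s : T) : Set T :=
  {x | x = s ∨ (∃ u, x = s * u) ∨ (∃ u, x = u * s) ∨ ∃ u v, x = u * s * v}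

/-- The `J`-class of `s`: the set of elements generating the same two-sided
ideal as `s`. -/
def jClass {T : Type} [Semigroup T] (s : T) : Set T :=
  {x | idealGen x = idealGen s}

/-- A rectangular band is a semigroup satisfying `x * y * x = x`. -/
def IsRectangularBand (B : Type) [Semigroup B] : Prop :=
  ∀ x y : B, x * y * x = x

/-- The subset `J` of `T`, which is assumed closed under multiplication, is
isomorphic as a semigroup (with the induced multiplication) to `B × G`. -/
def IsIsoToProd {T : Type} [Semigroup T] (J : Set T)
    (B G : Type) [Semigroup B] [Group G] : Prop :=
  ∃ φ : ↥J → B × G, Function.Bijective φ ∧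
    ∀ (x y : T) (hx : x ∈ J) (hy : y ∈ J) (hxy : x * y ∈ J),
      φ ⟨x * y, hxy⟩ = φ ⟨x, hx⟩ * φ ⟨y, hy⟩

/-- A finite semigroup `T` lies in `DO` if every regular `J`-class of `T`
(i.e. one containing an idempotent) is closed under multiplication and, with
the induced multiplication, is isomorphic to the direct product of a
rectangular band and a group. -/
def InDO (T : Type) [Semigroup T] : Prop :=
  ∀ s : T, (∃ e ∈ jClass s, IsIdempotentElem e) →
    (∀ x ∈ jClass s, ∀ y ∈ jClass s, x * y ∈ jClass s) ∧
    ∃ (B G : Type) (iB : Semigroup B) (iG : Group G),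
      @IsRectangularBand B iB ∧ @IsIsoToProd T _ (jClass s) B G iB iG

/-- κ-terms over the alphabet `A`: letters, binary multiplication and the
unary `(ω-1)`-power. -/
inductive KTerm (A : Type) : Type
  | letter : A → KTerm A
  | mul : KTerm A → KTerm A → KTerm A
  | ommPow : KTerm A → KTerm A

/-- The evaluation relation for κ-terms in a semigroup `T`, given an assignment
`f` of letters.  The `(ω-1)`-power of an element `s` is the element `g` of the
cyclic subsemigroup generated by `s` such that `g * s = s * g = e` and
`g * e = g`, where `e` is the (unique, in a finite semigroup) idempotent power
`s^ω` of `s`. -/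
inductive KEval {A T : Type} [Semigroup T] (f : A → T) : KTerm A → T → Prop
  | letter (a : A) : KEval f (KTerm.letter a) (f a)
  | mul {u v : KTerm A} {s t : T} :
      KEval f u s → KEval f v t → KEval f (KTerm.mul u v) (s * t)
  | ommPow {u : KTerm A} {s e g : T} :
      KEval f u s →
      IsIdempotentElem e → (∃ n : ℕ, spow s n = e) →
      (∃ n : ℕ, spow s n = g) →
      g * s = e → s * g = e → g * e = g →
      KEval f (KTerm.ommPow u) g

/-- `P` is pointlike for the pseudovariety `DO`: for every finite semigroup `T`
in `DO` and every subsemigroup `R` of `S × T` projecting onto `S`, some `t ∈ T`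
is related to every element of `P`. -/
def IsDOPointlike {S : Type} [Semigroup S] (P : Set S) : Prop :=
  ∀ (T : Type) [Semigroup T] [Finite T], InDO T →
    ∀ R : Subsemigroup (S × T),
      (∀ s : S, ∃ t : T, (s, t) ∈ R) →
      ∃ t : T, ∀ p ∈ P, (p, t) ∈ R


theorem spow_zero {S : Type*} [Mul S] (s : S) : spow s 0 = s := rfl

theorem spow_succ {S : Type*} [Mul S] (s : S) (n : ℕ) : spow s (n + 1) = spow s n * s := by
  unfold spow
  rw [Function.iterate_succ_apply']

theorem coe_spow {S : Type*} [Semigroup S] (s : S) (n : ℕ) :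
    ((spow s n : S) : WithOne S) = (s : WithOne S) ^ (n + 1) := by
  induction n with
  | zero => simp [spow_zero]
  | succ k ih => rw [spow_succ, WithOne.coe_mul, ih, pow_succ _ (k + 1)]

theorem spow_eq_pow {S : Type*} [Monoid S] (s : S) (n : ℕ) : spow s n = s ^ (n + 1) := by
  induction n with
  | zero => simp [spow_zero]
  | succ k ih => rw [spow_succ, ih, pow_succ _ (k + 1)]

theorem spow_mul {S : Type*} [Semigroup S] (s : S) (m n : ℕ) :
    spow s m * spow s n = spow s (m + n + 1) := by
  apply WithOne.coe_injective
  rw [WithOne.coe_mul, coe_spow, coe_spow, coe_spow, ← pow_add]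
  congr 1; omega

theorem map_spow {S S' : Type*} [Semigroup S] [Semigroup S'] (h : S → S')
    (hh : ∀ x y, h (x * y) = h x * h y) (s : S) (n : ℕ) : h (spow s n) = spow (h s) n := by
  induction n with
  | zero => rfl
  | succ k ih => rw [spow_succ, hh, ih, spow_succ]

/-- `n + 1` is an exponent making all powers idempotent. -/
def IdemExp (T : Type) [Semigroup T] (n : ℕ) : Prop := ∀ s : T, IsIdempotentElem (spow s n)

/-- In a finite monoid some positive power makes everything idempotent. -/
theorem exists_pow_idem (M : Type*) [Monoid M] [Finite M] :
    ∃ N : ℕ, 0 < N ∧ ∀ s : M, s ^ N * s ^ N = s ^ N := by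
  classical
  have h1 : ∀ s : M, ∃ N : ℕ, 0 < N ∧ s ^ N * s ^ N = s ^ N := by
    intro s
    obtain ⟨i, j, hij, hs⟩ : ∃ i j : ℕ, i < j ∧ s ^ i = s ^ j := by
      obtain ⟨i, j, hne, hs⟩ := Finite.exists_ne_map_eq_of_infinite (fun n : ℕ => s ^ n)
      rcases lt_or_gt_of_ne hne with h | h
      · exact ⟨i, j, h, hs⟩
      · exact ⟨j, i, h, hs.symm⟩
    -- s^(m + k*(j-i)) = s^m for m ≥ i
    have hp : ∀ m k, i ≤ m → s ^ (m + k * (j - i)) = s ^ m := by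
      intro m k hm
      induction k with
      | zero => simp
      | succ k ih =>
        have e1 : m + (k + 1) * (j - i) = j + ((m - i) + k * (j - i)) := by
          have : (k + 1) * (j - i) = k * (j - i) + (j - i) := by ring
          omega
        have e2 : m + k * (j - i) = i + ((m - i) + k * (j - i)) := by omega
        rw [e1, pow_add, ← hs, ← pow_add, ← e2, ih]
    refine ⟨(i + 1) * (j - i), Nat.mul_pos (by omega) (by omega), ?_⟩
    rw [← pow_add]
    apply hp
    nlinarith [Nat.sub_pos_of_lt hij]
  choose N hN hs using h1
  have := Fintype.ofFinite M
  refine ⟨∏ s, N s, Finset.prod_pos (fun s _ => hN s), fun s => ?_⟩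
  obtain ⟨k, hk⟩ := Finset.dvd_prod_of_mem N (Finset.mem_univ s)
  rw [hk, pow_mul, ← (Commute.refl (s ^ N s)).mul_pow, hs]

theorem pow_idem_mul {M : Type*} [Monoid M] {s : M} {N : ℕ} (h : s ^ N * s ^ N = s ^ N) (k : ℕ)
    (hk : 0 < k) : s ^ (N * k) = s ^ N := by
  obtain ⟨k, rfl⟩ : ∃ k', k = k' + 1 := ⟨k - 1, by omega⟩
  clear hk
  induction k with
  | zero => simp
  | succ k ih => rw [Nat.mul_add, pow_add, ih, mul_one, h]

theorem exists_idemExp (T : Type) [Semigroup T] [Finite T] : ∃ n, IdemExp T n := by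
  have : Finite (WithOne T) := inferInstanceAs (Finite (Option T))
  obtain ⟨N, hN, h⟩ := exists_pow_idem (WithOne T)
  refine ⟨N - 1, fun s => ?_⟩
  apply WithOne.coe_injective
  have e : N - 1 + 1 = N := by omega
  rw [WithOne.coe_mul, coe_spow, e, h]

theorem IdemExp.pow {T : Type} [Semigroup T] {n : ℕ} (h : IdemExp T n) (c : WithOne T) :
    c ^ (n + 1) * c ^ (n + 1) = c ^ (n + 1) := by
  refine WithOne.cases_on c (by simp) (fun s => ?_)
  rw [← coe_spow, ← WithOne.coe_mul, h s]

/-- Explicit evaluation of terms. -/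
def sv {A T : Type} [Semigroup T] (n : ℕ) (f : A → T) : KTerm A → T
  | .letter a => f a
  | .mul u v => sv n f u * sv n f v
  | .ommPow u => spow (sv n f u) (2 * n)

theorem spow_omm_left {T : Type} [Semigroup T] {n : ℕ} (h : IdemExp T n) (s : T) :
    spow s (2 * n) * s = spow s n := by
  rw [← spow_succ, ← h s, spow_mul]; congr 1; omega

theorem kEval_sv {A T : Type} [Semigroup T] {n : ℕ} (h : IdemExp T n) (f : A → T) (t : KTerm A) :
    KEval f t (sv n f t) := by
  induction t with
  | letter a => exact .letter a
  | mul u v hu hv => exact .mul hu hv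
  | ommPow u hu =>
    refine .ommPow (e := spow (sv n f u) n) hu (h _) ⟨n, rfl⟩ ⟨2 * n, rfl⟩ (spow_omm_left h _) ?_ ?_
    · change sv n f u * spow (sv n f u) (2 * n) = _
      rw [← spow_omm_left h]
      conv_lhs => lhs; rw [← spow_zero (sv n f u)]
      conv_rhs => rhs; rw [← spow_zero (sv n f u)]
      rw [spow_mul, spow_mul]; congr 1; omega
    · simp only [sv]
      apply WithOne.coe_injective
      have := h.pow ((sv n f u : T) : WithOne T)
      rw [WithOne.coe_mul, coe_spow, coe_spow]
      have e : 2 * n + 1 = n + (n + 1) := by omega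
      rw [e, pow_add _ n, mul_assoc, this]

/-- Evaluation in the free group. -/
def fgv {A : Type} : KTerm A → FreeGroup A
  | .letter a => FreeGroup.of a
  | .mul u v => fgv u * fgv v
  | .ommPow u => (fgv u)⁻¹

/-- Content of a term. -/
def cont {A : Type} : KTerm A → Set A
  | .letter a => {a}
  | .mul u v => cont u ∪ cont v
  | .ommPow u => cont u

def omul {A : Type} : Option (KTerm A) → Option (KTerm A) → Option (KTerm A)
  | none, y => y
  | some u, none => some u
  | some u, some v => some (.mul u v)

def oomm {A : Type} : Option (KTerm A) → Option (KTerm A)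
  | none => none
  | some u => some (.ommPow u)

def osv {A T : Type} [Semigroup T] (n : ℕ) (f : A → T) : Option (KTerm A) → WithOne T
  | none => 1
  | some u => ((sv n f u : T) : WithOne T)

def ofg {A : Type} : Option (KTerm A) → FreeGroup A
  | none => 1
  | some u => fgv u

def ocont {A : Type} : Option (KTerm A) → Set A
  | none => ∅
  | some u => cont u

theorem osv_omul {A T : Type} [Semigroup T] (n : ℕ) (f : A → T) (x y : Option (KTerm A)) :
    osv n f (omul x y) = osv n f x * osv n f y := by
  cases x <;> cases y <;> simp [omul, osv, sv]

theorem ofg_omul {A : Type} (x y : Option (KTerm A)) :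
    ofg (omul x y) = ofg x * ofg y := by
  cases x <;> cases y <;> simp [omul, ofg, fgv]

theorem ocont_omul {A : Type} (x y : Option (KTerm A)) :
    ocont (omul x y) = ocont x ∪ ocont y := by
  cases x <;> cases y <;> simp [omul, ocont, cont]

theorem osv_oomm {A T : Type} [Semigroup T] (n : ℕ) (f : A → T) (x : Option (KTerm A)) :
    osv n f (oomm x) = (osv n f x) ^ (2 * n + 1) := by
  cases x <;> simp [oomm, osv, sv, coe_spow]

theorem ofg_oomm {A : Type} (x : Option (KTerm A)) : ofg (oomm x) = (ofg x)⁻¹ := by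
  cases x <;> simp [oomm, ofg, fgv]

theorem ocont_oomm {A : Type} (x : Option (KTerm A)) : ocont (oomm x) = ocont x := by
  cases x <;> simp [oomm, ocont, cont]

theorem cont_nonempty {A : Type} (t : KTerm A) : (cont t).Nonempty := by
  induction t with
  | letter a => exact ⟨a, rfl⟩
  | mul u v hu hv => exact hu.mono Set.subset_union_left
  | ommPow u hu => exact hu


section Ideals
variable {T : Type} [Semigroup T]

theorem mem_idealGen_iff {x s : T} :
    x ∈ idealGen s ↔ ∃ u v : WithOne T, (x : WithOne T) = u * s * v := by
  constructor
  · rintro (h | ⟨u, h⟩ | ⟨u, h⟩ | ⟨u, v, h⟩)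
    · exact ⟨1, 1, by simp [h]⟩
    · exact ⟨1, u, by simp [h]⟩
    · exact ⟨u, 1, by simp [h]⟩
    · exact ⟨u, v, by simp [h]⟩
  · rintro ⟨u, v, h⟩
    revert h
    refine WithOne.cases_on u ?_ (fun u => ?_) <;> refine WithOne.cases_on v ?_ (fun v => ?_) <;>
      intro h
    · left; apply WithOne.coe_injective; simpa using h
    · right; left; refine ⟨v, ?_⟩; apply WithOne.coe_injective; simpa using h
    · right; right; left; refine ⟨u, ?_⟩; apply WithOne.coe_injective; simpa using h
    · right; right; right; refine ⟨u, v, ?_⟩; apply WithOne.coe_injective; simpa using h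

theorem idealGen_self (x : T) : x ∈ idealGen x := Or.inl rfl

theorem idealGen_trans {x y z : T} (h1 : x ∈ idealGen y) (h2 : y ∈ idealGen z) :
    x ∈ idealGen z := by
  rw [mem_idealGen_iff] at *
  obtain ⟨a, b, h1⟩ := h1
  obtain ⟨c, d, h2⟩ := h2
  exact ⟨a * c, d * b, by rw [h1, h2]; simp only [mul_assoc]⟩

theorem mul_left_mem_idealGen (x y : T) : x * y ∈ idealGen y := Or.inr (Or.inr (Or.inl ⟨x, rfl⟩))
theorem mul_right_mem_idealGen (x y : T) : x * y ∈ idealGen x := Or.inr (Or.inl ⟨y, rfl⟩)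

theorem mem_jClass_iff {x s : T} : x ∈ jClass s ↔ x ∈ idealGen s ∧ s ∈ idealGen x := by
  constructor
  · intro h
    have h : idealGen x = idealGen s := h
    exact ⟨h ▸ idealGen_self x, h ▸ idealGen_self s⟩
  · rintro ⟨h1, h2⟩
    exact Set.ext fun y => ⟨fun h => idealGen_trans h h1, fun h => idealGen_trans h h2⟩

theorem mem_jClass_self (s : T) : s ∈ jClass s := mem_jClass_iff.2 ⟨idealGen_self s, idealGen_self s⟩

theorem idem_factor {e u : T} (he : e * e = e) (h : e ∈ idealGen u) :
    ∃ a b, e = a * u * b ∧ e * a = a ∧ b * e = b := by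
  rcases h with h | ⟨v, h⟩ | ⟨v, h⟩ | ⟨v, w, h⟩
  · exact ⟨e, e, by rw [← h, he, he], he, he⟩
  · exact ⟨e, v * e, by rw [← mul_assoc, mul_assoc e u v, ← h, he, he], he, by rw [mul_assoc, he]⟩
  · exact ⟨e * v, e, by rw [mul_assoc e v u, ← h, he, he], by rw [← mul_assoc, he], he⟩
  · refine ⟨e * v, w * e, ?_, by rw [← mul_assoc, he], by rw [mul_assoc, he]⟩
    calc e = e * e * e := by rw [he, he]
      _ = e * (v * u * w) * e := by rw [← h]
      _ = _ := by simp only [mul_assoc]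

end Ideals

section DOfacts
variable {T : Type} [Semigroup T]

theorem InDO.closed (hT : InDO T) {e : T} (he : e * e = e) {x y : T}
    (hx : x ∈ jClass e) (hy : y ∈ jClass e) : x * y ∈ jClass e :=
  (hT e ⟨e, mem_jClass_self e, he⟩).1 x hx y hy

theorem InDO.mul_mem (hT : InDO T) {e u : T} (he : e * e = e) (h : e ∈ idealGen u) :
    e * u ∈ jClass e ∧ u * e ∈ jClass e := by
  obtain ⟨a, b, h1, h2, h3⟩ := idem_factor he h
  have hub : u * b ∈ jClass e := by
    refine mem_jClass_iff.2 ⟨?_, ?_⟩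
    · rw [← h3, ← mul_assoc]; exact mul_left_mem_idealGen _ _
    · have := mul_left_mem_idealGen a (u * b)
      rwa [← mul_assoc, ← h1] at this
  have hau : a * u ∈ jClass e := by
    refine mem_jClass_iff.2 ⟨?_, ?_⟩
    · rw [← h2, mul_assoc]; exact mul_right_mem_idealGen _ _
    · have := mul_right_mem_idealGen (a * u) b
      rwa [← h1] at this
  constructor
  · refine mem_jClass_iff.2 ⟨mul_right_mem_idealGen _ _, ?_⟩
    refine idealGen_trans (mem_jClass_iff.1 (hT.closed he (mem_jClass_self e) hub)).2 ?_
    rw [← mul_assoc]; exact mul_right_mem_idealGen _ _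
  · refine mem_jClass_iff.2 ⟨mul_left_mem_idealGen _ _, ?_⟩
    refine idealGen_trans (mem_jClass_iff.1 (hT.closed he hau (mem_jClass_self e))).2 ?_
    rw [mul_assoc]; exact mul_left_mem_idealGen _ _

theorem InDO.F_mul (hT : InDO T) {e u v : T} (he : e * e = e) (hu : e ∈ idealGen u)
    (hv : e ∈ idealGen v) : e ∈ idealGen (u * v) := by
  have := hT.closed he (hT.mul_mem he hu).1 (hT.mul_mem he hv).2
  refine idealGen_trans (mem_jClass_iff.1 this).2 (Or.inr (Or.inr (Or.inr ⟨e, e, ?_⟩)))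
  simp only [mul_assoc]

theorem InDO.coords (hT : InDO T) {e : T} (he : e * e = e) :
    ∃ (B G : Type) (_ : Semigroup B) (_ : Group G) (β : T → B) (γ : T → G),
      (∀ x y : B, x * y * x = x) ∧
      (∀ x ∈ jClass e, ∀ y ∈ jClass e, β (x * y) = β x * β y) ∧
      (∀ x ∈ jClass e, ∀ y ∈ jClass e, γ (x * y) = γ x * γ y) ∧
      (∀ x ∈ jClass e, ∀ y ∈ jClass e, β x = β y → γ x = γ y → x = y) := by
  classical
  obtain ⟨hc, B, G, iB, iG, hB, ι, hι, hm⟩ := hT e ⟨e, mem_jClass_self e, he⟩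
  let ι' : T → B × G := fun x => if h : x ∈ jClass e then ι ⟨x, h⟩ else ι ⟨e, mem_jClass_self e⟩
  have hι' : ∀ x (h : x ∈ jClass e), ι' x = ι ⟨x, h⟩ := fun x h => by simp [ι', h]
  have hmul : ∀ x ∈ jClass e, ∀ y ∈ jClass e, ι' (x * y) = ι' x * ι' y := by
    intro x hx y hy
    rw [hι' x hx, hι' y hy, hι' _ (hc x hx y hy), hm]
  refine ⟨B, G, iB, iG, fun x => (ι' x).1, fun x => (ι' x).2, hB, ?_, ?_, ?_⟩
  · intro x hx y hy; simp only [hmul x hx y hy]; rfl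
  · intro x hx y hy; simp only [hmul x hx y hy]; rfl
  · intro x hx y hy h1 h2
    have : ι' x = ι' y := Prod.ext h1 h2
    rw [hι' x hx, hι' y hy] at this
    simpa using hι.1 this

theorem rect_mid {B : Type} [Semigroup B] (hB : ∀ x y : B, x * y * x = x) (x f y : B) :
    x * f * y = x * y := by
  calc x * f * y = x * f * (y * x * y) := by rw [hB]
    _ = (x * (f * y) * x) * y := by simp only [mul_assoc]
    _ = x * y := by rw [hB]

theorem InDO.mid (hT : InDO T) {e : T} (he : e * e = e) {a b f : T} (ha : a ∈ jClass e)
    (hb : b ∈ jClass e) (hf : f ∈ jClass e) (hff : f * f = f) : a * f * b = a * b := by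
  obtain ⟨B, G, _, _, β, γ, hB, h1, h2, h3⟩ := hT.coords he
  have haf := hT.closed he ha hf
  have hab := hT.closed he ha hb
  refine h3 _ (hT.closed he haf hb) _ hab ?_ ?_
  · rw [h1 _ haf _ hb, h1 _ ha _ hf, h1 _ ha _ hb, rect_mid hB]
  · have : γ f = 1 := by
      have := h2 f hf f hf
      rw [hff] at this
      exact (mul_eq_left.1 this.symm)
    rw [h2 _ haf _ hb, h2 _ ha _ hf, h2 _ ha _ hb, this, mul_one]

theorem InDO.F_spow (hT : InDO T) {e u : T} (he : e * e = e) (hu : e ∈ idealGen u) (k : ℕ) :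
    e ∈ idealGen (spow u k) := by
  induction k with
  | zero => exact hu
  | succ k ih => rw [spow_succ]; exact hT.F_mul he ih hu

theorem InDO.F_sv (hT : InDO T) {A : Type} {n : ℕ} {e : T} (he : e * e = e) (g : A → T)
    (t : KTerm A) (ht : ∀ a ∈ cont t, e ∈ idealGen (g a)) : e ∈ idealGen (sv n g t) := by
  induction t with
  | letter a => exact ht a rfl
  | mul u v hu hv =>
    exact hT.F_mul he (hu fun a h => ht a (Or.inl h)) (hv fun a h => ht a (Or.inr h))
  | ommPow u hu => exact hT.F_spow he (hu ht) _

theorem InDO.local_mem (hT : InDO T) {e u : T} (he : e * e = e) (hu : e ∈ idealGen u) :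
    e * u * e ∈ jClass e := hT.closed he (hT.mul_mem he hu).1 (mem_jClass_self e)

theorem InDO.local_mul (hT : InDO T) {e u v : T} (he : e * e = e) (hu : e ∈ idealGen u)
    (hv : e ∈ idealGen v) : e * (u * v) * e = (e * u * e) * (e * v * e) := by
  have := hT.mid he (hT.mul_mem he hu).1 (hT.mul_mem he hv).2 (mem_jClass_self e) he
  calc e * (u * v) * e = (e * u) * (v * e) := by simp only [mul_assoc]
    _ = e * u * e * (v * e) := this.symm
    _ = e * u * (e * e) * (v * e) := by rw [he]
    _ = _ := by simp only [mul_assoc]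

/-- Between `J`-equivalent idempotents only the free group value of a term matters. -/
theorem InDO.term_eq (hT : InDO T) {A : Type} {n : ℕ} (hn : IdemExp T n) {e f : T}
    (he : e * e = e) (hf : f * f = f) (hef : f ∈ jClass e) (g : A → T) (t t' : KTerm A)
    (ht : ∀ a ∈ cont t, e ∈ idealGen (g a)) (ht' : ∀ a ∈ cont t', e ∈ idealGen (g a))
    (hfg : fgv t = fgv t') : e * sv n g t * f = e * sv n g t' * f := by
  classical
  obtain ⟨B, G, _, _, β, γ, hB, h1, h2, h3⟩ := hT.coords he
  let θ : A → G := fun a => γ (e * g a * e)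
  have key : ∀ t : KTerm A, (∀ a ∈ cont t, e ∈ idealGen (g a)) →
      γ (e * sv n g t * e) = FreeGroup.lift θ (fgv t) := by
    intro t
    induction t with
    | letter a => intro _; simp [sv, fgv, θ]
    | mul u v hu hv =>
      intro h
      have hu' := fun a h' => h a (Or.inl h')
      have hv' := fun a h' => h a (Or.inr h')
      have ku := hT.F_sv (n := n) he g u hu'
      have kv := hT.F_sv (n := n) he g v hv'
      simp only [sv, fgv, map_mul]
      rw [hT.local_mul he ku kv, h2 _ (hT.local_mem he ku) _ (hT.local_mem he kv), hu hu', hv hv']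
    | ommPow u hu =>
      intro h
      have ku := hT.F_sv (n := n) he g u h
      simp only [sv, fgv, map_inv]
      rw [← hu h]
      set s := sv n g u
      have k1 := hT.F_spow he ku (2 * n)
      have k2 := hT.F_spow he ku n
      apply eq_inv_of_mul_eq_one_left
      rw [← h2 _ (hT.local_mem he k1) _ (hT.local_mem he ku), ← hT.local_mul he k1 ku,
        spow_omm_left hn]
      have := h2 _ (hT.local_mem he k2) _ (hT.local_mem he k2)
      rw [← hT.local_mul he k2 k2, hn s] at this
      exact (mul_eq_left.1 this.symm)
  have kt := hT.F_sv (n := n) he g t ht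
  have kt' := hT.F_sv (n := n) he g t' ht'
  have hβ : ∀ u, e ∈ idealGen u → β (e * u * e) = β e := by
    intro u hu
    have hx := hT.local_mem he hu
    have hxe : e * (e * u * e) * e = e * u * e := by
      have : e * (e * u * e) * e = (e * e) * u * (e * e) := by simp only [mul_assoc]
      rw [this, he]
    have := h1 _ (hT.closed he (mem_jClass_self e) hx) _ (mem_jClass_self e)
    rw [hxe, h1 _ (mem_jClass_self e) _ hx, hB] at this
    exact this
  have heq : e * sv n g t * e = e * sv n g t' * e := by
    refine h3 _ (hT.local_mem he kt) _ (hT.local_mem he kt') ?_ ?_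
    · rw [hβ _ kt, hβ _ kt']
    · rw [key t ht, key t' ht', hfg]
  have k1 := hT.mid he (hT.mul_mem he kt).1 hef (mem_jClass_self e) he
  have k2 := hT.mid he (hT.mul_mem he kt').1 hef (mem_jClass_self e) he
  rw [← k1, ← k2, heq]

end DOfacts

/-- The defining identity of `DO` for monoids. -/
def DOm (Q : Type) [Monoid Q] : Prop :=
  ∃ N : ℕ, 0 < N ∧ (∀ x : Q, x ^ N * x ^ N = x ^ N) ∧
    ∀ x y : Q, (x * y) ^ N * (y * x) ^ N * (x * y) ^ N = (x * y) ^ N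


theorem mem_idealGen_monoid {Q : Type} [Monoid Q] {x s : Q} :
    x ∈ idealGen s ↔ ∃ u v, x = u * s * v := by
  constructor
  · rintro (h | ⟨u, h⟩ | ⟨u, h⟩ | ⟨u, v, h⟩)
    · exact ⟨1, 1, by simp [h]⟩
    · exact ⟨1, u, by simp [h]⟩
    · exact ⟨u, 1, by simp [h]⟩
    · exact ⟨u, v, h⟩
  · rintro ⟨u, v, h⟩
    exact Or.inr (Or.inr (Or.inr ⟨u, v, h⟩))

theorem idem_pow_eq {Q : Type} [Monoid Q] {f : Q} (h : f * f = f) {N : ℕ} (hN : 0 < N) :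
    f ^ N = f := by
  obtain ⟨k, rfl⟩ : ∃ k, N = k + 1 := ⟨N - 1, by omega⟩
  clear hN
  induction k with
  | zero => simp
  | succ k ih => rw [pow_succ, ih, h]

section DOmIn
variable {Q : Type} [Monoid Q] {N : ℕ}

theorem dom_jidem (hN : 0 < N) (hid : ∀ x : Q, x ^ N * x ^ N = x ^ N)
    (hdo : ∀ x y : Q, (x * y) ^ N * (y * x) ^ N * (x * y) ^ N = (x * y) ^ N)
    {e f : Q} (he : e * e = e) (hf : f * f = f) (hef : f ∈ jClass e) : f * e * f = f := by
  obtain ⟨hfe, hef⟩ := mem_jClass_iff.1 hef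
  obtain ⟨a, b, h1, h2, h3⟩ := idem_factor hf hfe
  have hk : (e * b * (a * e)) * (e * b * (a * e)) = e * b * (a * e) := by
    calc (e * b * (a * e)) * (e * b * (a * e)) = e * b * (a * (e * e) * b) * a * e := by
          simp only [mul_assoc]
      _ = e * (b * f) * a * e := by rw [he, ← h1]; simp only [mul_assoc]
      _ = _ := by rw [h3]; simp only [mul_assoc]
  set k := e * b * (a * e) with hkdef
  have hek : e * k = k := by rw [hkdef]; simp only [← mul_assoc, he]
  have hke : k * e = k := by rw [hkdef]; simp only [mul_assoc, he]
  have hfk : f ∈ idealGen k := by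
    rw [mem_idealGen_monoid]
    refine ⟨a * e, e * b, ?_⟩
    have e1 : f = (a * e) * (e * b) := by
      calc f = a * (e * e) * b := by rw [he, ← h1]
        _ = _ := by simp only [mul_assoc]
    calc f = f * f := hf.symm
      _ = _ := by rw [hkdef]; nth_rw 1 [e1]; nth_rw 1 [e1]; simp only [mul_assoc]
  obtain ⟨c, d, g1, g2, g3⟩ := idem_factor he (idealGen_trans hef hfk)
  have hx : ∀ n, e = c ^ (n + 1) * (k * d) ^ (n + 1) := by
    intro n
    induction n with
    | zero => simpa [mul_assoc] using g1
    | succ n ih =>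
      have : c ^ (n + 1 + 1) * (k * d) ^ (n + 1 + 1) = c ^ (n + 1) * (c * k * d) * (k * d) ^ (n + 1) := by
        rw [pow_succ, pow_succ' (k * d) (n + 1)]; simp only [mul_assoc]
      rw [this, ← g1, mul_assoc, pow_succ' (k * d) n, ← mul_assoc e, ← mul_assoc e, hek, ← pow_succ', ← ih]
  have hN' : N - 1 + 1 = N := by omega
  have hxN := hx (N - 1)
  rw [hN'] at hxN
  have h5 : e * (k * d) ^ N = e := by
    nth_rw 1 [hxN]
    rw [mul_assoc, hid, ← hxN]
  have h6 : e * (k * d) ^ N = (k * d) ^ N := by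
    rw [← hN', pow_succ', ← mul_assoc, ← mul_assoc e, hek]
  have h7 : k * e = e := by
    rw [← h5, h6, ← hN', pow_succ', ← mul_assoc, ← mul_assoc, hk]
  have h8 : k = e := by rw [← hke, h7]
  have e1 : f = (a * e) * (e * b) := by
    calc f = a * (e * e) * b := by rw [he, ← h1]
      _ = _ := by simp only [mul_assoc]
  have := hdo (a * e) (e * b)
  rw [← e1, ← hkdef, h8, idem_pow_eq he hN, idem_pow_eq hf hN] at this
  exact this

theorem dom_F_mul (hN : 0 < N) (hid : ∀ x : Q, x ^ N * x ^ N = x ^ N)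
    (hdo : ∀ x y : Q, (x * y) ^ N * (y * x) ^ N * (x * y) ^ N = (x * y) ^ N)
    {e u v : Q} (he : e * e = e) (hu : e ∈ idealGen u) (hv : e ∈ idealGen v) :
    e ∈ idealGen (u * v) := by
  have hN' : N - 1 + 1 = N := by omega
  -- general fact
  have gen : ∀ p q : Q, e = p * q → e * p = p → (q * p) ^ N ∈ jClass e := by
    intro p q h hp
    have h1 := hdo p q
    rw [← h, idem_pow_eq he hN] at h1
    refine mem_jClass_iff.2 ⟨?_, ?_⟩
    · rw [mem_idealGen_monoid]
      refine ⟨(q * p) ^ (N - 1) * q, p, ?_⟩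
      rw [← hN', pow_succ]
      simp only [mul_assoc, hN', hp]
    · rw [mem_idealGen_monoid]
      exact ⟨e, e, h1.symm⟩
  obtain ⟨f, f', hf, hfJ, hff⟩ : ∃ f f', f = f' * u ∧ f ∈ jClass e ∧ f * f = f := by
    obtain ⟨a, b, h1, h2, h3⟩ := idem_factor he hu
    refine ⟨(b * (a * u)) ^ N, (b * (a * u)) ^ (N - 1) * b * a, ?_, gen _ _ h1 ?_, hid _⟩
    · conv_lhs => rw [← hN', pow_succ]
      simp only [mul_assoc]
    · rw [← mul_assoc, h2]
  obtain ⟨g, g', hg, hgJ, hgg⟩ : ∃ g g', g = v * g' ∧ g ∈ jClass e ∧ g * g = g := by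
    obtain ⟨a, b, h1, h2, h3⟩ := idem_factor he hv
    refine ⟨((v * b) * a) ^ N, b * a * ((v * b) * a) ^ (N - 1), ?_,
      gen _ _ (by rw [← mul_assoc, ← h1]) h2, hid _⟩
    conv_lhs => rw [← hN', pow_succ']
    simp only [mul_assoc]
  have hfg : f ∈ jClass g := by
    have a1 := mem_jClass_iff.1 hfJ
    have a2 := mem_jClass_iff.1 hgJ
    exact mem_jClass_iff.2 ⟨idealGen_trans a1.1 a2.2, idealGen_trans a2.1 a1.2⟩
  have := dom_jidem hN hid hdo hgg hff hfg
  refine idealGen_trans (mem_jClass_iff.1 hfJ).2 ?_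
  rw [mem_idealGen_monoid]
  refine ⟨f', g' * f, ?_⟩
  calc f = (f' * u) * (v * g') * f := by rw [← hf, ← hg, this]
    _ = _ := by simp only [mul_assoc]

theorem DOm.inDO (h : DOm Q) : InDO Q := by
  obtain ⟨N, hN, hid, hdo⟩ := h
  rintro s ⟨e, heJ, he⟩
  have he : e * e = e := he
  have hJ : jClass s = jClass e := by
    have heJ : idealGen e = idealGen s := heJ
    unfold jClass; rw [heJ]
  rw [hJ]
  have hN' : N - 1 + 1 = N := by omega
  have F_mul := fun {u v : Q} => dom_F_mul (u := u) (v := v) hN hid hdo he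
  have closed : ∀ x ∈ jClass e, ∀ y ∈ jClass e, x * y ∈ jClass e := by
    intro x hx y hy
    rw [mem_jClass_iff] at *
    exact ⟨idealGen_trans (mul_right_mem_idealGen _ _) hx.1, F_mul hx.2 hy.2⟩
  have hpow : ∀ x ∈ jClass e, ∀ k, x ^ (k + 1) ∈ jClass e := by
    intro x hx k
    induction k with
    | zero => simpa using hx
    | succ k ih => rw [pow_succ]; exact closed _ ih _ hx
  have heJ' := mem_jClass_self e
  have hpN : ∀ x ∈ jClass e, x ^ N ∈ jClass e := fun x hx => by
    rw [← hN']; exact hpow x hx _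
  have reg : ∀ x ∈ jClass e, x ^ N * x = x := by
    intro x hx
    have h1 : x ∈ idealGen (x ^ (N + 1)) :=
      idealGen_trans (mem_jClass_iff.1 hx).1 (mem_jClass_iff.1 (hpow x hx N)).2
    obtain ⟨a, b, h1⟩ := mem_idealGen_monoid.1 h1
    have h2 : x = a * x * (x ^ N * b) := by
      rw [pow_succ'] at h1
      simpa only [mul_assoc] using h1
    have h3 : ∀ n, x = a ^ n * x * (x ^ N * b) ^ n := by
      intro n
      induction n with
      | zero => simp
      | succ n ih =>
        calc x = a ^ n * x * (x ^ N * b) ^ n := ih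
          _ = a ^ n * (a * x * (x ^ N * b)) * (x ^ N * b) ^ n := by rw [← h2]
          _ = _ := by rw [pow_succ, pow_succ' (x ^ N * b)]; simp only [mul_assoc]
    have h4 : x * (x ^ N * b) ^ N = x := by
      nth_rw 1 [h3 N]
      rw [mul_assoc, hid, ← h3 N]
    have h5 : x = x ^ N * x * (b * (x ^ N * b) ^ (N - 1)) := by
      have : x ^ N * x = x * x ^ N := by rw [← pow_succ, ← pow_succ']
      rw [this]
      conv_lhs => rw [← h4, ← hN', pow_succ', hN']
      simp only [mul_assoc]
    calc x ^ N * x = x ^ N * (x ^ N * x * (b * (x ^ N * b) ^ (N - 1))) := by rw [← h5]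
      _ = (x ^ N * x ^ N) * x * (b * (x ^ N * b) ^ (N - 1)) := by simp only [mul_assoc]
      _ = x := by rw [hid, ← h5]
  have reg' : ∀ x ∈ jClass e, x * x ^ N = x := by
    intro x hx
    rw [← pow_succ', pow_succ, reg x hx]
  have rect : ∀ f ∈ jClass e, ∀ g ∈ jClass e, f * f = f → g * g = g → f * g * f = f := by
    intro f hf g hg hff hgg
    refine dom_jidem hN hid hdo hgg hff ?_
    have a1 := mem_jClass_iff.1 hf
    have a2 := mem_jClass_iff.1 hg
    exact mem_jClass_iff.2 ⟨idealGen_trans a1.1 a2.2, idealGen_trans a2.1 a1.2⟩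
  have imul : ∀ f ∈ jClass e, ∀ g ∈ jClass e, f * f = f → g * g = g → (f * g) * (f * g) = f * g := by
    intro f hf g hg hff hgg
    rw [← mul_assoc, rect f hf g hg hff hgg]
  have imid : ∀ f ∈ jClass e, ∀ k ∈ jClass e, ∀ g ∈ jClass e, f * f = f → k * k = k → g * g = g →
      f * k * g = f * g := by
    intro f hf k hk g hg hff hkk hgg
    calc f * k * g = f * k * (g * f * g) := by rw [rect g hg f hf hgg hff]
      _ = f * (k * g) * f * g := by simp only [mul_assoc]
      _ = f * g := by rw [rect f hf _ (closed _ hk _ hg) hff (imul _ hk _ hg hkk hgg)]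
  have mid : ∀ x ∈ jClass e, ∀ k ∈ jClass e, ∀ y ∈ jClass e, k * k = k → x * k * y = x * y := by
    intro x hx k hk y hy hkk
    calc x * k * y = (x * x ^ N) * k * (y ^ N * y) := by rw [reg' x hx, reg y hy]
      _ = x * (x ^ N * k * y ^ N) * y := by simp only [mul_assoc]
      _ = (x * x ^ N) * (y ^ N * y) := by
        rw [imid _ (hpN x hx) _ hk _ (hpN y hy) (hid _) hkk (hid _)]; simp only [mul_assoc]
      _ = _ := by rw [reg' x hx, reg y hy]
  have powmul : ∀ x ∈ jClass e, ∀ y ∈ jClass e, (x * y) ^ N = x ^ N * y ^ N := by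
    intro x hx y hy
    have h1 : x ^ N * (x * y) ^ N = (x * y) ^ N := by
      rw [← hN', pow_succ' (x * y), hN', ← mul_assoc, ← mul_assoc, reg x hx]
    have h2 : (x * y) ^ N * y ^ N = (x * y) ^ N := by
      rw [← hN', pow_succ (x * y), hN', mul_assoc, mul_assoc, reg' y hy]
    have h3 := imid _ (hpN x hx) _ (hpN _ (closed x hx y hy)) _ (hpN y hy) (hid _) (hid _) (hid _)
    rw [h1, h2] at h3
    exact h3
  refine ⟨closed, ?_⟩
  have gpow : ∀ x ∈ jClass e, e * x = x → x * e = x → x ^ N = e := by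
    intro x hx h1 h2
    have h3 := rect e heJ' _ (hpN x hx) he (hid x)
    have h4 : e * x ^ N = x ^ N := by rw [← hN', pow_succ', ← mul_assoc, h1]
    have h5 : x ^ N * e = x ^ N := by rw [← hN', pow_succ, mul_assoc, h2]
    rw [h4, h5] at h3; exact h3
  let iB : Semigroup {f : Q // f ∈ jClass e ∧ f * f = f} :=
    { mul := fun f g => ⟨f.1 * g.1, closed _ f.2.1 _ g.2.1, imul _ f.2.1 _ g.2.1 f.2.2 g.2.2⟩
      mul_assoc := fun f g h => Subtype.ext (mul_assoc _ _ _) }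
  let mG : Mul {x : Q // x ∈ jClass e ∧ e * x = x ∧ x * e = x} :=
    ⟨fun f g => ⟨f.1 * g.1, closed _ f.2.1 _ g.2.1, by rw [← mul_assoc, f.2.2.1],
      by rw [mul_assoc, g.2.2.2]⟩⟩
  let oG : One {x : Q // x ∈ jClass e ∧ e * x = x ∧ x * e = x} := ⟨⟨e, heJ', he, he⟩⟩
  let vG : Inv {x : Q // x ∈ jClass e ∧ e * x = x ∧ x * e = x} :=
    ⟨fun x => ⟨x.1 ^ (2 * (N - 1) + 1), hpow _ x.2.1 _,
      by rw [pow_succ', ← mul_assoc, x.2.2.1], by rw [pow_succ, mul_assoc, x.2.2.2]⟩⟩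
  let iG : Group {x : Q // x ∈ jClass e ∧ e * x = x ∧ x * e = x} :=
    Group.ofLeftAxioms (fun a b c => Subtype.ext (mul_assoc _ _ _))
      (fun a => Subtype.ext a.2.2.1)
      (fun a => Subtype.ext (by
        change a.1 ^ (2 * (N - 1) + 1) * a.1 = e
        have : 2 * (N - 1) + 1 + 1 = N + N := by omega
        rw [← pow_succ, this, pow_add, hid, gpow _ a.2.1 a.2.2.1 a.2.2.2]))
  refine ⟨_, _, iB, iG, fun f g => Subtype.ext (rect _ f.2.1 _ g.2.1 f.2.2 g.2.2), ?_⟩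
  refine ⟨fun x => (⟨x.1 ^ N, hpN _ x.2, hid _⟩,
    ⟨e * x.1 * e, closed _ (closed _ heJ' _ x.2) _ heJ', by simp only [← mul_assoc, he],
      by simp only [mul_assoc, he]⟩), ⟨?_, ?_⟩, ?_⟩
  · rintro ⟨x, hx⟩ ⟨y, hy⟩ h
    simp only [Prod.mk.injEq, Subtype.mk.injEq] at h
    have key : ∀ x ∈ jClass e, x = x ^ N * (e * x * e) * x ^ N := by
      intro x hx
      have : x ^ N * (e * x * e) * x ^ N = (x ^ N * e * x) * e * x ^ N := by simp only [mul_assoc]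
      rw [this, mid _ (hpN x hx) _ heJ' _ hx he, reg x hx, mid _ hx _ heJ' _ (hpN x hx) he, reg' x hx]
    apply Subtype.ext
    change x = y
    rw [key x hx, key y hy, h.1, h.2]
  · rintro ⟨⟨f, hf, hff⟩, ⟨g, hg, h1, h2⟩⟩
    refine ⟨⟨f * g * f, closed _ (closed _ hf _ hg) _ hf⟩, ?_⟩
    simp only [Prod.mk.injEq, Subtype.mk.injEq]
    constructor
    · rw [powmul _ (closed _ hf _ hg) _ hf, powmul _ hf _ hg, gpow g hg h1 h2, idem_pow_eq hff hN,
        rect f hf e heJ' hff he]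
    · calc e * (f * g * f) * e = (e * f * g) * f * e := by simp only [mul_assoc]
        _ = g * f * e := by rw [mid e heJ' f hf g hg hff, h1]
        _ = g := by rw [mid g hg f hf e heJ' hff, h2]
  · intro x y hx hy hxy
    refine Prod.ext (Subtype.ext (powmul x hx y hy)) (Subtype.ext ?_)
    change e * (x * y) * e = (e * x * e) * (e * y * e)
    calc e * (x * y) * e = e * (x * e * y) * e := by rw [mid x hx e heJ' y hy he]
      _ = e * x * (e * e) * y * e := by rw [he]; simp only [mul_assoc]
      _ = _ := by simp only [mul_assoc]

end DOmIn


/-- The expansion of a monoid recording the first occurrences of letters. -/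
def LExp (A Q : Type) : Type := Q × (A → Option (Q × Q))

instance {A Q : Type} [Finite A] [Finite Q] : Finite (LExp A Q) :=
  inferInstanceAs (Finite (Q × (A → Option (Q × Q))))

/-- Combination of the occurrence data. -/
def lcomb {Q : Type} [Monoid Q] (p q : Q) : Option (Q × Q) → Option (Q × Q) → Option (Q × Q)
  | some (x, y), _ => some (x, y * q)
  | none, some (x, y) => some (p * x, y)
  | none, none => none

instance LExp.instMonoid {A Q : Type} [Monoid Q] : Monoid (LExp A Q) where
  mul X Y := (X.1 * Y.1, fun a => lcomb X.1 Y.1 (X.2 a) (Y.2 a))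
  one := (1, fun _ => none)
  mul_assoc X Y Z := by
    refine Prod.ext (mul_assoc _ _ _) (funext fun a => ?_)
    change lcomb (X.1 * Y.1) Z.1 (lcomb X.1 Y.1 (X.2 a) (Y.2 a)) (Z.2 a) =
      lcomb X.1 (Y.1 * Z.1) (X.2 a) (lcomb Y.1 Z.1 (Y.2 a) (Z.2 a))
    rcases X.2 a with _ | ⟨x, y⟩ <;> rcases Y.2 a with _ | ⟨x', y'⟩ <;>
      rcases Z.2 a with _ | ⟨x'', y''⟩ <;> simp [lcomb, mul_assoc]
  one_mul X := by
    refine Prod.ext (one_mul _) (funext fun a => ?_)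
    change lcomb 1 X.1 none (X.2 a) = X.2 a
    rcases X.2 a with _ | ⟨x, y⟩ <;> simp [lcomb]
  mul_one X := by
    refine Prod.ext (mul_one _) (funext fun a => ?_)
    change lcomb X.1 1 (X.2 a) none = X.2 a
    rcases X.2 a with _ | ⟨x, y⟩ <;> simp [lcomb]

theorem LExp.mul_fst {A Q : Type} [Monoid Q] (X Y : LExp A Q) : (X * Y).1 = X.1 * Y.1 := rfl

theorem LExp.mul_snd {A Q : Type} [Monoid Q] (X Y : LExp A Q) (a : A) :
    (X * Y).2 a = lcomb X.1 Y.1 (X.2 a) (Y.2 a) := rfl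

/-- Projection. -/
def LExp.pr (A Q : Type) [Monoid Q] : LExp A Q →* Q where
  toFun X := X.1
  map_one' := rfl
  map_mul' _ _ := rfl

theorem LExp.pow_fst {A Q : Type} [Monoid Q] (X : LExp A Q) (n : ℕ) : (X ^ n).1 = X.1 ^ n :=
  map_pow (LExp.pr A Q) X n

theorem LExp.pow_some {A Q : Type} [Monoid Q] (X : LExp A Q) (a : A) (x y : Q)
    (h : X.2 a = some (x, y)) (n : ℕ) : (X ^ (n + 1)).2 a = some (x, y * X.1 ^ n) := by
  rw [pow_succ', LExp.mul_snd, h, LExp.pow_fst, lcomb]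

theorem LExp.pow_none {A Q : Type} [Monoid Q] (X : LExp A Q) (a : A)
    (h : X.2 a = none) (n : ℕ) : (X ^ n).2 a = none := by
  induction n with
  | zero => rfl
  | succ n ih => rw [pow_succ, LExp.mul_snd, h, ih, lcomb]

theorem LExp.mul_none {A Q : Type} [Monoid Q] (X Y : LExp A Q) (a : A) :
    (X * Y).2 a = none ↔ X.2 a = none ∧ Y.2 a = none := by
  rw [LExp.mul_snd]
  rcases X.2 a with _ | ⟨x, y⟩ <;> rcases Y.2 a with _ | ⟨x', y'⟩ <;> simp [lcomb]

theorem DOm.lexp {A Q : Type} [Monoid Q] [Finite A] [Finite Q] (h : DOm Q) : DOm (LExp A Q) := by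
  obtain ⟨N, hN, hid, hdo⟩ := h
  obtain ⟨N1, hN1, hid1⟩ := exists_pow_idem (LExp A Q)
  have hK : 0 < 2 * N * N1 := by positivity
  have e1 : ∀ W : LExp A Q, W ^ (2 * N * N1) = W ^ N1 := by
    intro W
    rw [mul_comm]
    exact pow_idem_mul (hid1 W) _ (by positivity)
  have e2 : ∀ w : Q, w ^ (2 * N * N1) = w ^ N := by
    intro w
    have : 2 * N * N1 = N * (2 * N1) := by ring
    rw [this]
    exact pow_idem_mul (hid w) _ (by positivity)
  refine ⟨2 * N * N1, hK, fun W => by rw [e1, hid1], fun X Y => ?_⟩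
  refine Prod.ext ?_ (funext fun a => ?_)
  · simp only [LExp.mul_fst, LExp.pow_fst, e2, hdo]
  · rcases h : (X * Y).2 a with _ | ⟨x, y⟩
    · have h' := (LExp.mul_none X Y a).1 h
      have h2 : (Y * X).2 a = none := (LExp.mul_none Y X a).2 h'.symm
      rw [LExp.pow_none _ _ h, LExp.mul_none, LExp.mul_none]
      exact ⟨⟨LExp.pow_none _ _ h _, LExp.pow_none _ _ h2 _⟩, LExp.pow_none _ _ h _⟩
    · have h3 : (2 * N * N1 - 1) + 1 = 2 * N * N1 := by omega
      have h4 := LExp.pow_some (X * Y) a x y h (2 * N * N1 - 1)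
      rw [h3] at h4
      rw [mul_assoc, LExp.mul_snd, h4, lcomb]
      simp only [LExp.mul_fst, LExp.pow_fst, e2]
      congr 2
      set w := X.1 * Y.1
      set v := Y.1 * X.1
      have h5 : w ^ (2 * N * N1 - 1) * w ^ N = w ^ (2 * N * N1 - 1) := by
        have : 2 * N * N1 - 1 = (2 * N * N1 - 1 - N) + N := by
          have : 2 * N ≤ 2 * N * N1 := Nat.le_mul_of_pos_right _ hN1
          omega
        rw [this, pow_add, mul_assoc, hid]
      have h6 : w ^ N * v ^ N * w ^ N = w ^ N := hdo _ _
      calc y * w ^ (2 * N * N1 - 1) * (v ^ N * w ^ N)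
          = y * (w ^ (2 * N * N1 - 1) * w ^ N) * (v ^ N * w ^ N) := by rw [h5]
        _ = y * (w ^ (2 * N * N1 - 1) * (w ^ N * v ^ N * w ^ N)) := by simp only [mul_assoc]
        _ = _ := by rw [h6, h5]

/-- Left expansion property. -/
def LeftP {A Q Q' : Type} [Monoid Q] [Monoid Q'] (ψ : FreeMonoid A →* Q)
    (ψ' : FreeMonoid A →* Q') : Prop :=
  ∀ u v, ψ' u = ψ' v → ψ u = ψ v ∧ (∀ a, a ∈ u ↔ a ∈ v) ∧
    ∀ a u1 u2, u = u1 * FreeMonoid.of a * u2 → a ∉ u1 →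
      ∃ v1 v2, v = v1 * FreeMonoid.of a * v2 ∧ a ∉ v1 ∧ ψ u1 = ψ v1 ∧ ψ u2 = ψ v2

/-- Right expansion property. -/
def RightP {A Q Q' : Type} [Monoid Q] [Monoid Q'] (ψ : FreeMonoid A →* Q)
    (ψ' : FreeMonoid A →* Q') : Prop :=
  ∀ u v, ψ' u = ψ' v → ψ u = ψ v ∧ (∀ a, a ∈ u ↔ a ∈ v) ∧
    ∀ a u1 u2, u = u1 * FreeMonoid.of a * u2 → a ∉ u2 →
      ∃ v1 v2, v = v1 * FreeMonoid.of a * v2 ∧ a ∉ v2 ∧ ψ u1 = ψ v1 ∧ ψ u2 = ψ v2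

theorem exists_first_occ {A : Type} (a : A) (u : FreeMonoid A) (h : a ∈ u) :
    ∃ u1 u2, u = u1 * FreeMonoid.of a * u2 ∧ a ∉ u1 := by
  obtain ⟨l1, l2, h1, h2⟩ := List.eq_append_cons_of_mem (xs := FreeMonoid.toList u) h
  refine ⟨FreeMonoid.ofList l1, FreeMonoid.ofList l2, ?_, h2⟩
  apply FreeMonoid.toList.injective
  rw [h1]
  simp [FreeMonoid.toList_mul]

theorem mem_reverse {A : Type} (a : A) (u : FreeMonoid A) : a ∈ u.reverse ↔ a ∈ u :=
  List.mem_reverse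

theorem exists_last_occ {A : Type} (a : A) (u : FreeMonoid A) (h : a ∈ u) :
    ∃ u1 u2, u = u1 * FreeMonoid.of a * u2 ∧ a ∉ u2 := by
  obtain ⟨u1, u2, h1, h2⟩ := exists_first_occ a u.reverse ((mem_reverse a u).2 h)
  refine ⟨u2.reverse, u1.reverse, ?_, fun h => h2 ((mem_reverse _ _).1 h)⟩
  have := congrArg FreeMonoid.reverse h1
  rw [FreeMonoid.reverse_reverse] at this
  rw [this]
  simp only [FreeMonoid.reverse_mul, FreeMonoid.reverse_of, mul_assoc]

theorem exists_left {A Q : Type} [Monoid Q] [Finite A] [Finite Q] (hQ : DOm Q)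
    (ψ : FreeMonoid A →* Q) :
    ∃ (Q' : Type) (_ : Monoid Q') (_ : Finite Q') (ψ' : FreeMonoid A →* Q'),
      DOm Q' ∧ LeftP ψ ψ' := by
  classical
  let ψ' : FreeMonoid A →* LExp A Q :=
    FreeMonoid.lift fun b => (ψ (FreeMonoid.of b), fun a => if a = b then some (1, 1) else none)
  have h1 : ∀ u, (ψ' u).1 = ψ u := by
    intro u
    have : (LExp.pr A Q).comp ψ' = ψ := by
      apply FreeMonoid.hom_eq; intro b; rfl
    rw [← this]; rfl
  have h2 : ∀ u a, (ψ' u).2 a = none ↔ a ∉ u := by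
    intro u a
    induction u using FreeMonoid.inductionOn' with
    | one => rw [map_one]; exact ⟨fun _ => FreeMonoid.notMem_one, fun _ => rfl⟩
    | of_mul b u ih =>
      rw [map_mul, LExp.mul_none, ih, FreeMonoid.mem_mul, FreeMonoid.mem_of, not_or]
      refine and_congr ?_ Iff.rfl
      change (if a = b then some ((1 : Q), (1 : Q)) else none) = none ↔ _
      split <;> simp [*]
  have h3 : ∀ a u1 u2, a ∉ u1 → (ψ' (u1 * FreeMonoid.of a * u2)).2 a = some (ψ u1, ψ u2) := by
    intro a u1 u2 h
    rw [map_mul, map_mul, LExp.mul_snd, LExp.mul_snd, (h2 _ _).2 h]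
    have : (ψ' (FreeMonoid.of a)).2 a = some (1, 1) := by
      change (if a = a then some ((1 : Q), (1 : Q)) else none) = _
      simp
    rw [this]
    simp [lcomb, h1]
  refine ⟨LExp A Q, inferInstance, inferInstance, ψ', hQ.lexp, ?_⟩
  intro u v huv
  have hm : ∀ a, a ∈ u ↔ a ∈ v := by
    intro a
    rw [← not_iff_not, ← h2, ← h2, huv]
  refine ⟨by rw [← h1, ← h1, huv], hm, ?_⟩
  intro a u1 u2 hu ha
  have hau : a ∈ u := by
    rw [hu, FreeMonoid.mem_mul, FreeMonoid.mem_mul]; left; right; exact FreeMonoid.mem_of_self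
  obtain ⟨v1, v2, hv, hv1⟩ := exists_first_occ a v ((hm a).1 hau)
  have e1 := h3 a u1 u2 ha
  have e2 := h3 a v1 v2 hv1
  rw [← hu, huv, hv, e2] at e1
  simp only [Option.some.injEq, Prod.mk.injEq] at e1
  exact ⟨v1, v2, hv, hv1, e1.1.symm, e1.2.symm⟩

theorem DOm.op {Q : Type} [Monoid Q] (h : DOm Q) : DOm Qᵐᵒᵖ := by
  obtain ⟨N, hN, hid, hdo⟩ := h
  refine ⟨N, hN, fun x => ?_, fun x y => ?_⟩
  · apply MulOpposite.unop_injective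
    simpa using hid x.unop
  · apply MulOpposite.unop_injective
    simpa [mul_assoc] using hdo y.unop x.unop

/-- Reversal of a homomorphism. -/
def revHom {A Q : Type} [Monoid Q] (ψ : FreeMonoid A →* Q) : FreeMonoid A →* Qᵐᵒᵖ where
  toFun u := MulOpposite.op (ψ u.reverse)
  map_one' := by
    change MulOpposite.op (ψ 1) = 1
    rw [map_one]; rfl
  map_mul' u v := by
    rw [FreeMonoid.reverse_mul, map_mul, MulOpposite.op_mul]

theorem exists_right {A Q : Type} [Monoid Q] [Finite A] [Finite Q] (hQ : DOm Q)
    (ψ : FreeMonoid A →* Q) :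
    ∃ (Q' : Type) (_ : Monoid Q') (_ : Finite Q') (ψ' : FreeMonoid A →* Q'),
      DOm Q' ∧ RightP ψ ψ' := by
  have : Finite Qᵐᵒᵖ := Finite.of_equiv Q MulOpposite.opEquiv
  obtain ⟨Q', _, _, ψ', hQ', hL⟩ := exists_left hQ.op (revHom ψ)
  have : Finite Q'ᵐᵒᵖ := Finite.of_equiv Q' MulOpposite.opEquiv
  refine ⟨Q'ᵐᵒᵖ, inferInstance, inferInstance, revHom ψ', hQ'.op, ?_⟩
  intro u v huv
  obtain ⟨e1, e2, e3⟩ := hL u.reverse v.reverse (MulOpposite.op_injective huv)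
  refine ⟨?_, fun a => ?_, ?_⟩
  · have := MulOpposite.op_injective e1
    simpa [FreeMonoid.reverse_reverse] using this
  · have := e2 a
    rwa [mem_reverse, mem_reverse] at this
  · intro a u1 u2 hu ha
    obtain ⟨v1, v2, h1, h2, h3, h4⟩ := e3 a u2.reverse u1.reverse
      (by rw [hu]; simp only [FreeMonoid.reverse_mul, FreeMonoid.reverse_of, mul_assoc])
      (fun h => ha ((mem_reverse _ _).1 h))
    refine ⟨v2.reverse, v1.reverse, ?_, fun h => h2 ((mem_reverse _ _).1 h), ?_, ?_⟩
    · have := congrArg FreeMonoid.reverse h1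
      rw [FreeMonoid.reverse_reverse] at this
      rw [this]
      simp only [FreeMonoid.reverse_mul, FreeMonoid.reverse_of, mul_assoc]
    · have := MulOpposite.op_injective h4
      simpa [FreeMonoid.reverse_reverse] using this
    · have := MulOpposite.op_injective h3
      simpa [FreeMonoid.reverse_reverse] using this

theorem DOm.of_group (H : Type) [Group H] [Finite H] : DOm H := by
  refine ⟨Nat.card H, Nat.card_pos, fun x => ?_, fun x y => ?_⟩ <;> simp [pow_card_eq_one']


/-- A finite quotient of the free group. -/
structure FQ (A : Type) where
  G : Type
  [grp : Group G]
  [fin : Finite G]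
  hom : FreeGroup A →* G

attribute [instance] FQ.grp FQ.fin

/-- Refinement of finite quotients. -/
def FQ.Le {A : Type} (η' η : FQ A) : Prop :=
  ∀ x y, η'.hom x = η'.hom y → η.hom x = η.hom y

theorem FQ.Le.trans {A : Type} {η η' η'' : FQ A} (h1 : η''.Le η') (h2 : η'.Le η) : η''.Le η :=
  fun _ _ h => h2 _ _ (h1 _ _ h)

theorem FQ.Le.refl {A : Type} (η : FQ A) : η.Le η := fun _ _ h => h

/-- Connection of vertices of the Cayley graph of the free group through a set of edges. -/
def Conn {A : Type} (V : Set (FreeGroup A × A)) : FreeGroup A → FreeGroup A → Prop :=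
  Relation.EqvGen (fun u v => ∃ a, (u, a) ∈ V ∧ v = u * FreeGroup.of a)

theorem fg_const {A α : Type} (Δ : FreeGroup A → α) (h : ∀ y a, Δ (y * FreeGroup.of a) = Δ y) :
    ∀ y x, Δ (x * y) = Δ x := by
  intro y
  induction y using FreeGroup.induction_on with
  | C1 => intro x; rw [mul_one]
  | of a => intro x; exact h x a
  | inv_of a ih =>
    intro x
    have := h (x * (FreeGroup.of a)⁻¹) a
    rw [inv_mul_cancel_right] at this
    exact this.symm
  | mul y z hy hz => intro x; rw [← mul_assoc, hz, hy]

theorem fg_const' {A α : Type} (Δ : FreeGroup A → α)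
    (h : ∀ y a, Δ (y * FreeGroup.of a) = Δ y) (x y) : Δ x = Δ y := by
  have := fg_const Δ h (x⁻¹ * y) x
  rw [mul_inv_cancel_left] at this
  exact this.symm

section KL
variable {A : Type}

open Classical in
/-- The step permutation. -/
noncomputable def stepPerm (η : FQ A) (a : A) :
    Equiv.Perm (η.G × (η.G × A → ZMod 2)) where
  toFun p := (p.1 * η.hom (FreeGroup.of a), p.2 + Pi.single (p.1, a) 1)
  invFun p := (p.1 * (η.hom (FreeGroup.of a))⁻¹,
    p.2 - Pi.single (p.1 * (η.hom (FreeGroup.of a))⁻¹, a) 1)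
  left_inv p := by simp
  right_inv p := by simp

/-- The expansion of a finite quotient counting edges modulo two. -/
noncomputable def FQ.exp [Finite A] (η : FQ A) : FQ A :=
  letI : Finite (Equiv.Perm (η.G × (η.G × A → ZMod 2)))ᵐᵒᵖ :=
    Finite.of_equiv _ MulOpposite.opEquiv
  { G := (Equiv.Perm (η.G × (η.G × A → ZMod 2)))ᵐᵒᵖ
    hom := FreeGroup.lift fun a => MulOpposite.op (stepPerm η a) }

noncomputable def FQ.act [Finite A] (η : FQ A) (y : FreeGroup A) :
    η.G × (η.G × A → ZMod 2) :=
  (MulOpposite.unop (show (Equiv.Perm (η.G × (η.G × A → ZMod 2)))ᵐᵒᵖ from η.exp.hom y)) (1, 0)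

theorem FQ.act_mul [Finite A] (η : FQ A) (y : FreeGroup A) (a : A) :
    η.act (y * FreeGroup.of a) = stepPerm η a (η.act y) := by
  unfold FQ.act FQ.exp
  dsimp only
  rw [map_mul, FreeGroup.lift_apply_of, MulOpposite.unop_mul, MulOpposite.unop_op]
  rfl

theorem FQ.act_one [Finite A] (η : FQ A) : η.act 1 = (1, 0) := by
  unfold FQ.act FQ.exp
  dsimp only
  rw [map_one]
  rfl

theorem FQ.act_fst [Finite A] (η : FQ A) (y : FreeGroup A) : (η.act y).1 = η.hom y := by
  have h := fg_const' (fun y => (η.act y).1 * (η.hom y)⁻¹) (by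
    intro y a
    rw [FQ.act_mul]
    simp [stepPerm, mul_assoc]) y 1
  simp only [FQ.act_one, map_one, inv_one, mul_one] at h
  exact mul_inv_eq_one.1 h

theorem FQ.act_eq [Finite A] (η : FQ A) {y y' : FreeGroup A} (h : η.exp.hom y = η.exp.hom y') :
    η.act y = η.act y' := by
  unfold FQ.act; rw [h]

open Classical in
theorem FQ.act_snd [Finite A] (η : FQ A) (y : FreeGroup A) (a : A) :
    (η.act (y * FreeGroup.of a)).2 = (η.act y).2 + Pi.single (η.hom y, a) 1 := by
  rw [FQ.act_mul, ← FQ.act_fst]; rfl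

theorem FQ.exp_le [Finite A] (η : FQ A) : η.exp.Le η := by
  intro x y h
  rw [← FQ.act_fst, ← FQ.act_fst, η.act_eq h]

theorem conn_act [Finite A] (η : FQ A) (V : Set (FreeGroup A × A)) {x y : FreeGroup A}
    (h : Conn V x y) (e : η.G × A) (he : ¬ ∃ z', η.hom z' = e.1 ∧ (z', e.2) ∈ V) :
    (η.act y).2 e = (η.act x).2 e := by
  classical
  induction h with
  | rel u v h =>
    obtain ⟨a, ha, rfl⟩ := h
    rw [FQ.act_snd, Pi.add_apply, Pi.single_eq_of_ne, add_zero]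
    rintro rfl
    exact he ⟨u, rfl, ha⟩
  | refl x => rfl
  | symm x y _ ih => exact ih.symm
  | trans x y z _ _ ih1 ih2 => rw [ih2, ih1]

theorem exp_KL [Finite A] (η : FQ A) {I : Type} (V : I → Set (FreeGroup A × A))
    (x y : FreeGroup A) (yi : I → FreeGroup A) (hI : Nonempty I) (hc : ∀ i, Conn (V i) x (yi i))
    (hy : ∀ i, η.exp.hom (yi i) = η.exp.hom y) :
    ∃ y', η.hom y' = η.hom y ∧
      Conn {z | ∀ i, ∃ z', η.hom z' = η.hom z.1 ∧ (z', z.2) ∈ V i} x y' := by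
  classical
  have := Fintype.ofFinite η.G
  have := Fintype.ofFinite A
  set E : Set (FreeGroup A × A) := {z | ∀ i, ∃ z', η.hom z' = η.hom z.1 ∧ (z', z.2) ∈ V i} with hE
  let Z : Set η.G := {g | ∃ y', η.hom y' = g ∧ Conn E x y'}
  let χ : η.G → ZMod 2 := fun g => if g ∈ Z then 1 else 0
  let δ : η.G × A → ZMod 2 := fun e => χ e.1 + χ (e.1 * η.hom (FreeGroup.of e.2))
  have two : ∀ t : ZMod 2, t + t = 0 := fun t => CharTwo.add_self_eq_zero t
  have hδ : ∀ e : η.G × A, (∀ i, ∃ z', η.hom z' = e.1 ∧ (z', e.2) ∈ V i) → δ e = 0 := by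
    rintro ⟨g, a⟩ he
    have : g ∈ Z ↔ g * η.hom (FreeGroup.of a) ∈ Z := by
      constructor
      · rintro ⟨y', rfl, h2⟩
        refine ⟨y' * FreeGroup.of a, by simp, ?_⟩
        exact h2.trans _ _ _ (.rel _ _ ⟨a, he, rfl⟩)
      · rintro ⟨y', h1, h2⟩
        have h3 : η.hom (y' * (FreeGroup.of a)⁻¹) = g := by simp [h1]
        refine ⟨y' * (FreeGroup.of a)⁻¹, h3, ?_⟩
        refine h2.trans _ _ _ (.symm _ _ (.rel _ _ ⟨a, ?_, by simp⟩))
        intro i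
        change ∃ z', η.hom z' = η.hom (y' * (FreeGroup.of a)⁻¹) ∧ _
        rw [h3]
        exact he i
    simp only [δ, χ, this, two]
  let ℓ : (η.G × A → ZMod 2) → ZMod 2 := fun f => ∑ e, f e * δ e
  have hconst := fg_const' (fun y => χ (η.hom y) + ℓ (η.act y).2) (by
    intro y a
    simp only [ℓ, FQ.act_snd, Pi.add_apply, add_mul, Finset.sum_add_distrib]
    have : ∑ e, (Pi.single (η.hom y, a) 1 : η.G × A → ZMod 2) e * δ e = δ (η.hom y, a) := by
      simp [Pi.single_apply]
    rw [this]
    simp only [δ, map_mul]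
    have := two (χ (η.hom y * η.hom (FreeGroup.of a)))
    linear_combination this) y x
  have hℓ : ℓ (η.act y).2 = ℓ (η.act x).2 := by
    refine Finset.sum_congr rfl fun e _ => ?_
    by_cases he : ∀ i, ∃ z', η.hom z' = e.1 ∧ (z', e.2) ∈ V i
    · rw [hδ e he, mul_zero, mul_zero]
    · push Not at he
      obtain ⟨i, hi⟩ := he
      rw [← η.act_eq (hy i), conn_act η (V i) (hc i) e (by push Not; exact hi)]
  rw [hℓ, add_left_inj] at hconst
  have hx : η.hom x ∈ Z := ⟨x, rfl, .refl _⟩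
  have : η.hom y ∈ Z := by
    by_contra hn
    simp [χ, hx, hn] at hconst
  exact this

end KL


section Chains
variable {A : Type} (η0 : FQ A)

theorem Conn.mono {V W : Set (FreeGroup A × A)} (h : V ⊆ W) {x y : FreeGroup A}
    (hc : Conn V x y) : Conn W x y := by
  refine Relation.EqvGen.mono ?_ _ _ hc
  rintro u v ⟨a, ha, hv⟩
  exact ⟨a, h ha, hv⟩

/-- Connection through edges described by their image in the base quotient. -/
def ConnU (U : Set (η0.G × A)) (x y : FreeGroup A) : Prop :=
  Conn {z | (η0.hom z.1, z.2) ∈ U} x y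

variable {η0}

theorem ConnU.refl (U : Set (η0.G × A)) (x : FreeGroup A) : ConnU η0 U x x := Relation.EqvGen.refl _
theorem ConnU.symm {U : Set (η0.G × A)} {x y : FreeGroup A} (h : ConnU η0 U x y) :
    ConnU η0 U y x := Relation.EqvGen.symm _ _ h
theorem ConnU.trans {U : Set (η0.G × A)} {x y z : FreeGroup A} (h : ConnU η0 U x y)
    (h' : ConnU η0 U y z) : ConnU η0 U x z := Relation.EqvGen.trans _ _ _ h h'

theorem ConnU.translate {U : Set (η0.G × A)} {x y : FreeGroup A} (h : ConnU η0 U x y)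
    {t : FreeGroup A} (ht : η0.hom t = 1) : ConnU η0 U (t * x) (t * y) := by
  unfold ConnU Conn at *
  induction h with
  | rel u v h =>
    obtain ⟨a, ha, rfl⟩ := h
    refine .rel _ _ ⟨a, ?_, by rw [mul_assoc]⟩
    change (η0.hom (t * u), a) ∈ U
    rw [map_mul, ht, one_mul]; exact ha
  | refl x => exact .refl _
  | symm x y _ ih => exact ih.symm
  | trans x y z _ _ ih1 ih2 => exact ih1.trans _ _ _ ih2

theorem conn_trace {U : Set (η0.G × A)} {u v : FreeGroup A} (h : ConnU η0 U u v) :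
    ∀ w, ConnU η0 U w u →
      Conn {z | ConnU η0 U w z.1 ∧ ConnU η0 U w (z.1 * FreeGroup.of z.2)} u v := by
  unfold ConnU at h
  induction h with
  | rel u v h =>
    intro w hw
    obtain ⟨a, ha, rfl⟩ := h
    exact .rel _ _ ⟨a, ⟨hw, hw.trans (.rel _ _ ⟨a, ha, rfl⟩)⟩, rfl⟩
  | refl x => intro w _; exact .refl _
  | symm x y h ih =>
    intro w hw
    exact (ih w (hw.trans (ConnU.symm h))).symm
  | trans x y z h1 h2 ih1 ih2 =>
    intro w hw
    exact (ih1 w hw).trans _ _ _ (ih2 w (hw.trans h1))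

variable (η0) in
/-- Chains of connections with pinned intermediate points. -/
def Chain : Set (η0.G × A) → List (η0.G × Set (η0.G × A)) → FreeGroup A → FreeGroup A → Prop
  | U, [], x, y => ConnU η0 U x y
  | U, (p, U1) :: L, x, y => ∃ z, ConnU η0 U x z ∧ η0.hom z = p ∧ Chain U1 L z y

/-- Last set of a chain. -/
def lastU {X : Type} {Y : Type} : Y → List (X × Y) → Y
  | U, [] => U
  | _, (_, U1) :: L => lastU U1 L

theorem lastU_append {X Y : Type} (U : Y) (L1 L2 : List (X × Y)) :
    lastU U (L1 ++ L2) = lastU (lastU U L1) L2 := by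
  induction L1 generalizing U with
  | nil => rfl
  | cons c L1 ih => exact ih c.2

theorem Chain.translate {L : List (η0.G × Set (η0.G × A))} {U : Set (η0.G × A)}
    {x y : FreeGroup A} (h : Chain η0 U L x y) {t : FreeGroup A} (ht : η0.hom t = 1) :
    Chain η0 U L (t * x) (t * y) := by
  induction L generalizing U x with
  | nil => exact ConnU.translate h ht
  | cons c L ih =>
    obtain ⟨z, h1, h2, h3⟩ := h
    exact ⟨t * z, h1.translate ht, by rw [map_mul, ht, one_mul, h2], ih h3⟩

theorem Chain.left {L : List (η0.G × Set (η0.G × A))} {U : Set (η0.G × A)}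
    {x x' y : FreeGroup A} (h : Chain η0 U L x y) (hx : ConnU η0 U x' x) : Chain η0 U L x' y := by
  cases L with
  | nil => exact hx.trans h
  | cons c L =>
    obtain ⟨z, h1, h2, h3⟩ := h
    exact ⟨z, hx.trans h1, h2, h3⟩

theorem Chain.append {L1 L2 : List (η0.G × Set (η0.G × A))} {U : Set (η0.G × A)}
    {x y z : FreeGroup A} (h1 : Chain η0 U L1 x z) (h2 : Chain η0 (lastU U L1) L2 z y) :
    Chain η0 U (L1 ++ L2) x y := by
  induction L1 generalizing U x with
  | nil => exact h2.left h1
  | cons c L1 ih =>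
    obtain ⟨w, a1, a2, a3⟩ := h1
    exact ⟨w, a1, a2, ih a3 h2⟩

theorem Chain.right {L : List (η0.G × Set (η0.G × A))} {U : Set (η0.G × A)}
    {x y y' : FreeGroup A} (h : Chain η0 U L x y) (hy : ConnU η0 (lastU U L) y y') :
    Chain η0 U L x y' := by
  have := h.append (L2 := []) hy
  rwa [List.append_nil] at this

theorem Chain.split {L1 L2 : List (η0.G × Set (η0.G × A))} {U : Set (η0.G × A)}
    {x y : FreeGroup A} (h : Chain η0 U (L1 ++ L2) x y) :
    ∃ z, Chain η0 U L1 x z ∧ Chain η0 (lastU U L1) L2 z y := by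
  induction L1 generalizing U x with
  | nil => exact ⟨x, ConnU.refl _ _, h⟩
  | cons c L1 ih =>
    obtain ⟨w, a1, a2, a3⟩ := h
    obtain ⟨z, b1, b2⟩ := ih a3
    exact ⟨z, ⟨w, a1, a2, b1⟩, b2⟩

variable (η0) in
/-- Edges traversed by a chain. -/
def chainEdges (U : Set (η0.G × A)) (L : List (η0.G × Set (η0.G × A))) (x y : FreeGroup A) :
    Set (FreeGroup A × A) :=
  {z | ∃ L1 L2, L = L1 ++ L2 ∧
    (Chain η0 U L1 x z.1 ∧ Chain η0 (lastU U L1) L2 z.1 y) ∧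
    (Chain η0 U L1 x (z.1 * FreeGroup.of z.2) ∧
      Chain η0 (lastU U L1) L2 (z.1 * FreeGroup.of z.2) y)}

theorem chain_trace {U : Set (η0.G × A)} {L : List (η0.G × Set (η0.G × A))} {x y : FreeGroup A}
    (L2 : List (η0.G × Set (η0.G × A))) :
    ∀ L1 z, L = L1 ++ L2 → Chain η0 U L1 x z → Chain η0 (lastU U L1) L2 z y →
      Conn (chainEdges η0 U L x y) z y := by
  have gen : ∀ L1 L2 z w, L = L1 ++ L2 → Chain η0 U L1 x z → Chain η0 (lastU U L1) L2 z y →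
      ConnU η0 (lastU U L1) z w → Conn (chainEdges η0 U L x y) z w := by
    intro L1 L2 z w hL h1 h2 hc
    refine (conn_trace hc z (.refl _ _)).mono ?_
    rintro v ⟨hv1, hv2⟩
    exact ⟨L1, L2, hL, ⟨h1.right hv1, h2.left hv1.symm⟩, ⟨h1.right hv2, h2.left hv2.symm⟩⟩
  induction L2 with
  | nil =>
    intro L1 z hL h1 h2
    exact gen L1 [] z y hL h1 h2 h2
  | cons c L2 ih =>
    intro L1 z hL h1 h2
    obtain ⟨w, a1, a2, a3⟩ := id h2
    refine (gen L1 _ z w hL h1 h2 a1).trans _ _ _ ?_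
    refine ih (L1 ++ [c]) w (by simp [hL]) ?_ ?_
    · exact h1.append (L2 := [c]) ⟨w, a1, a2, .refl _ _⟩
    · rw [lastU_append]; exact a3

variable (η0) in
/-- The lifting property. -/
def LiftP (M : ℕ) (η' η : FQ A) : Prop :=
  ∀ (I : Type) [Fintype I] (U : I → Set (η0.G × A)) (L : I → List (η0.G × Set (η0.G × A)))
    (x y : FreeGroup A) (yi : I → FreeGroup A), ∑ i, (L i).length ≤ M →
    (∀ i, Chain η0 (U i) (L i) x (yi i)) → (∀ i, η'.hom (yi i) = η'.hom y) →
    ∃ y', η.hom y' = η.hom y ∧ ∀ i, Chain η0 (U i) (L i) x y'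

theorem lift_zero [Finite A] (η : FQ A) (hη : η.Le η0) : LiftP η0 0 η.exp η := by
  intro I _ U L x y yi hs hc hy
  have hL : ∀ i, L i = [] := by
    intro i
    have := Finset.single_le_sum (f := fun i => (L i).length) (fun i _ => Nat.zero_le _)
      (Finset.mem_univ i)
    exact List.length_eq_zero_iff.1 (by omega)
  by_cases hI : Nonempty I
  · obtain ⟨y', h1, h2⟩ := exp_KL η (fun i => {z | (η0.hom z.1, z.2) ∈ U i}) x y yi hI
      (fun i => by have := hc i; rw [hL i] at this; exact this) hy
    refine ⟨y', h1, fun i => ?_⟩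
    rw [hL i]
    refine h2.mono ?_
    intro z hz
    obtain ⟨z', a1, a2⟩ := hz i
    change (η0.hom z.1, z.2) ∈ U i
    rw [← hη _ _ a1]
    exact a2
  · exact ⟨y, rfl, fun i => (hI ⟨i⟩).elim⟩

theorem LiftP.two {M : ℕ} {η' η : FQ A} (h : LiftP η0 M η' η) {U U' : Set (η0.G × A)}
    {L L' : List (η0.G × Set (η0.G × A))} {x y y' : FreeGroup A}
    (hl : L.length + L'.length ≤ M) (h1 : Chain η0 U L x y) (h2 : Chain η0 U' L' x y')
    (hy : η'.hom y' = η'.hom y) :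
    ∃ z, η.hom z = η.hom y ∧ Chain η0 U L x z ∧ Chain η0 U' L' x z := by
  obtain ⟨z, hz, hc⟩ := h Bool (fun b => bif b then U else U') (fun b => bif b then L else L') x y
    (fun b => bif b then y else y') (by simpa using hl)
    (by rintro (_ | _) <;> simpa) (by rintro (_ | _) <;> simp [hy])
  exact ⟨z, hz, by simpa using hc true, by simpa using hc false⟩

theorem loop_exact {M : ℕ} {ηb ηc η : FQ A} (hbc : ηb.Le ηc) (hcη : ηc.Le η) (hη : η.Le η0)
    (hM : LiftP η0 M ηb ηc) (h0 : LiftP η0 0 ηc η)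
    {U0 : Set (η0.G × A)} {L : List (η0.G × Set (η0.G × A))} {z z' : FreeGroup A}
    (hL : L ≠ []) (hlen : L.length ≤ M + 1) (hc : Chain η0 U0 L z z')
    (hz : ηb.hom z' = ηb.hom z) : Chain η0 U0 L z z := by
  -- it suffices to find a loop at some congruent point
  have suff : ∀ w, η.hom w = η.hom z → Chain η0 U0 L w w → Chain η0 U0 L z z := by
    intro w hw h
    have h1 := h.translate (t := z * w⁻¹) (by rw [map_mul, map_inv, hη _ _ hw, mul_inv_cancel])
    simpa using h1
  rcases L with _ | ⟨⟨p, U1⟩, L⟩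
  · exact absurd rfl hL
  obtain ⟨a, a1, a2, a3⟩ := hc
  rcases List.eq_nil_or_concat L with rfl | ⟨L', ⟨p', Uj⟩, rfl⟩
  · obtain ⟨w, hw, w1, w2⟩ := h0.two (L := []) (L' := []) (U := U0) (U' := U1) (x := a) (y := z)
      (y' := z') (by simp) a1.symm a3 (hbc _ _ hz)
    exact suff w hw ⟨a, ConnU.symm w1, a2, w2⟩
  · rw [List.concat_eq_append] at *
    obtain ⟨b, b1, b2⟩ := a3.split
    obtain ⟨b', b3, b4, b5⟩ := b2
    have b1 := b1.right b3
    have b5 : ConnU η0 Uj b' z' := b5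
    have tz : η0.hom (z * z'⁻¹) = 1 := by
      rw [map_mul, map_inv, hη _ _ (hcη _ _ (hbc _ _ hz)), mul_inv_cancel]
    have c1 : Chain η0 U0 [(η0.hom z, Uj)] a (z * z'⁻¹ * b') := by
      refine ⟨z, a1.symm, rfl, ?_⟩
      change ConnU η0 Uj z (z * z'⁻¹ * b')
      have := b5.symm.translate tz
      simpa using this
    obtain ⟨b'', d1, d2, d3⟩ := hM.two (by simp at hlen ⊢; omega) b1 c1 (by simp [hz])
    obtain ⟨z0, e1, e2, e3⟩ := d3
    have e3 : ConnU η0 Uj z0 b'' := e3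
    have tb : η0.hom (b'' * b'⁻¹) = 1 := by
      rw [map_mul, map_inv, hη _ _ (hcη _ _ d1), mul_inv_cancel]
    have f1 : ConnU η0 Uj z0 (b'' * b'⁻¹ * z') := by
      refine e3.trans ?_
      have := b5.translate tb
      simpa using this
    obtain ⟨w, hw, w1, w2⟩ := h0.two (L := []) (L' := []) (x := z0) (y := z) (U := U0) (U' := Uj)
      (by simp) (e1.symm.trans a1.symm) f1 (by
        rw [map_mul, map_mul, map_inv, d1, mul_inv_cancel, one_mul]; exact hbc _ _ hz)
    have w1 : ConnU η0 U0 z0 w := w1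
    have w2 : ConnU η0 Uj z0 w := w2
    refine suff w hw ⟨a, w1.symm.trans e1.symm, a2, ?_⟩
    refine d2.append (L2 := [(p', Uj)]) ⟨b'', .refl _ _, ?_, e3.symm.trans w2⟩
    rw [← b4]; exact hη _ _ (hcη _ _ d1)

end Chains


section LiftStep
variable {A : Type} {η0 : FQ A}

theorem lift_step [Finite A] {M : ℕ} {ηa ηb ηc η : FQ A} (hab : ηa.Le ηb) (hbc : ηb.Le ηc)
    (hcη : ηc.Le η) (hη : η.Le η0) (h1 : LiftP η0 M ηa ηb) (hM : LiftP η0 M ηb ηc)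
    (h0 : LiftP η0 0 ηc η) : LiftP η0 (M + 1) ηa.exp η := by
  classical
  intro I _ U L x y yi hs hc hy
  by_cases hall : ∀ i, L i = []
  · refine h0 I U L x y yi (by simp [hall]) hc (fun i => ?_)
    exact hbc _ _ (hab _ _ (ηa.exp_le _ _ (hy i)))
  push Not at hall
  obtain ⟨i0, hi0⟩ := hall
  have ha0 : ηa.Le η0 := hab.trans (hbc.trans (hcη.trans hη))
  have hb0 : ηb.Le η0 := hbc.trans (hcη.trans hη)
  have hya : ∀ i, ηa.hom (yi i) = ηa.hom y := fun i => ηa.exp_le _ _ (hy i)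
  obtain ⟨y0, hy0, hE⟩ := exp_KL ηa (fun i => chainEdges η0 (U i) (L i) x (yi i)) x y yi ⟨i0⟩
    (fun i => chain_trace (L i) [] x rfl (ConnU.refl _ _) (hc i)) hy
  -- the relevant predicates
  let On : I → FreeGroup A → Prop := fun i z => ∃ z', ηa.hom z' = ηa.hom z ∧
    ∃ L1 L2, L i = L1 ++ L2 ∧ Chain η0 (U i) L1 x z' ∧ Chain η0 (lastU (U i) L1) L2 z' (yi i)
  let A0 : FreeGroup A → Prop := fun z => ∃ z', ηa.hom z' = ηa.hom z ∧ ConnU η0 (U i0) x z'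
  let B : FreeGroup A → Prop := fun z => ∃ z', ηa.hom z' = ηa.hom z ∧
    ∃ L1 L2, L i0 = L1 ++ L2 ∧ L1 ≠ [] ∧ Chain η0 (U i0) L1 x z' ∧
      Chain η0 (lastU (U i0) L1) L2 z' (yi i0)
  obtain ⟨z, hzA, hzB, hzO⟩ : ∃ z, A0 z ∧ B z ∧ ∀ i, On i z := by
    by_contra hno
    push Not at hno
    have hxA : A0 x := ⟨x, rfl, ConnU.refl _ _⟩
    have hxO : ∀ i, On i x := fun i => ⟨x, rfl, [], L i, rfl, ConnU.refl _ _, hc i⟩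
    have inv : ∀ u v, Conn {z | ∀ i, ∃ z', ηa.hom z' = ηa.hom z.1 ∧
        (z', z.2) ∈ chainEdges η0 (U i) (L i) x (yi i)} u v →
        ((A0 u ∧ ¬ B u) ↔ (A0 v ∧ ¬ B v)) := by
      intro u v h
      induction h with
      | rel u v h =>
        obtain ⟨a, ha, rfl⟩ := h
        have hu : ∀ i, On i u := by
          intro i
          obtain ⟨z', e1, L1, L2, e2, e3, e4⟩ := ha i
          exact ⟨z', e1, L1, L2, e2, e3⟩
        have hv : ∀ i, On i (u * FreeGroup.of a) := by
          intro i
          obtain ⟨z', e1, L1, L2, e2, e3, e4⟩ := ha i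
          exact ⟨z' * FreeGroup.of a, by simp only [map_mul, e1], L1, L2, e2, e4⟩
        have hnu : A0 u → ¬ B u := fun h h' => by
          obtain ⟨i, hi⟩ := hno u h h'; exact hi (hu i)
        have hnv : A0 (u * FreeGroup.of a) → ¬ B (u * FreeGroup.of a) := fun h h' => by
          obtain ⟨i, hi⟩ := hno _ h h'; exact hi (hv i)
        obtain ⟨z', e1, L1, L2, e2, e3, e4⟩ := ha i0
        dsimp only at e1 e2 e3 e4
        by_cases hL1 : L1 = []
        · subst hL1
          have k1 : A0 u := ⟨z', e1, e3.1⟩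
          have k2 : A0 (u * FreeGroup.of a) :=
            ⟨z' * FreeGroup.of a, by simp only [map_mul, e1], e4.1⟩
          exact ⟨fun _ => ⟨k2, hnv k2⟩, fun _ => ⟨k1, hnu k1⟩⟩
        · have k1 : B u := ⟨z', e1, L1, L2, e2, hL1, e3⟩
          have k2 : B (u * FreeGroup.of a) :=
            ⟨z' * FreeGroup.of a, by simp only [map_mul, e1], L1, L2, e2, hL1, e4⟩
          exact ⟨fun h => absurd k1 h.2, fun h => absurd k2 h.2⟩
      | refl x => rfl
      | symm x y _ ih => exact ih.symm
      | trans x y z _ _ ih1 ih2 => exact ih1.trans ih2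
    have hxB : ¬ B x := fun h => by
      obtain ⟨i, hi⟩ := hno _ hxA h; exact hi (hxO i)
    refine ((inv x y0 hE).1 ⟨hxA, hxB⟩).2 ⟨yi i0, (hya i0).trans hy0.symm, L i0, [], by simp, hi0,
      hc i0, ConnU.refl _ _⟩
  obtain ⟨z1, hz1, hz1c⟩ := hzA
  obtain ⟨z2, hz2, K1, K2, hK, hK1, hz2c, hz2d⟩ := hzB
  choose z' hz' L1 L2 hL hz'c hz'd using hzO
  -- first part
  have len1 : ∀ i, i ≠ i0 → (L1 i).length + (L2 i).length = (L i).length := by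
    intro i _; rw [hL i, List.length_append]
  have lenK : K1.length + K2.length = (L i0).length := by rw [hK, List.length_append]
  have hK1pos : 1 ≤ K1.length := by
    rcases K1 with _ | ⟨c, K1⟩
    · exact absurd rfl hK1
    · simp
  have hsum : ∀ f : I → ℕ, ∑ i, f i = f i0 + ∑ i ∈ Finset.univ.erase i0, f i := fun f =>
    (Finset.add_sum_erase _ _ (Finset.mem_univ i0)).symm
  rw [hsum] at hs
  obtain ⟨zs, hzs, hzsc⟩ := h1 I U (fun i => if i = i0 then [] else L1 i) x z
    (fun i => if i = i0 then z1 else z' i) (by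
      rw [hsum]
      have : ∑ i ∈ Finset.univ.erase i0, (if i = i0 then [] else L1 i).length ≤
          ∑ i ∈ Finset.univ.erase i0, (L i).length := by
        refine Finset.sum_le_sum fun i hi => ?_
        have hne := Finset.ne_of_mem_erase hi
        rw [if_neg hne, ← len1 i hne]; omega
      simp only [if_true, List.length_nil, zero_add]
      omega) (by
      intro i
      by_cases h : i = i0
      · subst h; simpa [Chain] using hz1c
      · simpa [h] using hz'c i) (by
      intro i
      by_cases h : i = i0
      · simp [h, hz1]
      · simp [h, hz' i])
  have hzs0 : ConnU η0 (U i0) x zs := by simpa [Chain] using hzsc i0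
  have hzsi : ∀ i, i ≠ i0 → Chain η0 (U i) (L1 i) x zs := fun i h => by simpa [h] using hzsc i
  -- second part
  have tr : ∀ w, ηa.hom w = ηa.hom z → ηb.hom (zs * w⁻¹) = 1 ∧ η0.hom (zs * w⁻¹) = 1 := by
    intro w hw
    have : ηb.hom zs = ηb.hom w := hzs.trans (hab _ _ hw).symm
    exact ⟨by rw [map_mul, map_inv, this, mul_inv_cancel],
      by rw [map_mul, map_inv, hb0 _ _ this, mul_inv_cancel]⟩
  obtain ⟨y', hy', hy'c⟩ := hM I (fun i => if i = i0 then lastU (U i) K1 else lastU (U i) (L1 i))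
    (fun i => if i = i0 then K2 else L2 i) zs y
    (fun i => if i = i0 then zs * z2⁻¹ * yi i else zs * (z' i)⁻¹ * yi i) (by
      rw [hsum]
      have : ∑ i ∈ Finset.univ.erase i0, (if i = i0 then K2 else L2 i).length ≤
          ∑ i ∈ Finset.univ.erase i0, (L i).length := by
        refine Finset.sum_le_sum fun i hi => ?_
        have hne := Finset.ne_of_mem_erase hi
        rw [if_neg hne, ← len1 i hne]; omega
      simp only [if_true]
      omega) (by
      intro i
      by_cases h : i = i0
      · subst h
        have := hz2d.translate (tr z2 hz2).2
        simpa using this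
      · have := (hz'd i).translate (tr (z' i) (hz' i)).2
        simpa [h] using this) (by
      intro i
      by_cases h : i = i0
      · simp only [h, if_true]
        rw [map_mul, (tr z2 hz2).1, one_mul]
        exact hab _ _ (hya _)
      · simp only [h, if_false]
        rw [map_mul, (tr (z' i) (hz' i)).1, one_mul]
        exact hab _ _ (hya _))
  refine ⟨y', hcη _ _ hy', fun i => ?_⟩
  by_cases h : i = i0
  · subst h
    have k1 : Chain η0 (lastU (U i) K1) K2 zs y' := by simpa using hy'c i
    rw [hK]
    refine Chain.append ?_ k1
    refine Chain.left ?_ hzs0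
    have k2 : Chain η0 (U i) K1 z1 z2 := hz2c.left hz1c.symm
    have k3 := k2.translate (tr z1 hz1).2
    rw [inv_mul_cancel_right] at k3
    refine loop_exact hbc hcη hη hM h0 hK1 (by omega) k3 ?_
    rw [map_mul, map_mul, map_inv, hab _ _ (hz2.trans hz1.symm), inv_mul_cancel_right]
  · have k1 : Chain η0 (lastU (U i) (L1 i)) (L2 i) zs y' := by simpa [h] using hy'c i
    rw [hL i]
    exact (hzsi i h).append k1

theorem exists_lift [Finite A] (M : ℕ) : ∀ η : FQ A, η.Le η0 →
    ∃ η' : FQ A, η'.Le η ∧ LiftP η0 M η' η := by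
  induction M with
  | zero => intro η hη; exact ⟨η.exp, η.exp_le, lift_zero η hη⟩
  | succ M ih =>
    intro η hη
    have hc := η.exp_le
    obtain ⟨ηb, hb, hbl⟩ := ih η.exp (hc.trans hη)
    obtain ⟨ηa, ha, hal⟩ := ih ηb (hb.trans (hc.trans hη))
    exact ⟨ηa.exp, ηa.exp_le.trans (ha.trans (hb.trans hc)),
      lift_step ha hb hc hη hal hbl (lift_zero η hη)⟩

end LiftStep


/-- Words as elements of the free group. -/
def toFG {A : Type} : FreeMonoid A →* FreeGroup A := FreeMonoid.lift FreeGroup.of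

/-- Evaluation of words. -/
def wev {A S : Type} [Semigroup S] (f : A → S) : FreeMonoid A →* WithOne S :=
  FreeMonoid.lift fun a => ((f a : S) : WithOne S)

/-- Realizability by a term. -/
def Kr {A S : Type} [Semigroup S] (n : ℕ) (f : A → S) (c : WithOne S) (γ : FreeGroup A) : Prop :=
  ∃ o : Option (KTerm A), osv n f o = c ∧ ofg o = γ

section Kr
variable {A S : Type} [Semigroup S] {n : ℕ} {f : A → S}

theorem Kr.one : Kr n f 1 1 := ⟨none, rfl, rfl⟩
theorem Kr.letter (a : A) : Kr n f (f a : S) (FreeGroup.of a) := ⟨some (.letter a), rfl, rfl⟩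
theorem Kr.mul {c d : WithOne S} {γ δ : FreeGroup A} (h : Kr n f c γ) (h' : Kr n f d δ) :
    Kr n f (c * d) (γ * δ) := by
  obtain ⟨o, rfl, rfl⟩ := h
  obtain ⟨o', rfl, rfl⟩ := h'
  exact ⟨omul o o', osv_omul _ _ _ _, ofg_omul _ _⟩
theorem Kr.omm {c : WithOne S} {γ : FreeGroup A} (h : Kr n f c γ) :
    Kr n f (c ^ (2 * n + 1)) γ⁻¹ := by
  obtain ⟨o, rfl, rfl⟩ := h
  exact ⟨oomm o, osv_oomm _ _ _, ofg_oomm _⟩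

variable (n f) in
/-- Related elements of the same `R`-class. -/
def DD (s s' : WithOne S) (γ : FreeGroup A) : Prop :=
  (∃ c, Kr n f c γ ∧ s * c = s') ∧ ∃ c γ', Kr n f c γ' ∧ s' * c = s

theorem DD.refl (s : WithOne S) : DD n f s s 1 :=
  ⟨⟨1, Kr.one, mul_one s⟩, ⟨1, 1, Kr.one, mul_one s⟩⟩

theorem DD.trans {s t u : WithOne S} {γ δ : FreeGroup A} (h : DD n f s t γ) (h' : DD n f t u δ) :
    DD n f s u (γ * δ) := by
  obtain ⟨⟨c, h1, h2⟩, ⟨c', γ', h3, h4⟩⟩ := h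
  obtain ⟨⟨d, k1, k2⟩, ⟨d', δ', k3, k4⟩⟩ := h'
  exact ⟨⟨c * d, h1.mul k1, by rw [← mul_assoc, h2, k2]⟩,
    ⟨d' * c', _, k3.mul h3, by rw [← mul_assoc, k4, h4]⟩⟩

theorem DD.symm {s t : WithOne S} {γ : FreeGroup A} (h : DD n f s t γ) : DD n f t s γ⁻¹ := by
  obtain ⟨⟨c, h1, h2⟩, ⟨d, δ, h3, h4⟩⟩ := h
  refine ⟨⟨d * (c * d) ^ (2 * n + 1), ?_, ?_⟩, ⟨c, γ, h1, h2⟩⟩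
  · have := h3.mul (h1.mul h3).omm
    simpa using this
  · have h5 : ∀ k, s * (c * d) ^ k = s := by
      intro k
      induction k with
      | zero => simp
      | succ k ih => rw [pow_succ, ← mul_assoc, ih, ← mul_assoc, h2, h4]
    rw [← mul_assoc, h4, h5]

variable (n f) in
/-- An edge staying in the `R`-class. -/
def Ed (s : WithOne S) (a : A) : Prop := ∃ c γ, Kr n f c γ ∧ s * (f a : S) * c = s

theorem Ed.dd {s : WithOne S} {a : A} (h : Ed n f s a) : DD n f s (s * (f a : S)) (FreeGroup.of a) :=
  ⟨⟨(f a : S), Kr.letter a, rfl⟩, h⟩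

variable (n f) in
/-- The setoid of states. -/
def stSetoid : Setoid (WithOne S) where
  r s s' := DD n f s s' 1
  iseqv := ⟨DD.refl, fun h => by simpa using h.symm, fun h h' => by simpa using h.trans h'⟩

theorem exists_perm {Q : Type} [Finite Q] (ρ : Q → Q → Prop)
    (h1 : ∀ q r r', ρ q r → ρ q r' → r = r') (h2 : ∀ q q' r, ρ q r → ρ q' r → q = q') :
    ∃ σ : Equiv.Perm Q, ∀ q r, ρ q r → σ q = r := by
  classical
  have := Fintype.ofFinite Q
  let g : {q // ∃ r, ρ q r} → {r // ∃ q, ρ q r} := fun q => ⟨q.2.choose, q.1, q.2.choose_spec⟩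
  have hg : Function.Bijective g := by
    constructor
    · intro q q' h
      have h : q.2.choose = q'.2.choose := congrArg Subtype.val h
      have a1 := q.2.choose_spec
      have a2 := q'.2.choose_spec
      rw [← h] at a2
      exact Subtype.ext (h2 _ _ _ a1 a2)
    · rintro ⟨r, q, h⟩
      refine ⟨⟨q, r, h⟩, Subtype.ext ?_⟩
      exact h1 _ _ _ (Exists.choose_spec (⟨r, h⟩ : ∃ r, ρ q r)) h
  refine ⟨(Equiv.ofBijective g hg).extendSubtype, fun q r h => ?_⟩
  rw [Equiv.extendSubtype_apply_of_mem _ q ⟨r, h⟩]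
  exact h1 _ _ _ (Exists.choose_spec (⟨r, h⟩ : ∃ r, ρ q r)) h

variable (n f) in
theorem exists_sigma [Finite S] (a : A) :
    ∃ σ : Equiv.Perm (Quotient (stSetoid n f)), ∀ s, Ed n f s a →
      σ (Quotient.mk _ s) = Quotient.mk _ (s * (f a : S)) := by
  have : Finite (WithOne S) := inferInstanceAs (Finite (Option S))
  obtain ⟨σ, hσ⟩ := exists_perm (Q := Quotient (stSetoid n f))
    (fun q q' => ∃ s, Ed n f s a ∧ Quotient.mk _ s = q ∧ Quotient.mk _ (s * (f a : S)) = q')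
    (by
      rintro q r r' ⟨s, h1, h2, h3⟩ ⟨s', h1', h2', h3'⟩
      rw [← h3, ← h3']
      apply Quotient.sound
      have e : DD n f s s' 1 := Quotient.exact (h2.trans h2'.symm)
      have := (h1.dd.symm.trans e).trans h1'.dd
      change DD n f _ _ 1
      simpa using this)
    (by
      rintro q q' r ⟨s, h1, h2, h3⟩ ⟨s', h1', h2', h3'⟩
      rw [← h2, ← h2']
      apply Quotient.sound
      have e : DD n f (s * (f a : S)) (s' * (f a : S)) 1 := Quotient.exact (h3.trans h3'.symm)
      have := (h1.dd.trans e).trans h1'.dd.symm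
      change DD n f _ _ 1
      simpa using this)
  exact ⟨σ, fun s h => hσ _ _ ⟨s, h, rfl, rfl⟩⟩

variable (n f) in
/-- The permutation induced by a letter. -/
noncomputable def sig [Finite S] (a : A) : Equiv.Perm (Quotient (stSetoid n f)) :=
  (exists_sigma n f a).choose

theorem sig_spec [Finite S] {a : A} {s : WithOne S} (h : Ed n f s a) :
    sig n f a (Quotient.mk _ s) = Quotient.mk _ (s * (f a : S)) :=
  (exists_sigma n f a).choose_spec s h

variable (n f) in
/-- The base quotient. -/
noncomputable def baseQ [Finite S] : FQ A :=
  haveI : Finite (WithOne S) := inferInstanceAs (Finite (Option S))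
  haveI : Finite (Equiv.Perm (Quotient (stSetoid n f)))ᵐᵒᵖ := Finite.of_equiv _ MulOpposite.opEquiv
  haveI : Finite (Multiplicative (ZMod 2)) := inferInstanceAs (Finite (ZMod 2))
  { G := (Equiv.Perm (Quotient (stSetoid n f)))ᵐᵒᵖ × Multiplicative (ZMod 2)
    hom := FreeGroup.lift fun a => (MulOpposite.op (sig n f a), Multiplicative.ofAdd 1) }

/-- Action on states. -/
def stt [Finite S] (q : Quotient (stSetoid n f)) (g : (baseQ n f).G) : Quotient (stSetoid n f) :=
  (MulOpposite.unop
    (show (Equiv.Perm (Quotient (stSetoid n f)))ᵐᵒᵖ × Multiplicative (ZMod 2) from g).1) q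

theorem stt_mul [Finite S] (q : Quotient (stSetoid n f)) (g h : (baseQ n f).G) :
    stt q (g * h) = stt (stt q g) h := rfl

theorem stt_one [Finite S] (q : Quotient (stSetoid n f)) : stt q (1 : (baseQ n f).G) = q := rfl

theorem stt_inv [Finite S] (q : Quotient (stSetoid n f)) (g : (baseQ n f).G) :
    stt (stt q g⁻¹) g = q := by
  rw [← stt_mul, inv_mul_cancel, stt_one]

theorem stt_inv' [Finite S] (q : Quotient (stSetoid n f)) (g : (baseQ n f).G) :
    stt (stt q g) g⁻¹ = q := by
  rw [← stt_mul, mul_inv_cancel, stt_one]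

theorem stt_of [Finite S] (q : Quotient (stSetoid n f)) (a : A) :
    stt q ((baseQ n f).hom (FreeGroup.of a)) = sig n f a q := by
  have : (baseQ n f).hom (FreeGroup.of a) =
    (show (baseQ n f).G from (MulOpposite.op (sig n f a), Multiplicative.ofAdd (1 : ZMod 2))) :=
    FreeGroup.lift_apply_of
  rw [this]; rfl

theorem base_ne [Finite S] (a : A) : (baseQ n f).hom (FreeGroup.of a) ≠ 1 := by
  have : (baseQ n f).hom (FreeGroup.of a) =
    (show (baseQ n f).G from (MulOpposite.op (sig n f a), Multiplicative.ofAdd (1 : ZMod 2))) :=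
    FreeGroup.lift_apply_of
  rw [this]
  intro h
  have h2 : Multiplicative.ofAdd (1 : ZMod 2) = 1 := congrArg Prod.snd h
  exact absurd h2 (by decide)

/-- Edges compatible with a state. -/
def Uq [Finite S] (q : Quotient (stSetoid n f)) : Set ((baseQ n f).G × A) :=
  {p | ∃ s, Quotient.mk _ s = stt q p.1 ∧ Ed n f s p.2}

theorem lemmaD [Finite S] (q : Quotient (stSetoid n f)) {u v : FreeGroup A}
    (h : ConnU (baseQ n f) (Uq q) u v) : ∀ s s' : WithOne S,
      Quotient.mk _ s = stt q ((baseQ n f).hom u) →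
      Quotient.mk _ s' = stt q ((baseQ n f).hom v) → DD n f s s' (u⁻¹ * v) := by
  unfold ConnU at h
  induction h with
  | rel u v h =>
    intro s s' hs hs'
    obtain ⟨a, ⟨t, ht, hta⟩, rfl⟩ := h
    rw [map_mul, stt_mul, stt_of, ← ht, sig_spec hta] at hs'
    have e1 : DD n f s t 1 := Quotient.exact (hs.trans ht.symm)
    have e2 : DD n f (t * (f a : S)) s' 1 := Quotient.exact hs'.symm
    have := (e1.trans hta.dd).trans e2
    simpa using this
  | refl u =>
    intro s s' hs hs'
    rw [inv_mul_cancel]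
    exact Quotient.exact (hs.trans hs'.symm)
  | symm u v _ ih =>
    intro s s' hs hs'
    have := (ih s' s hs' hs).symm
    simpa using this
  | trans u v w _ _ ih1 ih2 =>
    intro s s' hs hs'
    obtain ⟨t, ht⟩ := Quotient.exists_rep (stt q ((baseQ n f).hom v))
    have := (ih1 s t hs ht).trans (ih2 t s' ht hs')
    simpa [mul_assoc] using this

theorem single_edge {η0 : FQ A} {g : η0.G} {a : A} (ha : η0.hom (FreeGroup.of a) ≠ 1)
    {z z' : FreeGroup A} (h : ConnU η0 {(g, a)} z z') (hz : η0.hom z = g)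
    (hz' : η0.hom z' = g * η0.hom (FreeGroup.of a)) : z' = z * FreeGroup.of a := by
  classical
  let τ : FreeGroup A → FreeGroup A := fun u =>
    if η0.hom u = g then u else u * (FreeGroup.of a)⁻¹
  have hne : g * η0.hom (FreeGroup.of a) ≠ g := fun h => ha (mul_eq_left.1 h)
  have key : τ z = τ z' := by
    unfold ConnU at h
    clear hz hz'
    induction h with
    | rel u v h =>
      obtain ⟨b, hb, rfl⟩ := h
      obtain ⟨h1, rfl⟩ : η0.hom u = g ∧ b = a := by simpa using hb
      simp only [τ, map_mul, h1, if_true, hne, if_false, mul_inv_cancel_right]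
    | refl x => rfl
    | symm x y _ ih => exact ih.symm
    | trans x y z _ _ ih1 ih2 => exact ih1.trans ih2
  simp only [τ, hz, hz', if_true, hne, if_false] at key
  rw [key, inv_mul_cancel_right]

variable (n f) in
/-- Height of a state. -/
noncomputable def hgt (s : WithOne S) : ℕ := Set.ncard {t | ∃ c γ, Kr n f c γ ∧ s * c = t}

theorem word_chain [Finite S] (u : FreeMonoid A) : ∀ (s : WithOne S) (x : FreeGroup A)
    (q : Quotient (stSetoid n f)), stt q ((baseQ n f).hom x) = Quotient.mk _ s →
    ∃ L, L.length ≤ 2 * hgt n f s ∧ Chain (baseQ n f) (Uq q) L x (x * toFG u) ∧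
      ∀ x' y', (baseQ n f).hom x' = (baseQ n f).hom x →
        (baseQ n f).hom y' = (baseQ n f).hom (x * toFG u) →
        Chain (baseQ n f) (Uq q) L x' y' → ∃ c, Kr n f c (x'⁻¹ * y') ∧ s * c = s * wev f u := by
  have fin : Finite (WithOne S) := inferInstanceAs (Finite (Option S))
  induction u using FreeMonoid.inductionOn' with
  | one =>
    intro s x q hq
    refine ⟨[], by simp, ?_, ?_⟩
    · rw [map_one, mul_one]; exact ConnU.refl _ _
    · intro x' y' hx hy hc
      rw [map_one, mul_one] at hy
      obtain ⟨⟨c, h1, h2⟩, -⟩ := lemmaD q hc s s (by rw [hx, hq]) (by rw [hy, hq])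
      exact ⟨c, h1, by rw [h2, map_one, mul_one]⟩
  | of_mul b u ih =>
    intro s x q hq
    have hev : wev f (FreeMonoid.of b * u) = (f b : S) * wev f u := by rw [map_mul]; rfl
    have hfg : toFG (FreeMonoid.of b * u) = FreeGroup.of b * toFG u := by rw [map_mul]; rfl
    rw [hev, hfg]
    have hsub : {t | ∃ c γ, Kr n f c γ ∧ s * (f b : S) * c = t} ⊆
        {t | ∃ c γ, Kr n f c γ ∧ s * c = t} := by
      rintro t ⟨c, γ, h1, h2⟩
      exact ⟨(f b : S) * c, _, (Kr.letter b).mul h1, by rw [← mul_assoc, h2]⟩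
    by_cases hE : Ed n f s b
    · obtain ⟨L, hL, hC, hS⟩ := ih (s * (f b : S)) (x * FreeGroup.of b) q (by
        rw [map_mul, stt_mul, hq, stt_of, sig_spec hE])
      have edge : ∀ x', (baseQ n f).hom x' = (baseQ n f).hom x →
          ConnU (baseQ n f) (Uq q) x' (x' * FreeGroup.of b) := by
        intro x' hx'
        refine .rel _ _ ⟨b, ⟨s, ?_, hE⟩, rfl⟩
        change _ = stt q ((baseQ n f).hom x')
        rw [hx', hq]
      refine ⟨L, hL.trans ?_, ?_, ?_⟩
      · exact Nat.mul_le_mul_left 2 (Set.ncard_le_ncard hsub (Set.toFinite _))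
      · rw [← mul_assoc]; exact hC.left (edge x rfl)
      · intro x' y' hx hy hc
        obtain ⟨c, h1, h2⟩ := hS (x' * FreeGroup.of b) y' (by simp only [map_mul, hx])
          (by rw [hy, mul_assoc]) (hc.left (edge x' hx).symm)
        refine ⟨(f b : S) * c, ?_, ?_⟩
        · have := (Kr.letter (n := n) (f := f) b).mul h1
          simpa [mul_assoc] using this
        · rw [← mul_assoc, h2, mul_assoc]
    · obtain ⟨L, hL, hC, hS⟩ := ih (s * (f b : S)) (x * FreeGroup.of b)
        (stt (Quotient.mk _ (s * (f b : S))) ((baseQ n f).hom (x * FreeGroup.of b))⁻¹)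
        (stt_inv _ _)
      set q1 := stt (Quotient.mk (stSetoid n f) (s * (f b : S)))
        ((baseQ n f).hom (x * FreeGroup.of b))⁻¹
      refine ⟨((baseQ n f).hom x, {((baseQ n f).hom x, b)}) ::
        ((baseQ n f).hom (x * FreeGroup.of b), Uq q1) :: L, ?_, ?_, ?_⟩
      · have : hgt n f (s * (f b : S)) < hgt n f s := by
          refine Set.ncard_lt_ncard ⟨hsub, fun h => ?_⟩ (Set.toFinite _)
          exact hE (h ⟨1, 1, Kr.one, mul_one s⟩)
        simp only [List.length_cons]; omega
      · refine ⟨x, ConnU.refl _ _, rfl, x * FreeGroup.of b, ?_, rfl, ?_⟩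
        · exact .rel _ _ ⟨b, rfl, rfl⟩
        · rw [← mul_assoc]; exact hC
      · rintro x' y' hx hy ⟨z1, c1, c2, z2, c3, c4, c5⟩
        have hz2 := single_edge (base_ne b) c3 c2 (by rw [c4, map_mul])
        obtain ⟨⟨c, h1, h2⟩, -⟩ := lemmaD q c1 s s (by rw [hx, hq]) (by rw [c2, hq])
        obtain ⟨d, k1, k2⟩ := hS z2 y' c4 (by rw [hy, mul_assoc]) c5
        refine ⟨c * ((f b : S) * d), ?_, ?_⟩
        · have := h1.mul ((Kr.letter (n := n) (f := f) b).mul k1)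
          rw [hz2] at this
          simpa [mul_assoc] using this
        · rw [← mul_assoc, h2, ← mul_assoc, k2, mul_assoc]

/-- Ash's theorem, in the form needed for pointlike sets. -/
theorem ash [Finite S] [Finite A] (n : ℕ) (f : A → S) :
    ∃ H : FQ A, ∀ h : H.G, ∃ γ, ∀ u : FreeMonoid A, H.hom (toFG u) = h → Kr n f (wev f u) γ := by
  classical
  have fin : Finite (WithOne S) := inferInstanceAs (Finite (Option S))
  have := Fintype.ofFinite (WithOne S)
  set m := Nat.card (WithOne S)
  obtain ⟨H, hH, hl⟩ := exists_lift (η0 := baseQ n f) (m * (2 * m)) (baseQ n f) (FQ.Le.refl _)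
  refine ⟨H, fun h => ?_⟩
  let I := {c : WithOne S // ∃ u : FreeMonoid A, H.hom (toFG u) = h ∧ wev f u = c}
  choose w hw1 hw2 using fun c : I => c.2
  by_cases hI : Nonempty I
  swap
  · exact ⟨1, fun u hu => (hI ⟨⟨wev f u, u, hu, rfl⟩⟩).elim⟩
  obtain ⟨i0⟩ := hI
  have hwc := fun i : I => word_chain (n := n) (f := f) (w i) 1 1 (Quotient.mk _ 1)
    (by rw [map_one, stt_one])
  choose L hL hC hS using hwc
  obtain ⟨y, hy, hyc⟩ := hl I (fun _ => Uq (Quotient.mk _ 1)) L 1 (toFG (w i0))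
    (fun i => toFG (w i)) (by
      have h1 : ∀ i, (L i).length ≤ 2 * m := fun i => (hL i).trans (by
        refine Nat.mul_le_mul_left 2 ?_
        rw [hgt]
        exact (Set.ncard_le_ncard (Set.subset_univ _) (Set.toFinite _)).trans
          (Set.ncard_univ _).le)
      refine (Finset.sum_le_card_nsmul _ _ (2 * m) (fun i _ => h1 i)).trans ?_
      rw [smul_eq_mul]
      refine Nat.mul_le_mul_right _ ?_
      rw [Finset.card_univ, ← Nat.card_eq_fintype_card]
      exact Finite.card_subtype_le _)
    (fun i => by simpa using hC i) (fun i => by rw [hw1, hw1])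
  refine ⟨y, fun u hu => ?_⟩
  let i : I := ⟨wev f u, u, hu, rfl⟩
  obtain ⟨c, h1, h2⟩ := hS i 1 y rfl (by
    rw [one_mul, hy]
    apply hH
    rw [hw1, hw1]) (hyc i)
  rw [one_mul, one_mul, hw2] at h2
  rw [inv_one, one_mul] at h1
  have h3 : c = wev f u := h2
  rw [h3] at h1
  exact h1

end Kr


/-- Sets of letters under union. -/
def CSet (A : Type) : Type := Set A

instance {A : Type} : Semigroup (CSet A) where
  mul x y := (Set.union x y : Set A)
  mul_assoc x y z := Set.union_assoc x y z

instance {A : Type} [Finite A] : Finite (CSet A) := inferInstanceAs (Finite (Set A))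

theorem CSet.mul_def {A : Type} (x y : CSet A) : x * y = ((x : Set A) ∪ (y : Set A) : Set A) := rfl

theorem CSet.spow {A : Type} (x : CSet A) (n : ℕ) : spow x n = x := by
  induction n with
  | zero => rfl
  | succ k ih => rw [spow_succ, ih, CSet.mul_def]; exact Set.union_self _

section
variable {A S : Type} [Semigroup S]

/-- Assignment recording the content. -/
def fC (f : A → S) : A → S × CSet A := fun a => (f a, ({a} : Set A))

theorem sv_fC (n : ℕ) (f : A → S) (t : KTerm A) :
    sv n (fC f) t = (sv n f t, (cont t : Set A)) := by
  induction t with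
  | letter a => rfl
  | mul u v hu hv =>
    simp only [sv, hu, hv]; rfl
  | ommPow u hu =>
    simp only [sv, hu]
    refine Prod.ext ?_ ?_
    · exact map_spow (Prod.fst : S × CSet A → S) (fun _ _ => rfl) _ _
    · exact (map_spow (Prod.snd : S × CSet A → CSet A) (fun _ _ => rfl) _ _).trans (CSet.spow _ _)

/-- Content component. -/
def cc : WithOne (S × CSet A) → Set A
  | none => (∅ : Set A)
  | some x => x.2

/-- Value component. -/
def vv : WithOne (S × CSet A) → WithOne S
  | none => none
  | some x => some x.1

theorem cc_mul (x y : WithOne (S × CSet A)) : cc (x * y) = cc x ∪ cc y := by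
  rcases x with _ | x <;> rcases y with _ | y
  · exact (Set.union_self _).symm
  · exact (Set.empty_union _).symm
  · exact (Set.union_empty _).symm
  · rfl

theorem vv_mul (x y : WithOne (S × CSet A)) : vv (x * y) = vv x * vv y := by
  rcases x with _ | x <;> rcases y with _ | y
  · rfl
  · rfl
  · rfl
  · rfl

theorem osv_fC (n : ℕ) (f : A → S) (o : Option (KTerm A)) :
    vv (osv n (fC f) o) = osv n f o ∧ cc (osv n (fC f) o) = ocont o := by
  rcases o with _ | t
  · exact ⟨rfl, rfl⟩
  · simp only [osv, sv_fC]; exact ⟨rfl, rfl⟩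

theorem wev_fC (f : A → S) (u : FreeMonoid A) :
    vv (wev (fC f) u) = wev f u ∧ cc (wev (fC f) u) = {a | a ∈ u} := by
  induction u using FreeMonoid.inductionOn' with
  | one =>
    refine ⟨rfl, ?_⟩
    ext a
    simp [FreeMonoid.notMem_one]
    exact fun h => h
  | of_mul b u ih =>
    rw [map_mul, map_mul, vv_mul, cc_mul, ih.1, ih.2]
    refine ⟨rfl, ?_⟩
    ext a
    rw [Set.mem_union]
    simp only [Set.mem_ofPred_eq, FreeMonoid.mem_mul, FreeMonoid.mem_of]
    exact Iff.rfl

/-- Content of a word. -/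
def wc (u : FreeMonoid A) : Set A := {a | a ∈ u}

theorem wc_mul (u v : FreeMonoid A) : wc (u * v) = wc u ∪ wc v := by
  ext a; simp [wc, FreeMonoid.mem_mul]

theorem wc_of (a : A) : wc (FreeMonoid.of a) = {a} := by
  ext b; simp [wc, FreeMonoid.mem_of]

theorem wc_one : wc (1 : FreeMonoid A) = ∅ := by
  ext b; simp [wc, FreeMonoid.notMem_one]

theorem ashc [Finite S] [Finite A] (n : ℕ) (f : A → S) :
    ∃ H : FQ A, ∀ h : H.G, ∃ γ, ∀ u : FreeMonoid A, H.hom (toFG u) = h →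
      ∃ o, osv n f o = wev f u ∧ ofg o = γ ∧ ocont o = wc u := by
  obtain ⟨H, hH⟩ := ash n (fC f)
  refine ⟨H, fun h => ?_⟩
  obtain ⟨γ, hγ⟩ := hH h
  refine ⟨γ, fun u hu => ?_⟩
  obtain ⟨o, h1, h2⟩ := hγ u hu
  refine ⟨o, ?_, h2, ?_⟩
  · rw [← (osv_fC n f o).1, h1, (wev_fC f u).1]
  · rw [← (osv_fC n f o).2, h1, (wev_fC f u).2, wc]

open scoped Pointwise

/-- Terms with equal values over the free group and over `DO`. -/
def Eqv (o o' : Option (KTerm A)) : Prop :=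
  ofg o = ofg o' ∧ ∀ (T : Type) [Semigroup T] [Finite T], InDO T → ∀ m, IdemExp T m →
    ∀ g : A → T, osv m g o = osv m g o'

theorem Eqv.refl (o : Option (KTerm A)) : Eqv o o := ⟨rfl, fun _ _ _ _ _ _ _ => rfl⟩

theorem Eqv.mul {o o' p p' : Option (KTerm A)} (h : Eqv o o') (h' : Eqv p p') :
    Eqv (omul o p) (omul o' p') := by
  refine ⟨by rw [ofg_omul, ofg_omul, h.1, h'.1], fun T _ _ hT m hm g => ?_⟩
  rw [osv_omul, osv_omul, h.2 T hT m hm g, h'.2 T hT m hm g]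

/-- Realizable sets. -/
def Rl (n : ℕ) (f : A → S) (B : Set A) (P : Set (WithOne S)) : Prop :=
  ∃ K : Set (Option (KTerm A)), (∀ o ∈ K, ocont o = B) ∧ (∀ o ∈ K, ∀ o' ∈ K, Eqv o o') ∧
    ∀ p ∈ P, ∃ o ∈ K, osv n f o = p

/-- Group-realizable sets. -/
def Gr (n : ℕ) (f : A → S) (B : Set A) (P : Set (WithOne S)) : Prop :=
  ∃ γ, ∀ p ∈ P, ∃ o, osv n f o = p ∧ ocont o ⊆ B ∧ ofg o = γ

variable {n : ℕ} {f : A → S}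

theorem Rl.mono {B : Set A} {P P' : Set (WithOne S)} (h : Rl n f B P) (hP : P' ⊆ P) :
    Rl n f B P' := by
  obtain ⟨K, h1, h2, h3⟩ := h
  exact ⟨K, h1, h2, fun p hp => h3 p (hP hp)⟩

theorem Rl.mul {B C : Set A} {P Q : Set (WithOne S)} (h : Rl n f B P) (h' : Rl n f C Q) :
    Rl n f (B ∪ C) (P * Q) := by
  obtain ⟨K, h1, h2, h3⟩ := h
  obtain ⟨L, k1, k2, k3⟩ := h'
  refine ⟨Set.image2 omul K L, ?_, ?_, ?_⟩
  · rintro _ ⟨o, ho, o', ho', rfl⟩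
    rw [ocont_omul, h1 o ho, k1 o' ho']
  · rintro _ ⟨o, ho, o', ho', rfl⟩ _ ⟨p, hp, p', hp', rfl⟩
    exact (h2 _ ho _ hp).mul (k2 _ ho' _ hp')
  · rintro _ ⟨p, hp, q, hq, rfl⟩
    obtain ⟨o, ho, rfl⟩ := h3 p hp
    obtain ⟨o', ho', rfl⟩ := k3 q hq
    exact ⟨_, ⟨o, ho, o', ho', rfl⟩, osv_omul _ _ _ _⟩

theorem Rl.one : Rl n f ∅ 1 :=
  ⟨{none}, by rintro _ rfl; rfl, by rintro _ rfl _ rfl; exact Eqv.refl _,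
    by rintro _ rfl; exact ⟨none, rfl, rfl⟩⟩

theorem Rl.letter (a : A) : Rl n f {a} {((f a : S) : WithOne S)} :=
  ⟨{some (.letter a)}, by rintro _ rfl; rfl, by rintro _ rfl _ rfl; exact Eqv.refl _,
    by rintro _ rfl; exact ⟨_, rfl, rfl⟩⟩

theorem Rl.list_prod {B : Set A} (Xs : List (Set (WithOne S))) (h : ∀ X ∈ Xs, Rl n f B X) :
    (∃ B' ⊆ B, Rl n f B' Xs.prod) ∧ (Xs ≠ [] → Rl n f B Xs.prod) := by
  induction Xs with
  | nil => exact ⟨⟨∅, Set.empty_subset _, Rl.one⟩, fun h => (h rfl).elim⟩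
  | cons X Xs ih =>
    obtain ⟨⟨B', hB', h'⟩, -⟩ := ih fun Y hY => h Y (List.mem_cons_of_mem _ hY)
    have h1 := (h X List.mem_cons_self).mul h'
    rw [Set.union_eq_self_of_subset_right hB', ← List.prod_cons] at h1
    exact ⟨⟨B, subset_rfl, h1⟩, fun _ => h1⟩

theorem Rl.pow {B : Set A} {X : Set (WithOne S)} (h : Rl n f B X) {N : ℕ} (hN : 0 < N) :
    Rl n f B (X ^ N) := by
  rw [← List.prod_replicate]
  refine (Rl.list_prod (List.replicate N X) fun Y hY => ?_).2 (by simp; omega)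
  rw [List.eq_of_mem_replicate hY]; exact h

theorem Rl.gr {B B' : Set A} {X : Set (WithOne S)} (h : Rl n f B' X) (hB : B' ⊆ B) :
    Gr n f B X := by
  obtain ⟨K, h1, h2, h3⟩ := h
  by_cases hK : ∃ o, o ∈ K
  · obtain ⟨o0, h0⟩ := hK
    refine ⟨ofg o0, fun p hp => ?_⟩
    obtain ⟨o, ho, hop⟩ := h3 p hp
    exact ⟨o, hop, (h1 o ho).trans_subset hB, (h2 o ho o0 h0).1⟩
  · refine ⟨1, fun p hp => ?_⟩
    obtain ⟨o, ho, hop⟩ := h3 p hp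
    exact (hK ⟨o, ho⟩).elim

theorem Gr.mul {B : Set A} {X Y : Set (WithOne S)} (h : Gr n f B X) (h' : Gr n f B Y) :
    Gr n f B (X * Y) := by
  obtain ⟨γ, h⟩ := h
  obtain ⟨δ, h'⟩ := h'
  refine ⟨γ * δ, ?_⟩
  rintro _ ⟨x, hx, y, hy, rfl⟩
  obtain ⟨o, rfl, ho, ho2⟩ := h x hx
  obtain ⟨p, rfl, hp, hp2⟩ := h' y hy
  exact ⟨omul o p, osv_omul _ _ _ _, by rw [ocont_omul]; exact Set.union_subset ho hp,
    by rw [ofg_omul, ho2, hp2]⟩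

theorem sv_mem_idealGen {T : Type} [Semigroup T] {m : ℕ} (g : A → T) (t : KTerm A) {a : A}
    (ha : a ∈ cont t) : sv m g t ∈ idealGen (g a) := by
  induction t with
  | letter b => cases ha; exact idealGen_self _
  | mul u v hu hv =>
    rcases ha with h | h
    · exact idealGen_trans (mul_right_mem_idealGen _ _) (hu h)
    · exact idealGen_trans (mul_left_mem_idealGen _ _) (hv h)
  | ommPow u hu =>
    refine idealGen_trans ?_ (hu ha)
    simp only [sv]
    rcases (2 * m) with _ | k
    · exact idealGen_self _
    · rw [spow_succ]; exact mul_left_mem_idealGen _ _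

/-- The omega power of a term. -/
def oom (o : Option (KTerm A)) : Option (KTerm A) := omul o (oomm o)

theorem oom_ocont (o : Option (KTerm A)) : ocont (oom o) = ocont o := by
  rw [oom, ocont_omul, ocont_oomm, Set.union_self]

theorem oom_ofg (o : Option (KTerm A)) : ofg (oom o) = 1 := by
  rw [oom, ofg_omul, ofg_oomm, mul_inv_cancel]

theorem oom_osv {T : Type} [Semigroup T] (m : ℕ) (g : A → T) (o : Option (KTerm A)) :
    osv m g (oom o) = (osv m g o) ^ (2 * m + 2) := by
  rw [oom, osv_omul, osv_oomm, ← pow_succ']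

theorem Eqv.oom {o o' : Option (KTerm A)} (h : Eqv o o') : Eqv (oom o) (oom o') := by
  refine ⟨by rw [oom_ofg, oom_ofg], fun T _ _ hT m hm g => ?_⟩
  rw [oom_osv, oom_osv, h.2 T hT m hm g]

theorem mid_eqv {B : Set A} (hB : B.Nonempty) {c d s s' : Option (KTerm A)} (hc : ocont c = B)
    (hd : ocont d = B) (hs : ocont s = B) (hs' : ocont s' = B) (hf : ofg s = ofg s') :
    Eqv (omul (omul (oom c) s) (oom d)) (omul (omul (oom c) s') (oom d)) := by
  refine ⟨by simp only [ofg_omul, hf], fun T _ _ hT m hm g => ?_⟩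
  have some_of : ∀ o : Option (KTerm A), ocont o = B → ∃ t, o = some t := by
    rintro (_ | t) h
    · rw [← h] at hB; exact absurd hB Set.not_nonempty_empty
    · exact ⟨t, rfl⟩
  obtain ⟨s, rfl⟩ := some_of s hs
  obtain ⟨s', rfl⟩ := some_of s' hs'
  have idem : ∀ o : Option (KTerm A), osv m g (oom o) * osv m g (oom o) = osv m g (oom o) := by
    intro o
    have := hm.pow (osv m g o)
    have e : 2 * m + 2 = (m + 1) + (m + 1) := by omega
    rw [oom_osv, e, pow_add, this, this]
  have hc' := oom_ocont c
  have hd' := oom_ocont d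
  have ic := idem c
  have id' := idem d
  rw [hc] at hc'
  rw [hd] at hd'
  obtain ⟨tc, htc⟩ := some_of _ hc'
  obtain ⟨td, htd⟩ := some_of _ hd'
  rw [htc] at hc' ic ⊢
  rw [htd] at hd' id' ⊢
  simp only [osv, ← WithOne.coe_mul, WithOne.coe_inj] at ic id'
  simp only [ocont] at hs hs' hc' hd'
  simp only [osv_omul]
  simp only [osv, ← WithOne.coe_mul, WithOne.coe_inj]
  have ec : ∀ a ∈ B, sv m g tc ∈ idealGen (g a) := fun a ha => sv_mem_idealGen g tc (hc' ▸ ha)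
  have ed : ∀ a ∈ B, sv m g td ∈ idealGen (g a) := fun a ha => sv_mem_idealGen g td (hd' ▸ ha)
  refine hT.term_eq hm ic id' ?_ g s s' (by rw [hs]; exact ec) (by rw [hs']; exact ec) hf
  refine mem_jClass_iff.2 ⟨?_, ?_⟩
  · exact hT.F_sv id' g tc (by rw [hc']; exact ed)
  · exact hT.F_sv ic g td (by rw [hd']; exact ec)

theorem factor_idem {M : Type*} [Monoid M] [Finite M] {X : Set M} (hX : X * X = X) {x : M}
    (hx : x ∈ X) : ∃ x1 ∈ X, ∃ c ∈ X, ∃ x2 ∈ X, x1 * x2 = x ∧ x1 * c = x1 := by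
  have hd : ∀ y : X, ∃ p : X × X, (p.1 : M) * p.2 = y := by
    rintro ⟨y, hy⟩
    rw [← hX] at hy
    obtain ⟨a, ha, b, hb, h⟩ := hy
    exact ⟨(⟨a, ha⟩, ⟨b, hb⟩), h⟩
  choose d hd using hd
  let sq : ℕ → X × X := fun k => Nat.rec (d ⟨x, hx⟩)
    (fun _ p => (⟨p.1 * (d p.2).1, by
      have := Set.mul_mem_mul p.1.2 (d p.2).1.2
      rwa [hX] at this⟩, (d p.2).2)) k
  have h0 : sq 0 = d ⟨x, hx⟩ := rfl
  have h1 : ∀ k, ((sq (k + 1)).1 : M) = (sq k).1 * (d (sq k).2).1 := fun k => rfl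
  have h2 : ∀ k, (sq (k + 1)).2 = (d (sq k).2).2 := fun k => rfl
  have h3 : ∀ k, ((sq k).1 : M) * (sq k).2 = x := by
    intro k
    induction k with
    | zero => rw [h0, hd]
    | succ k ih => rw [h1, h2, mul_assoc, hd, ih]
  have h4 : ∀ i j, ∃ c ∈ X, ((sq (i + j + 1)).1 : M) = (sq i).1 * c := by
    intro i j
    induction j with
    | zero => exact ⟨_, (d (sq i).2).1.2, h1 i⟩
    | succ j ih =>
      obtain ⟨c, hc, h⟩ := ih
      refine ⟨c * (d (sq (i + j + 1)).2).1, ?_, ?_⟩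
      · have := Set.mul_mem_mul hc (d (sq (i + j + 1)).2).1.2
        rwa [hX] at this
      · rw [← mul_assoc, ← h]; exact h1 (i + j + 1)
  obtain ⟨i, j, hij, hs⟩ : ∃ i j : ℕ, i < j ∧ ((sq i).1 : M) = (sq j).1 := by
    obtain ⟨i, j, hne, hs⟩ := Finite.exists_ne_map_eq_of_infinite (fun k : ℕ => ((sq k).1 : M))
    rcases lt_or_gt_of_ne hne with h | h
    · exact ⟨i, j, h, hs⟩
    · exact ⟨j, i, h, hs.symm⟩
  obtain ⟨c, hc, h⟩ := h4 i (j - i - 1)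
  have e : i + (j - i - 1) + 1 = j := by omega
  rw [e, ← hs] at h
  exact ⟨_, (sq i).1.2, c, hc, _, (sq i).2.2, h3 i, h.symm⟩

theorem mul_pow_absorb {M : Type*} [Monoid M] {x c : M} (h : x * c = x) (k : ℕ) :
    x * c ^ k = x := by
  induction k with
  | zero => simp
  | succ k ih => rw [pow_succ, ← mul_assoc, ih, h]

theorem Rl.sandwich [Finite S] {B : Set A} (hB : B.Nonempty) {X Y Z : Set (WithOne S)}
    (hX : X * X = X) (hY : Y * Y = Y) (rX : Rl n f B X) (rY : Rl n f B Y) (gZ : Gr n f B Z) :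
    Rl n f B (X * Z * Y) := by
  have : Finite (WithOne S) := inferInstanceAs (Finite (Option S))
  obtain ⟨K, h1, h2, h3⟩ := rX
  obtain ⟨L, k1, k2, k3⟩ := rY
  obtain ⟨γ, hγ⟩ := gZ
  refine ⟨{o | ∃ w1 ∈ K, ∃ c ∈ K, ∃ w2 ∈ K, ∃ v1 ∈ L, ∃ d ∈ L, ∃ v2 ∈ L, ∃ z,
    ocont z ⊆ B ∧ ofg z = γ ∧
    o = omul (omul w1 (omul (omul (oom c) (omul (omul w2 z) v1)) (oom d))) v2}, ?_, ?_, ?_⟩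
  · rintro _ ⟨w1, hw1, c, hc, w2, hw2, v1, hv1, d, hd, v2, hv2, z, hz, -, rfl⟩
    simp only [ocont_omul, oom_ocont, h1 _ hw1, h1 _ hc, h1 _ hw2, k1 _ hv1, k1 _ hv2, k1 _ hd,
      Set.union_eq_self_of_subset_right hz, Set.union_self]
  · rintro _ ⟨w1, hw1, c, hc, w2, hw2, v1, hv1, d, hd, v2, hv2, z, hz, hz', rfl⟩
      _ ⟨w1', hw1', c', hc', w2', hw2', v1', hv1', d', hd', v2', hv2', z', hzz, hzz', rfl⟩
    refine ((h2 _ hw1 _ hw1').mul ?_).mul (k2 _ hv2 _ hv2')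
    have e1 : Eqv (omul (omul (oom c) (omul (omul w2 z) v1)) (oom d))
        (omul (omul (oom c) (omul (omul w2' z') v1')) (oom d)) := by
      refine mid_eqv hB (h1 _ hc) (k1 _ hd) ?_ ?_ ?_
      · simp only [ocont_omul, h1 _ hw2, k1 _ hv1, Set.union_eq_self_of_subset_right hz,
          Set.union_self]
      · simp only [ocont_omul, h1 _ hw2', k1 _ hv1', Set.union_eq_self_of_subset_right hzz,
          Set.union_self]
      · simp only [ofg_omul, hz', hzz', (h2 _ hw2 _ hw2').1, (k2 _ hv1 _ hv1').1]
    have e2 := (((h2 _ hc _ hc').oom).mul (Eqv.refl (omul (omul w2' z') v1'))).mul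
      (k2 _ hd _ hd').oom
    exact ⟨e1.1.trans e2.1, fun T _ _ hT m hm g =>
      (e1.2 T hT m hm g).trans (e2.2 T hT m hm g)⟩
  · rintro _ ⟨_, ⟨x, hx, z, hz, rfl⟩, y, hy, rfl⟩
    obtain ⟨x1, hx1, c, hc, x2, hx2, rfl, hxc⟩ := factor_idem hX hx
    obtain ⟨y1, hy1, d, hd, y2, hy2, rfl, hyd⟩ := factor_idem hY hy
    obtain ⟨w1, hw1, rfl⟩ := h3 _ hx1
    obtain ⟨w2, hw2, rfl⟩ := h3 _ hx2
    obtain ⟨wc, hwc, rfl⟩ := h3 _ hc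
    obtain ⟨v1, hv1, rfl⟩ := k3 _ hy1
    obtain ⟨v2, hv2, rfl⟩ := k3 _ hy2
    obtain ⟨wd, hwd, rfl⟩ := k3 _ hd
    obtain ⟨o, rfl, ho, ho'⟩ := hγ _ hz
    refine ⟨_, ⟨w1, hw1, wc, hwc, w2, hw2, v1, hv1, wd, hwd, v2, hv2, o, ho, ho', rfl⟩, ?_⟩
    have a1 := mul_pow_absorb hxc (2 * n + 2)
    have a2 := mul_pow_absorb hyd (2 * n + 2)
    simp only [osv_omul, oom_osv]
    calc _ = (osv n f w1 * osv n f wc ^ (2 * n + 2)) * osv n f w2 * osv n f o *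
          (osv n f v1 * osv n f wd ^ (2 * n + 2)) * osv n f v2 := by simp only [mul_assoc]
      _ = _ := by rw [a1, a2]; simp only [mul_assoc]

/-- Pigeonhole on products of sets. -/
theorem Rl.split [Finite S] {B : Set A} (Xs : List (Set (WithOne S)))
    (h : ∀ X ∈ Xs, Rl n f B X) (hl : Nat.card (Set (WithOne S)) ≤ Xs.length) :
    ∃ C E D : Set (WithOne S), Xs.prod = C * E * D ∧ E * E = E ∧ Rl n f B E ∧
      (∃ B' ⊆ B, Rl n f B' C) ∧ ∃ B' ⊆ B, Rl n f B' D := by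
  have : Finite (WithOne S) := inferInstanceAs (Finite (Option S))
  have := Fintype.ofFinite (Set (WithOne S))
  obtain ⟨i, j, hij, hs⟩ : ∃ i j : Fin (Xs.length + 1), i < j ∧
      (Xs.take i).prod = (Xs.take j).prod := by
    obtain ⟨i, j, hne, hs⟩ := Fintype.exists_ne_map_eq_of_card_lt
      (fun k : Fin (Xs.length + 1) => (Xs.take k).prod)
      (by rw [Fintype.card_fin, ← Nat.card_eq_fintype_card]; omega)
    rcases lt_or_gt_of_ne hne with h | h
    · exact ⟨i, j, h, hs⟩
    · exact ⟨j, i, h, hs.symm⟩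
  have hij' : (i : ℕ) < j := hij
  have hj := j.2
  obtain ⟨N, hN, hid⟩ := exists_pow_idem (Set (WithOne S))
  set M := ((Xs.drop i).take (j - i)).prod with hM
  have e : (Xs.take i).prod * M = (Xs.take i).prod := by
    rw [hM, ← List.prod_append, ← List.take_add]
    rw [show (i : ℕ) + (j - i) = j by omega, hs]
  have rM : Rl n f B M := by
    refine (Rl.list_prod _ fun X hX => h X (List.mem_of_mem_drop (List.mem_of_mem_take hX))).2 ?_
    intro hnil
    have := congrArg List.length hnil
    simp at this
    omega
  refine ⟨(Xs.take i).prod, M ^ N, (Xs.drop i).prod, ?_, hid M, rM.pow hN, ?_, ?_⟩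
  · rw [mul_pow_absorb e, ← List.prod_append, List.take_append_drop]
  · exact (Rl.list_prod _ fun X hX => h X (List.mem_of_mem_take hX)).1
  · exact (Rl.list_prod _ fun X hX => h X (List.mem_of_mem_drop hX)).1

theorem Rl.final [Finite S] {B : Set A} (hB : B.Nonempty) (Xs Ys : List (Set (WithOne S)))
    (hX : ∀ X ∈ Xs, Rl n f B X) (hY : ∀ X ∈ Ys, Rl n f B X)
    (hXl : Nat.card (Set (WithOne S)) ≤ Xs.length)
    (hYl : Nat.card (Set (WithOne S)) ≤ Ys.length) {Z : Set (WithOne S)} (hZ : Gr n f B Z) :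
    Rl n f B (Xs.prod * Z * Ys.prod) := by
  obtain ⟨C, E, D, h1, h2, h3, ⟨B1, hB1, h4⟩, ⟨B2, hB2, h5⟩⟩ := Rl.split Xs hX hXl
  obtain ⟨C', E', D', k1, k2, k3, ⟨B1', hB1', k4⟩, ⟨B2', hB2', k5⟩⟩ := Rl.split Ys hY hYl
  have := (h4.mul (Rl.sandwich hB h2 k2 h3 k3 (((h5.gr hB2).mul hZ).mul (k4.gr hB1')))).mul k5
  rw [Set.union_eq_self_of_subset_left hB1, Set.union_eq_self_of_subset_right hB2'] at this
  rw [h1, k1]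
  simpa only [mul_assoc] using this
end


/-- A finite monoid quotient in `DO`. -/
structure MQ (A : Type) where
  Q : Type
  [mon : Monoid Q]
  [fin : Finite Q]
  hom : FreeMonoid A →* Q
  dom : DOm Q

attribute [instance] MQ.mon MQ.fin

section
open scoped Pointwise
variable {A S : Type} [Semigroup S]

/-- Refinement. -/
def MQ.Le (M' M : MQ A) : Prop := ∀ u v, M'.hom u = M'.hom v → M.hom u = M.hom v

theorem MQ.Le.trans {M M' M'' : MQ A} (h1 : M''.Le M') (h2 : M'.Le M) : M''.Le M :=
  fun u v h => h2 _ _ (h1 _ _ h)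

/-- Contents are recognized. -/
def MQ.Co (M : MQ A) : Prop := ∀ u v, M.hom u = M.hom v → wc u = wc v

/-- The values of the words in a class. -/
def MQ.cl (M : MQ A) (f : A → S) (u0 : FreeMonoid A) : Set (WithOne S) :=
  wev f '' {u | M.hom u = M.hom u0}

theorem MQ.cl_mono {M' M : MQ A} (h : M'.Le M) (f : A → S) (u0 : FreeMonoid A) :
    M'.cl f u0 ⊆ M.cl f u0 := Set.image_mono fun _ hu => h _ _ hu

/-- All classes with small content are realizable. -/
def Good (n : ℕ) (f : A → S) (k : ℕ) (M : MQ A) : Prop :=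
  ∀ u0, (wc u0).ncard ≤ k → Rl n f (wc u0) (M.cl f u0)

variable {n : ℕ} {f : A → S}

theorem Good.le {k : ℕ} {M M' : MQ A} (h : Good n f k M) (hle : M'.Le M) : Good n f k M' :=
  fun u0 hu => (h u0 hu).mono (MQ.cl_mono hle f u0)

/-- Factorization at the letter whose first occurrence is last. -/
theorem exists_last_new (u : FreeMonoid A) (hu : u ≠ 1) :
    ∃ a u1 u2, u = u1 * FreeMonoid.of a * u2 ∧ a ∉ u1 ∧ wc u1 ∪ {a} = wc u := by
  have hr : ∀ v : FreeMonoid A, v ≠ 1 →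
      ∃ a u1 u2, v.reverse = u1 * FreeMonoid.of a * u2 ∧ a ∉ u1 ∧ wc u1 ∪ {a} = wc v.reverse := by
    intro v
    induction v using FreeMonoid.inductionOn' with
    | one => exact fun h => (h rfl).elim
    | of_mul b v ih =>
      intro _
      have e : (FreeMonoid.of b * v).reverse = v.reverse * FreeMonoid.of b := by
        rw [FreeMonoid.reverse_mul]; rfl
      rw [e]
      by_cases hb : b ∈ v.reverse
      · have hv : v ≠ 1 := by
          rintro rfl
          exact FreeMonoid.notMem_one hb
        obtain ⟨a, u1, u2, h1, h2, h3⟩ := ih hv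
        refine ⟨a, u1, u2 * FreeMonoid.of b, ?_, h2, ?_⟩
        · rw [h1]; simp only [mul_assoc]
        · rw [h3, wc_mul, wc_of]
          exact (Set.union_eq_self_of_subset_right (Set.singleton_subset_iff.2 hb)).symm
      · exact ⟨b, v.reverse, 1, by rw [mul_one], hb, by rw [wc_mul, wc_of]⟩
  have := hr u.reverse (by
    intro h
    apply hu
    rw [← FreeMonoid.reverse_reverse (a := u), h]; rfl)
  rwa [FreeMonoid.reverse_reverse] at this

theorem exists_first_new (u : FreeMonoid A) (hu : u ≠ 1) :
    ∃ a u1 u2, u = u1 * FreeMonoid.of a * u2 ∧ a ∉ u2 ∧ wc u2 ∪ {a} = wc u := by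
  induction u using FreeMonoid.inductionOn' with
  | one => exact (hu rfl).elim
  | of_mul b v ih =>
    by_cases hb : b ∈ v
    · have hv : v ≠ 1 := by
        rintro rfl
        exact FreeMonoid.notMem_one hb
      obtain ⟨a, u1, u2, h1, h2, h3⟩ := ih hv
      refine ⟨a, FreeMonoid.of b * u1, u2, ?_, h2, ?_⟩
      · rw [h1]; simp only [mul_assoc]
      · rw [h3, wc_mul, wc_of]
        exact (Set.union_eq_self_of_subset_left (Set.singleton_subset_iff.2 hb)).symm
    · exact ⟨b, 1, v, by rw [one_mul], hb, by rw [wc_mul, wc_of, Set.union_comm]⟩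

theorem MQ.left [Finite A] (M : MQ A) : ∃ M' : MQ A, LeftP M.hom M'.hom := by
  obtain ⟨Q', _, _, ψ', h1, h2⟩ := exists_left M.dom M.hom
  exact ⟨⟨Q', ψ', h1⟩, h2⟩

theorem MQ.right [Finite A] (M : MQ A) : ∃ M' : MQ A, RightP M.hom M'.hom := by
  obtain ⟨Q', _, _, ψ', h1, h2⟩ := exists_right M.dom M.hom
  exact ⟨⟨Q', ψ', h1⟩, h2⟩

theorem ne_one_of_wc {u : FreeMonoid A} {k : ℕ} (h : (wc u).ncard = k + 1) : u ≠ 1 := by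
  rintro rfl
  rw [wc_one, Set.ncard_empty] at h
  omega

theorem ncard_new [Finite A] {B C : Set A} {a : A} {k : ℕ} (h : C.ncard = k + 1) (ha : a ∉ B)
    (hB : B ∪ {a} = C) : B.ncard ≤ k := by
  rw [Set.union_singleton] at hB
  rw [← hB, Set.ncard_insert_of_notMem ha] at h
  omega

theorem left_step [Finite A] {k : ℕ} {M M' : MQ A} (hg : Good n f k M)
    (hl : LeftP M.hom M'.hom) (u0 : FreeMonoid A) (hu : (wc u0).ncard = k + 1) :
    ∃ X m0, Rl n f (wc u0) X ∧ wc m0 ⊆ wc u0 ∧ M'.cl f u0 ⊆ X * M.cl f m0 := by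
  obtain ⟨a, u1, u2, h1, h2, h3⟩ := exists_last_new u0 (ne_one_of_wc hu)
  have hc : (wc u1).ncard ≤ k := ncard_new hu h2 h3
  refine ⟨M.cl f u1 * {((f a : S) : WithOne S)}, u2, ?_, ?_, ?_⟩
  · rw [← h3]; exact (hg u1 hc).mul (Rl.letter a)
  · rw [h1, wc_mul]; exact Set.subset_union_right
  · rintro _ ⟨v, hv, rfl⟩
    obtain ⟨v1, v2, rfl, -, e1, e2⟩ := (hl u0 v (Eq.symm hv)).2.2 a u1 u2 h1 h2
    rw [map_mul, map_mul]
    exact Set.mul_mem_mul (Set.mul_mem_mul ⟨v1, e1.symm, rfl⟩ rfl) ⟨v2, e2.symm, rfl⟩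

theorem right_step [Finite A] {k : ℕ} {M M' : MQ A} (hg : Good n f k M)
    (hl : RightP M.hom M'.hom) (u0 : FreeMonoid A) (hu : (wc u0).ncard = k + 1) :
    ∃ X m0, Rl n f (wc u0) X ∧ wc m0 ⊆ wc u0 ∧ M'.cl f u0 ⊆ M.cl f m0 * X := by
  obtain ⟨a, u1, u2, h1, h2, h3⟩ := exists_first_new u0 (ne_one_of_wc hu)
  have hc : (wc u2).ncard ≤ k := ncard_new hu h2 h3
  refine ⟨{((f a : S) : WithOne S)} * M.cl f u2, u1, ?_, ?_, ?_⟩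
  · rw [← h3, Set.union_comm]; exact (Rl.letter a).mul (hg u2 hc)
  · rw [h1, wc_mul, wc_mul]; exact Set.subset_union_left.trans Set.subset_union_left
  · rintro _ ⟨v, hv, rfl⟩
    obtain ⟨v1, v2, rfl, -, e1, e2⟩ := (hl u0 v (Eq.symm hv)).2.2 a u1 u2 h1 h2
    rw [map_mul, map_mul, mul_assoc]
    exact Set.mul_mem_mul ⟨v1, e1.symm, rfl⟩ (Set.mul_mem_mul rfl ⟨v2, e2.symm, rfl⟩)

theorem left_peel [Finite A] {k : ℕ} {M : MQ A} (hg : Good n f k M) (hco : M.Co) (K : ℕ) :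
    ∃ M' : MQ A, M'.Le M ∧ ∀ u0, (wc u0).ncard = k + 1 → Rl n f (wc u0) (M'.cl f u0) ∨
      ∃ Xs : List (Set (WithOne S)), ∃ m0, Xs.length = K ∧ (∀ X ∈ Xs, Rl n f (wc u0) X) ∧
        wc m0 = wc u0 ∧ M'.cl f u0 ⊆ Xs.prod * M.cl f m0 := by
  induction K with
  | zero =>
    refine ⟨M, fun _ _ h => h, fun u0 _ => Or.inr ⟨[], u0, rfl, by simp, rfl, ?_⟩⟩
    rw [List.prod_nil, one_mul]
  | succ K ih =>
    obtain ⟨M1, hle, h1⟩ := ih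
    obtain ⟨M2, hl⟩ := M1.left
    refine ⟨M2, fun u v h => hle _ _ (hl u v h).1, fun u0 hu => ?_⟩
    obtain ⟨X, m, hX, hm, hs⟩ := left_step (hg.le hle) hl u0 hu
    by_cases hmc : wc m = wc u0
    · rcases h1 m (by rw [hmc, hu]) with h2 | ⟨Xs, m0, k1, k2, k3, k4⟩
      · left
        have := hX.mul h2
        rw [hmc, Set.union_self] at this
        exact this.mono hs
      · right
        refine ⟨X :: Xs, m0, by simp [k1], ?_, by rw [k3, hmc], ?_⟩
        · intro Y hY
          rcases List.mem_cons.1 hY with rfl | hY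
          · exact hX
          · rw [← hmc]; exact k2 Y hY
        · rw [List.prod_cons, mul_assoc]
          exact hs.trans (Set.mul_subset_mul_left k4)
    · left
      have hlt := Set.ncard_lt_ncard (hm.ssubset_of_ne hmc) (Set.toFinite _)
      have := hX.mul (hg.le hle m (by omega))
      rw [Set.union_eq_self_of_subset_right hm] at this
      exact this.mono hs

theorem right_peel [Finite A] {k : ℕ} {M : MQ A} (hg : Good n f k M) (hco : M.Co) (K : ℕ) :
    ∃ M' : MQ A, M'.Le M ∧ ∀ u0, (wc u0).ncard = k + 1 → Rl n f (wc u0) (M'.cl f u0) ∨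
      ∃ Xs : List (Set (WithOne S)), ∃ m0, Xs.length = K ∧ (∀ X ∈ Xs, Rl n f (wc u0) X) ∧
        wc m0 = wc u0 ∧ M'.cl f u0 ⊆ M.cl f m0 * Xs.prod := by
  induction K with
  | zero =>
    refine ⟨M, fun _ _ h => h, fun u0 _ => Or.inr ⟨[], u0, rfl, by simp, rfl, ?_⟩⟩
    rw [List.prod_nil, mul_one]
  | succ K ih =>
    obtain ⟨M1, hle, h1⟩ := ih
    obtain ⟨M2, hl⟩ := M1.right
    refine ⟨M2, fun u v h => hle _ _ (hl u v h).1, fun u0 hu => ?_⟩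
    obtain ⟨X, m, hX, hm, hs⟩ := right_step (hg.le hle) hl u0 hu
    by_cases hmc : wc m = wc u0
    · rcases h1 m (by rw [hmc, hu]) with h2 | ⟨Xs, m0, k1, k2, k3, k4⟩
      · left
        have := h2.mul hX
        rw [hmc, Set.union_self] at this
        exact this.mono hs
      · right
        refine ⟨Xs ++ [X], m0, by simp [k1], ?_, by rw [k3, hmc], ?_⟩
        · intro Y hY
          rcases List.mem_append.1 hY with hY | hY
          · rw [← hmc]; exact k2 Y hY
          · rw [List.mem_singleton.1 hY]; exact hX
        · rw [List.prod_append, List.prod_singleton, ← mul_assoc]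
          exact hs.trans (Set.mul_subset_mul_right k4)
    · left
      have hlt := Set.ncard_lt_ncard (hm.ssubset_of_ne hmc) (Set.toFinite _)
      have := (hg.le hle m (by omega)).mul hX
      rw [Set.union_eq_self_of_subset_left hm] at this
      exact this.mono hs

theorem exists_good [Finite S] [Finite A] (n : ℕ) (f : A → S) (k : ℕ) :
    ∃ M : MQ A, Good n f k M := by
  obtain ⟨H, hH⟩ := ashc n f
  suffices h : ∃ M : MQ A, Good n f k M ∧ M.Co ∧
      ∀ u v, M.hom u = M.hom v → H.hom (toFG u) = H.hom (toFG v) by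
    obtain ⟨M, h, -⟩ := h
    exact ⟨M, h⟩
  induction k with
  | zero =>
    let M0 : MQ A := ⟨H.G, H.hom.comp toFG, DOm.of_group H.G⟩
    obtain ⟨M, hM⟩ := M0.left
    have hco : M.Co := fun u v h => Set.ext (hM u v h).2.1
    refine ⟨M, ?_, hco, fun u v h => (hM u v h).1⟩
    intro u0 hu
    have h0 : wc u0 = ∅ := by
      rw [← Set.ncard_eq_zero (Set.toFinite _)]; omega
    have e1 : ∀ u : FreeMonoid A, wc u = ∅ → u = 1 := by
      intro u
      induction u using FreeMonoid.inductionOn' with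
      | one => exact fun _ => rfl
      | of_mul b v _ =>
        intro h
        rw [wc_mul, wc_of] at h
        have : b ∈ (∅ : Set A) := h ▸ Or.inl rfl
        exact this.elim
    rw [h0]
    refine Rl.one.mono ?_
    rintro _ ⟨u, hu, rfl⟩
    rw [e1 u (by rw [hco _ _ hu, h0]), map_one]
    rfl
  | succ k ih =>
    obtain ⟨M, hg, hco, hMH⟩ := ih
    obtain ⟨M1, hle1, h1⟩ := right_peel hg hco (Nat.card (Set (WithOne S)))
    have hco1 : M1.Co := fun u v h => hco u v (hle1 u v h)
    obtain ⟨M2, hle2, h2⟩ := left_peel (hg.le hle1) hco1 (Nat.card (Set (WithOne S)))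
    have hle := hle2.trans hle1
    refine ⟨M2, ?_, fun u v h => hco u v (hle u v h), fun u v h => hMH u v (hle u v h)⟩
    intro u0 hu
    rcases Nat.lt_or_ge k (wc u0).ncard with hlt | hlt
    swap
    · exact hg.le hle u0 hlt
    have hu' : (wc u0).ncard = k + 1 := by omega
    have hne : (wc u0).Nonempty := by
      rw [← Set.ncard_pos (Set.toFinite _)]; omega
    rcases h2 u0 hu' with h | ⟨Xs, m0, a1, a2, a3, a4⟩
    · exact h
    rcases h1 m0 (by rw [a3, hu']) with h | ⟨Ys, m1, b1, b2, b3, b4⟩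
    · obtain ⟨⟨B', hB', hr⟩, -⟩ := Rl.list_prod Xs a2
      have := hr.mul h
      rw [a3, Set.union_eq_self_of_subset_left hB'] at this
      exact this.mono a4
    rw [a3] at b2 b3
    obtain ⟨γ, hγ⟩ := hH (H.hom (toFG m1))
    have gZ : Gr n f (wc u0) (M.cl f m1) := by
      refine ⟨γ, ?_⟩
      rintro _ ⟨u, hu, rfl⟩
      obtain ⟨o, o1, o2, o3⟩ := hγ u (hMH _ _ hu)
      refine ⟨o, o1, ?_, o2⟩
      rw [o3, hco _ _ hu, b3]
    refine (Rl.final hne Xs Ys a2 b2 a1.ge b1.ge gZ).mono ?_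
    rw [mul_assoc]
    exact a4.trans (Set.mul_subset_mul_left b4)
end


theorem exists_word {S A : Type} [Semigroup S] (φ : FreeSemigroup A →ₙ* S) (w : FreeSemigroup A) :
    ∃ u, wev (fun a => φ (FreeSemigroup.of a)) u = ((φ w : S) : WithOne S) := by
  induction w using FreeSemigroup.recOnMul with
  | ih1 a => exact ⟨FreeMonoid.of a, rfl⟩
  | ih2 a w h1 h2 =>
    obtain ⟨u, hu⟩ := h1
    obtain ⟨v, hv⟩ := h2
    exact ⟨u * v, by rw [map_mul, hu, hv, map_mul, WithOne.coe_mul]⟩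

/-- The pseudovariety `DO` is κ-reducible for pointlike sets. -/
theorem DO_kappa_reducible_for_pointlikes
    {S : Type} [Semigroup S] [Finite S]
    (P : Set S) (hP : IsDOPointlike P)
    (A : Type) [Finite A]
    (φ : FreeSemigroup A →ₙ* S) (hφ : Function.Surjective φ) :
    ∃ w : P → KTerm A,
      (∀ p : P, KEval (fun a => φ (FreeSemigroup.of a)) (w p) (p : S)) ∧
      (∀ (T : Type) [Semigroup T] [Finite T], InDO T →
        ∀ f : A → T, ∃ t : T, ∀ p : P, KEval f (w p) t) := by

  classical
  set f : A → S := fun a => φ (FreeSemigroup.of a) with hf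
  have hA : Nonempty A := by
    by_contra hA
    have hS : IsEmpty S := ⟨fun s => by
      obtain ⟨w, -⟩ := hφ s
      exact hA ⟨w.head⟩⟩
    obtain ⟨t, -⟩ := hP S (fun s => (hS.false s).elim) ⊤ (fun s => (hS.false s).elim)
    exact hS.false t
  obtain ⟨a0⟩ := hA
  obtain ⟨n, hn⟩ := exists_idemExp S
  obtain ⟨M, hM⟩ := exists_good n f (Nat.card A)
  let R : Subsemigroup (S × M.Q) :=
    { carrier := {x | ∃ u, wev f u = ((x.1 : S) : WithOne S) ∧ M.hom u = x.2}
      mul_mem' := by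
        rintro x y ⟨u, h1, h2⟩ ⟨v, h3, h4⟩
        exact ⟨u * v, by rw [map_mul, h1, h3]; rfl, by rw [map_mul, h2, h4]; rfl⟩ }
  obtain ⟨t, ht⟩ := hP M.Q M.dom.inDO R (by
    intro s
    obtain ⟨w, rfl⟩ := hφ s
    obtain ⟨u, hu⟩ := exists_word φ w
    exact ⟨M.hom u, u, hu, rfl⟩)
  by_cases hne : ∃ p0, p0 ∈ P
  swap
  · refine ⟨fun p => (hne ⟨p.1, p.2⟩).elim, fun p => (hne ⟨p.1, p.2⟩).elim, ?_⟩
    intro T _ _ _ g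
    exact ⟨g a0, fun p => (hne ⟨p.1, p.2⟩).elim⟩
  obtain ⟨p0, hp0⟩ := hne
  obtain ⟨u0, -, hu0⟩ := ht p0 hp0
  obtain ⟨K, -, h2, h3⟩ := hM u0 (Set.ncard_le_card _)
  have key : ∀ p : P, ∃ w : KTerm A, some w ∈ K ∧ sv n f w = p := by
    rintro ⟨p, hp⟩
    obtain ⟨u, hu, hut⟩ := ht p hp
    obtain ⟨o, ho, hop⟩ := h3 (wev f u) ⟨u, hut.trans hu0.symm, rfl⟩
    rw [hu] at hop
    rcases o with _ | w
    · exact absurd hop.symm WithOne.coe_ne_one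
    · exact ⟨w, ho, WithOne.coe_injective hop⟩
  choose w hw1 hw2 using key
  refine ⟨w, fun p => ?_, fun T _ _ hT g => ?_⟩
  · have := kEval_sv hn f (w p)
    rwa [hw2] at this
  · obtain ⟨m, hm⟩ := exists_idemExp T
    refine ⟨sv m g (w ⟨p0, hp0⟩), fun p => ?_⟩
    have e := (h2 _ (hw1 p) _ (hw1 ⟨p0, hp0⟩)).2 T hT m hm g
    rw [← WithOne.coe_injective e]
    exact kEval_sv hm g (w p)
end
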